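/- Let K be a finite 2-dimensional geometric simplicial complex in ℝⁿ such that |K| is connected, K is locally planar, every edge of K is an interior edge (K has no boundary edges), and K is not orientable. Then the genus g of the space |K| satisfies g = 2 − χ(K). -/

import Mathlib

open Geometry

namespace PaperAlg

/-- Points of `ℝⁿ`. -/
abbrev Pt (n : ℕ) := EuclideanSpace ℝ (Fin n)

variable {n : ℕ}

/-- The 1-skeleton graph of a geometric simplicial complex `K`: its vertex set is the set of
vertices of `K`, and two vertices are adjacent iff they form an edge (a two-element face) of `K`. -/
def skeletonGraph (K : SimplicialComplex ℝ (Pt n)) : SimpleGraph K.vertices where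
  Adj u v := (u : Pt n) ≠ (v : Pt n) ∧
    ∃ s ∈ K.faces, (s : Set (Pt n)) = {(u : Pt n), (v : Pt n)}
  symm := by
    constructor
    rintro u v ⟨hne, s, hs, hset⟩
    exact ⟨fun h => hne h.symm, s, hs, by rw [hset, Set.pair_comm]⟩
  loopless := by constructor; rintro u ⟨hne, -⟩; exact hne rfl

/-- `K` is 2-dimensional: every face has at most three elements. -/
def TwoDimensional (K : SimplicialComplex ℝ (Pt n)) : Prop :=
  ∀ s ∈ K.faces, s.card ≤ 3

/-- The set of triangles (three-element faces) of `K` containing the finset `e`. -/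
def trianglesContaining (K : SimplicialComplex ℝ (Pt n)) (e : Finset (Pt n)) :
    Set (Finset (Pt n)) :=
  {t | t ∈ K.faces ∧ t.card = 3 ∧ e ⊆ t}

/-- An edge of `K` contained in exactly one triangle. -/
def IsBoundaryEdge (K : SimplicialComplex ℝ (Pt n)) (e : Finset (Pt n)) : Prop :=
  e ∈ K.faces ∧ e.card = 2 ∧ (trianglesContaining K e).ncard = 1

/-- An edge of `K` contained in exactly two triangles. -/
def IsInteriorEdge (K : SimplicialComplex ℝ (Pt n)) (e : Finset (Pt n)) : Prop :=
  e ∈ K.faces ∧ e.card = 2 ∧ (trianglesContaining K e).ncard = 2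

/-- The closed upper half-plane `{(a, b) ∈ ℝ² : b ≥ 0}`. -/
def HalfPlane : Set (ℝ × ℝ) := {p | 0 ≤ p.2}

/-- `x` has a neighborhood in `|K|` homeomorphic to an open subset of `ℝ²`. -/
def HasPlanarNbhd (K : SimplicialComplex ℝ (Pt n)) (x : Pt n) : Prop :=
  ∃ U : Set (Pt n), U ⊆ K.space ∧ U ∈ nhdsWithin x K.space ∧
    ∃ V : Set (ℝ × ℝ), IsOpen V ∧ Nonempty (↥U ≃ₜ ↥V)

/-- `x` has a neighborhood in `|K|` homeomorphic to an open subset of the closed half-plane. -/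
def HasHalfPlanarNbhd (K : SimplicialComplex ℝ (Pt n)) (x : Pt n) : Prop :=
  ∃ U : Set (Pt n), U ⊆ K.space ∧ U ∈ nhdsWithin x K.space ∧
    ∃ V : Set ↥HalfPlane, IsOpen V ∧ Nonempty (↥U ≃ₜ ↥V)

/-- `x` is a locally planar point of `|K|`. -/
def IsLocallyPlanarPt (K : SimplicialComplex ℝ (Pt n)) (x : Pt n) : Prop :=
  x ∈ K.space ∧ (HasPlanarNbhd K x ∨ HasHalfPlanarNbhd K x)

/-- `K` is locally planar if every point of `|K|` is locally planar. -/
def LocallyPlanar (K : SimplicialComplex ℝ (Pt n)) : Prop :=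
  ∀ x ∈ K.space, IsLocallyPlanarPt K x

/-- The vertices `a` of `K` such that `{v, a}` is an edge of `K`. -/
def linkVertices (K : SimplicialComplex ℝ (Pt n)) (v : Pt n) : Set (Pt n) :=
  {a | a ≠ v ∧ ∃ s ∈ K.faces, (s : Set (Pt n)) = {v, a}}

/-- The link graph `L(v)`: vertices are the `a` with `{v, a}` an edge of `K`, and `a`, `b`
are adjacent iff `{v, a, b}` is a triangle of `K`. -/
def linkGraph (K : SimplicialComplex ℝ (Pt n)) (v : Pt n) :
    SimpleGraph (linkVertices K v) where
  Adj a b := (a : Pt n) ≠ (b : Pt n) ∧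
    ∃ t ∈ K.faces, t.card = 3 ∧ (t : Set (Pt n)) = {v, (a : Pt n), (b : Pt n)}
  symm := by
    constructor
    rintro a b ⟨hne, t, ht, hc, hset⟩
    exact ⟨fun h => hne h.symm, t, ht, hc, by rw [hset, Set.pair_comm]⟩
  loopless := by constructor; rintro a ⟨hne, -⟩; exact hne rfl

/-- The vertices of `K` lying on some boundary edge. -/
def boundaryVertices (K : SimplicialComplex ℝ (Pt n)) : Set (Pt n) :=
  {v | ∃ e, IsBoundaryEdge K e ∧ v ∈ e}

/-- The boundary graph of `K`: the simple graph formed by the boundary edges of `K`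
and their endpoints. -/
def boundaryGraph (K : SimplicialComplex ℝ (Pt n)) :
    SimpleGraph (boundaryVertices K) where
  Adj u v := (u : Pt n) ≠ (v : Pt n) ∧
    ∃ e, IsBoundaryEdge K e ∧ (e : Set (Pt n)) = {(u : Pt n), (v : Pt n)}
  symm := by
    constructor
    rintro u v ⟨hne, e, he, hset⟩
    exact ⟨fun h => hne h.symm, e, he, by rw [hset, Set.pair_comm]⟩
  loopless := by constructor; rintro u ⟨hne, -⟩; exact hne rfl

/-- The Euler characteristic `χ(K) = V - E + F`. -/
noncomputable def eulerChar (K : SimplicialComplex ℝ (Pt n)) : ℤ :=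
  (K.vertices.ncard : ℤ)
    - ({e : Finset (Pt n) | e ∈ K.faces ∧ e.card = 2}.ncard : ℤ)
    + ({t : Finset (Pt n) | t ∈ K.faces ∧ t.card = 3}.ncard : ℤ)

/-- The three directed edges induced on its boundary by the cyclic ordering `(a, b, c)`. -/
def triDirs (o : Pt n × Pt n × Pt n) : Set (Pt n × Pt n) :=
  {(o.1, o.2.1), (o.2.1, o.2.2), (o.2.2, o.1)}

/-- `K` is orientable: one can assign to each triangle a cyclic ordering of its vertices so
that the two triangles containing any interior edge induce opposite directions on it. -/
def Orientable (K : SimplicialComplex ℝ (Pt n)) : Prop :=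
  ∃ ori : Finset (Pt n) → Pt n × Pt n × Pt n,
    (∀ t ∈ K.faces, t.card = 3 →
      (t : Set (Pt n)) = {(ori t).1, (ori t).2.1, (ori t).2.2}) ∧
    (∀ t₁ ∈ K.faces, ∀ t₂ ∈ K.faces, t₁.card = 3 → t₂.card = 3 → t₁ ≠ t₂ →
      ∀ e ∈ K.faces, e.card = 2 → e ⊆ t₁ → e ⊆ t₂ →
      ∀ x y : Pt n, x ∈ e → y ∈ e → x ≠ y →
        (x, y) ∈ triDirs (ori t₁) → (y, x) ∈ triDirs (ori t₂))

/-- The genus of a topological space `X`: the supremum of the numbers `m` for which there exist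
`m` pairwise disjoint subsets of `X`, each homeomorphic to the circle `S¹`, whose union has
connected complement. -/
noncomputable def genus (X : Type*) [TopologicalSpace X] : ℕ :=
  sSup {m : ℕ | ∃ C : Fin m → Set X,
    (Pairwise fun i j => Disjoint (C i) (C j)) ∧
    (∀ i, Nonempty (↥(C i) ≃ₜ ↥(Metric.sphere (0 : EuclideanSpace ℝ (Fin 2)) 1))) ∧
    IsConnected (⋃ i, C i)ᶜ}

end PaperAlg

namespace PaperAlg
section Comb

inductive NC {α : Type*} : List α → Set (Sym2 α) → Prop
  | nil : NC [] ∅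
  | ins (u v : List α) (a b : α) (M : Set (Sym2 α)) :
      NC (u ++ v) M → NC (u ++ a :: b :: v) (insert s(a, b) M)

variable {α β : Type*}

theorem NC.append {u : List α} {M} (h : NC u M) {v : List α} {N} (h' : NC v N) :
    NC (u ++ v) (M ∪ N) := by
  induction h with
  | nil => simpa using h'
  | ins u1 u2 a b M _ ih =>
    have := NC.ins u1 (u2 ++ v) a b (M ∪ N) (by simpa using ih)
    rw [Set.insert_union]
    simpa using this

theorem NC.wrap {w : List α} {M} (h : NC w M) (a b : α) :
    NC (a :: (w ++ [b])) (insert s(a, b) M) := by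
  induction h with
  | nil => exact NC.ins [] [] a b ∅ NC.nil
  | ins u v c d M _ ih =>
    have := NC.ins (a :: u) (v ++ [b]) c d _ (by simpa using ih)
    rw [Set.insert_comm]
    simpa using this

theorem append_split {u v p q : List α} {a b : α} (h : u ++ v = p ++ a :: b :: q) :
    (∃ q1, u = p ++ a :: b :: q1 ∧ q = q1 ++ v) ∨ (∃ p2, v = p2 ++ a :: b :: q ∧ p = u ++ p2) ∨
    (u = p ++ [a] ∧ v = b :: q) := by
  rw [List.append_eq_append_iff] at h
  rcases h with ⟨c, h1, h2⟩ | ⟨c, h1, h2⟩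
  · exact Or.inr (Or.inl ⟨c, h2, h1⟩)
  · rcases c with _ | ⟨x, _ | ⟨y, c⟩⟩
    · exact Or.inr (Or.inl ⟨[], by simpa using h2.symm, by simpa using h1.symm⟩)
    · simp only [List.cons_append, List.nil_append, List.cons.injEq] at h2
      exact Or.inr (Or.inr ⟨by rw [h1, h2.1], h2.2.symm⟩)
    · simp only [List.cons_append, List.cons.injEq] at h2
      exact Or.inl ⟨c, by rw [h1, h2.1, h2.2.1], h2.2.2⟩

theorem NC.rot {w : List α} {M} (h : NC w M) : ∀ {u v}, w = u ++ v → NC (v ++ u) M := by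
  induction h with
  | nil =>
    intro u v h
    obtain ⟨rfl, rfl⟩ := List.append_eq_nil_iff.1 h.symm
    exact NC.nil
  | ins p q a b M _ ih =>
    intro u v h
    rcases append_split h.symm with ⟨q1, rfl, rfl⟩ | ⟨p2, rfl, rfl⟩ | ⟨rfl, rfl⟩
    · have := NC.ins (v ++ p) q1 a b M (by simpa using ih (u := p ++ q1) (v := v) (by simp))
      simpa using this
    · have := NC.ins p2 (q ++ u) a b M (by simpa using ih (u := u) (v := p2 ++ q) (by simp))
      simpa using this
    · have := (ih (u := p) (v := q) rfl).wrap b a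
      rw [Sym2.eq_swap]
      simpa using this

theorem NC.mem {w : List α} {M} (h : NC w M) : ∀ {a b}, s(a, b) ∈ M → a ∈ w ∧ b ∈ w := by
  induction h with
  | nil => simp
  | ins u v c d M _ ih =>
    intro a b hab
    rcases hab with hab | hab
    · rw [Sym2.eq_iff] at hab
      rcases hab with ⟨rfl, rfl⟩ | ⟨rfl, rfl⟩ <;> simp
    · have := ih hab
      simp only [List.mem_append, List.mem_cons] at this ⊢
      tauto

def A2 (ps cs : List α) : Set (Sym2 α) := {z | ∃ x ∈ ps.zip cs, z = s(x.1, x.2)}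

theorem A2_cons (p c : α) (ps cs : List α) : A2 (p :: ps) (c :: cs) = insert s(p, c) (A2 ps cs) := by
  ext z; simp [A2]

theorem NC.nest : ∀ (cs ds : List α) {u v : List α} {M}, cs.length = ds.length → NC (u ++ v) M →
    NC (u ++ (cs ++ (ds.reverse ++ v))) (M ∪ A2 cs ds)
  | [], [], u, v, M, _, h => by simpa [A2] using h
  | c :: cs, d :: ds, u, v, M, hl, h => by
    have := NC.nest cs ds (u := u ++ [c]) (v := d :: v) (by simpa using hl)
      (by simpa using NC.ins u v c d M h)
    rw [A2_cons, Set.union_insert]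
    simpa [Set.insert_union] using this

theorem NC.cut {w : List α} {M} (h : NC w M) : ∀ {u v}, w = u ++ v →
    ∃ (l : List (α × α)) (Mu Mv : Set (Sym2 α)),
      M = Mu ∪ Mv ∪ {z | ∃ x ∈ l, z = s(x.1, x.2)} ∧
      (∀ x ∈ l, x.1 ∈ u ∧ x.2 ∈ v) ∧
      (∀ z ∈ Mu, ∀ a ∈ z, a ∈ u) ∧ (∀ z ∈ Mv, ∀ a ∈ z, a ∈ v) ∧
      (∀ cs : List α, cs.length = l.length → NC (u ++ cs) (Mu ∪ A2 (l.map Prod.fst) cs)) ∧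
      (∀ ds : List α, ds.length = l.length →
        NC (ds.reverse ++ v) (Mv ∪ A2 (l.map Prod.snd) ds)) := by
  induction h with
  | nil =>
    intro u v h
    obtain ⟨rfl, rfl⟩ := List.append_eq_nil_iff.1 h.symm
    exact ⟨[], ∅, ∅, by simp, by simp, by simp, by simp,
      fun cs h => by simp at h; subst h; simpa [A2] using NC.nil,
      fun cs h => by simp at h; subst h; simpa [A2] using NC.nil⟩
  | ins p q a b M _ ih =>
    intro u v h
    rcases append_split h.symm with ⟨q1, rfl, rfl⟩ | ⟨p2, rfl, rfl⟩ | ⟨rfl, rfl⟩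
    · obtain ⟨l, Mu, Mv, h1, h2, h3, h4, h5, h6⟩ := ih (u := p ++ q1) (v := v) (by simp)
      refine ⟨l, insert s(a, b) Mu, Mv, by rw [h1]; simp [Set.insert_union], ?_, ?_, h4, ?_, h6⟩
      · intro x hx; have := h2 x hx
        simp only [List.mem_append, List.mem_cons] at this ⊢; tauto
      · rintro z (rfl | hz) c hc
        · simp only [Sym2.mem_iff] at hc; simp; tauto
        · have := h3 z hz c hc
          simp only [List.mem_append, List.mem_cons] at this ⊢; tauto
      · intro cs hcs
        have := NC.ins p (q1 ++ cs) a b _ (by simpa using h5 cs hcs)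
        simpa [Set.insert_union] using this
    · obtain ⟨l, Mu, Mv, h1, h2, h3, h4, h5, h6⟩ := ih (u := u) (v := p2 ++ q) (by simp)
      refine ⟨l, Mu, insert s(a, b) Mv, by rw [h1]; simp [Set.insert_union], ?_, h3, ?_, h5, ?_⟩
      · intro x hx; have := h2 x hx
        simp only [List.mem_append, List.mem_cons] at this ⊢; tauto
      · rintro z (rfl | hz) c hc
        · simp only [Sym2.mem_iff] at hc; simp; tauto
        · have := h4 z hz c hc
          simp only [List.mem_append, List.mem_cons] at this ⊢; tauto
      · intro ds hds
        have := NC.ins (ds.reverse ++ p2) q a b _ (by simpa using h6 ds hds)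
        simpa [Set.insert_union] using this
    · obtain ⟨l, Mu, Mv, h1, h2, h3, h4, h5, h6⟩ := ih (u := p) (v := q) rfl
      refine ⟨(a, b) :: l, Mu, Mv, ?_, ?_, ?_, ?_, ?_, ?_⟩
      · rw [h1, ← Set.union_insert]; congr 1; ext z; simp
      · intro x hx
        rcases List.mem_cons.1 hx with rfl | hx
        · simp
        · have := h2 x hx; simp; tauto
      · intro z hz c hc; have := h3 z hz c hc; simp; tauto
      · intro z hz c hc; have := h4 z hz c hc; simp; tauto
      · rintro (_ | ⟨c, cs⟩) hcs
        · simp at hcs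
        have := NC.ins p cs a c _ (h5 cs (by simpa using hcs))
        rw [List.map_cons, A2_cons, Set.union_insert]
        simpa using this
      · rintro (_ | ⟨c, cs⟩) hcs
        · simp at hcs
        have := NC.ins cs.reverse q c b _ (h6 cs (by simpa using hcs))
        rw [List.map_cons, A2_cons, Set.union_insert, Sym2.eq_swap]
        simpa using this

theorem NC.map {w : List α} {M} (h : NC w M) (f : α → β) : NC (w.map f) (Sym2.map f '' M) := by
  induction h with
  | nil => simpa using NC.nil
  | ins u v a b M _ ih =>
    have := NC.ins (u.map f) (v.map f) (f a) (f b) _ (by simpa using ih)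
    rw [Set.image_insert_eq]
    simpa using this

theorem NC.lift {w : List β} {M} (h : NC w M) (f : α → β) : ∀ {W : List α}, w = W.map f →
    ∃ M', NC W M' ∧ M = Sym2.map f '' M' := by
  induction h with
  | nil =>
    intro W h
    obtain rfl : W = [] := by simpa using h.symm
    exact ⟨∅, NC.nil, by simp⟩
  | ins u v a b M _ ih =>
    intro W h
    obtain ⟨U, V', rfl, rfl, h2⟩ := List.map_eq_append_iff.1 h.symm
    obtain ⟨a', V'', rfl, rfl, h3⟩ := List.map_eq_cons_iff.1 h2
    obtain ⟨b', V, rfl, rfl, rfl⟩ := List.map_eq_cons_iff.1 h3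
    obtain ⟨M', h1, rfl⟩ := ih (W := U ++ V) (by simp)
    exact ⟨_, NC.ins U V a' b' M' h1, by simp [Set.image_insert_eq]⟩

inductive NCs {α : Type*} : List (List α) → Set (Sym2 α) → Prop
  | nil : NCs [] ∅
  | cons (w ws M N) : NC w M → NCs ws N → NCs (w :: ws) (M ∪ N)

variable {Λ : Type*} {Lab : Type}

def E (pts : Λ → List Lab) (x : Λ × Bool) : List (Lab × Bool) :=
  if x.2 then (pts x.1).map (·, true) else (pts x.1).reverse.map (·, false)

def Ew (pts : Λ → List Lab) (w : List (Λ × Bool)) : List (Lab × Bool) := w.flatMap (E pts)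

def Inv (v : Lab → Bool → Bool) (M : Set (Sym2 (Lab × Bool))) : Prop :=
  ∀ a b, s(a, b) ∈ M → v a.1 a.2 = v b.1 (!b.2)

def KInv (κ : Lab → ℕ) (M : Set (Sym2 (Lab × Bool))) : Prop :=
  ∀ a b, s(a, b) ∈ M → κ a.1 = κ b.1

def GoodS (k : ℕ) (pts : Λ → List Lab) (M : Set (Sym2 (Lab × Bool))) : Prop :=
  (∀ x, (pts x).Nodup) ∧ (∀ x y l, l ∈ pts x → l ∈ pts y → x = y) ∧
  (∀ v, Inv v M → ∀ x, ∀ l ∈ pts x, v l true = v l false) ∧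
  ∃ κ : Lab → ℕ, KInv κ M ∧ ∀ j < k, ∃ x, ∃ l ∈ pts x, κ l = j

def Good (k : ℕ) (P : List (List (Λ × Bool))) : Prop :=
  ∃ (Lab : Type) (pts : Λ → List Lab) (M : Set (Sym2 (Lab × Bool))),
    GoodS k pts M ∧ NCs (P.map (Ew pts)) M

theorem Good.mono {k k' : ℕ} (h : k' ≤ k) {P : List (List (Λ × Bool))} (H : Good k P) :
    Good k' P := by
  obtain ⟨L, pts, M, ⟨h1, h2, h3, κ, h4, h5⟩, h6⟩ := H
  exact ⟨L, pts, M, ⟨h1, h2, h3, κ, h4, fun j hj => h5 j (by omega)⟩, h6⟩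

theorem NCs_single {w : List α} {M} : NCs [w] M ↔ NC w M := by
  constructor
  · intro h
    cases h with
    | cons _ _ M N h1 h2 => cases h2; simpa using h1
  · intro h; simpa using NCs.cons w [] M ∅ h NCs.nil

theorem Ew_append (pts : Λ → List Lab) (u v) : Ew pts (u ++ v) = Ew pts u ++ Ew pts v := by
  simp [Ew]

theorem Ew_cons (pts : Λ → List Lab) (u v) : Ew pts (u :: v) = E pts u ++ Ew pts v := by
  simp [Ew]

theorem mem_E {pts : Λ → List Lab} {x d} {o : Lab × Bool} (h : o ∈ E pts (x, d)) :
    o.1 ∈ pts x ∧ o.2 = d := by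
  cases d <;> simp [E] at h <;> obtain ⟨a, h, rfl⟩ := h <;> simp [h]

theorem Good.rot {k} {u v : List (Λ × Bool)} (h : Good k [v ++ u]) : Good k [u ++ v] := by
  obtain ⟨L, pts, M, h1, h2⟩ := h
  refine ⟨L, pts, M, h1, ?_⟩
  simp only [List.map_cons, List.map_nil, NCs_single, Ew_append] at h2 ⊢
  exact h2.rot rfl

theorem Good.zero {P : List (List (Λ × Bool))} : Good 0 P := by
  refine ⟨ℕ, fun _ => [], ∅, ⟨by simp, by simp, by simp, fun _ => 0, by simp [KInv], by simp⟩, ?_⟩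
  induction P with
  | nil => exact NCs.nil
  | cons w P ih =>
    have : Ew (fun _ : Λ => ([] : List ℕ)) w = [] := by simp [Ew, E]
    simpa [this] using NCs.cons [] _ ∅ ∅ NC.nil ih

end Comb
end PaperAlg

namespace PaperAlg
section Comb
variable {α β : Type*} {Λ : Type*} {Lab : Type}

theorem E_flip (pts : Λ → List Lab) (a : Λ) (d : Bool) :
    E pts (a, d) = ((E pts (a, !d)).map fun o => (o.1, d)).reverse := by
  cases d <;> simp [E, Function.comp_def]

theorem E_congr {pts : Λ → List Lab} {Lab' : Type} {pts' : Λ → List Lab'} {f : Lab → Lab'} {y : Λ × Bool}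
    (h : pts' y.1 = (pts y.1).map f) : E pts' y = (E pts y).map (Prod.map f id) := by
  obtain ⟨y, d⟩ := y
  cases d <;> simp_all [E, Function.comp_def]

theorem Ew_congr {pts : Λ → List Lab} {Lab' : Type} {pts' : Λ → List Lab'} {f : Lab → Lab'}
    {w : List (Λ × Bool)}
    (h : ∀ y ∈ w, pts' y.1 = (pts y.1).map f) : Ew pts' w = (Ew pts w).map (Prod.map f id) := by
  induction w with
  | nil => simp [Ew]
  | cons y w ih =>
    rw [Ew_cons, Ew_cons, ih fun z hz => h z (by simp [hz]), E_congr (h y (by simp))]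
    simp

theorem bool_aux (f g : Bool → Bool) (dx da : Bool) (h1 : f dx = g (!da)) (h2 : f (!dx) = g (!!da))
    (h3 : g true = g false) : f true = f false := by
  cases dx <;> cases da <;> simp_all

set_option maxHeartbeats 1000000 in
theorem Good.slide {k : ℕ} {x a : Λ} {dx da : Bool} {B C : List (Λ × Bool)} (hax : a ≠ x)
    (hB : ∀ y ∈ B, y.1 ≠ x) (hC : ∀ y ∈ C, y.1 ≠ x)
    (h : Good k [(x, dx) :: B ++ (x, dx) :: (a, !da) :: C]) :
    Good k [(x, dx) :: (a, da) :: B ++ (x, dx) :: C] := by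
  classical
  obtain ⟨L, pts, M, ⟨h1, h2, h3, κ, h4, h5⟩, h6⟩ := h
  set A := E pts (a, !da) with hA
  set Y : List (L ⊕ L) := A.map (fun o => Sum.inr o.1) with hY
  set il : L → L ⊕ L := Sum.inl
  let pts' : Λ → List (L ⊕ L) := fun y => if y = x then
    (if dx then (pts x).map il ++ Y else Y.reverse ++ (pts x).map il) else (pts y).map il
  have hp : ∀ y, y ≠ x → pts' y = (pts y).map il := fun y hy => by simp [pts', hy]
  set XE : List ((L ⊕ L) × Bool) := A.map (fun o => (Sum.inr o.1, dx)) with hXE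
  have hEx : E pts' (x, dx) = (E pts (x, dx)).map (Prod.map il id) ++ XE := by
    cases dx <;> simp [E, pts', hXE, hY, Function.comp_def]
  have hYn : Y.Nodup := by
    have := h1 a
    rw [hY, hA]
    cases da
    · simp only [E, Bool.not_false, if_true, List.map_map, Function.comp_def]
      exact List.Nodup.map Sum.inr_injective this
    · simp only [E, Bool.not_true, Bool.false_eq_true, if_false, List.map_map, Function.comp_def]
      exact List.Nodup.map Sum.inr_injective (List.nodup_reverse.2 this)
  have hYm : ∀ l ∈ Y, ∃ o ∈ pts a, l = Sum.inr o := by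
    intro l hl
    obtain ⟨o, ho, rfl⟩ := List.mem_map.1 hl
    exact ⟨o.1, (mem_E ho).1, rfl⟩
  have hpm : ∀ y l, l ∈ pts' y → (∃ o ∈ pts y, l = Sum.inl o) ∨ (y = x ∧ ∃ o ∈ pts a, l = Sum.inr o) := by
    intro y l hl
    by_cases hy : y = x
    · subst hy
      have : l ∈ (pts y).map il ∨ l ∈ Y := by
        cases dx <;> simp only [pts', if_true, if_false, List.mem_append, List.mem_reverse, Bool.false_eq_true] at hl <;> tauto
      rcases this with h | h
      · obtain ⟨o, ho, rfl⟩ := List.mem_map.1 h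
        exact Or.inl ⟨o, ho, rfl⟩
      · exact Or.inr ⟨rfl, hYm l h⟩
    · rw [hp y hy] at hl
      obtain ⟨o, ho, rfl⟩ := List.mem_map.1 hl
      exact Or.inl ⟨o, ho, rfl⟩
  simp only [List.map_cons, List.map_nil, NCs_single, Ew_append, Ew_cons, List.cons_append] at h6
  rw [← hA] at h6
  set tf : L × Bool → (L × Bool) × Bool := fun o => (o, false)
  set tt : L × Bool → (L × Bool) × Bool := fun o => (o, true)
  set U := E pts (x, dx)
  obtain ⟨M', h7, h8⟩ := h6.lift (W := U.map tf ++ ((Ew pts B).map tf ++ (U.map tf ++ (A.map tt ++ (Ew pts C).map tf)))) Prod.fst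
    (by simp [tf, tt, Function.comp_def])
  let g : (L × Bool) × Bool → (L ⊕ L) × Bool := fun z => if z.2 then (Sum.inr z.1.1, dx) else (Sum.inl z.1.1, z.1.2)
  have h9 := h7.map g
  have hgf : g ∘ tf = Prod.map il id := by ext z <;> simp [g, tf, il]
  have hgt : g ∘ tt = fun o => (Sum.inr o.1, dx) := by ext z <;> simp [g, tt]
  simp only [List.map_append, List.map_map, hgf, hgt] at h9
  rw [← hXE] at h9
  have h10 := NC.nest XE (A.map fun o => (il o.1, da)) (u := U.map (Prod.map il id)) (by simp [hXE]) h9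
  have hAe : (A.map fun o => (il o.1, da)).reverse = E pts' (a, da) := by
    rw [E_congr (hp a hax), E_flip]
    simp [Function.comp_def, il, hA]
  have hW : ∀ z, z ∈ U.map tf ++ ((Ew pts B).map tf ++ (U.map tf ++ (A.map tt ++ (Ew pts C).map tf))) →
      z.2 = true → z.1 ∈ A := by
    intro z hz hz2
    simp only [List.mem_append, List.mem_map] at hz
    rcases hz with ⟨o, ho, rfl⟩ | ⟨o, ho, rfl⟩ | ⟨o, ho, rfl⟩ | ⟨o, ho, rfl⟩ | ⟨o, ho, rfl⟩ <;> simp [tf, tt] at hz2 ⊢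
    exact ho
  have hA2 : ∀ o ∈ A, s(((Sum.inr o.1 : L ⊕ L), dx), ((Sum.inl o.1 : L ⊕ L), da)) ∈ A2 XE (A.map fun o => (il o.1, da)) := by
    intro o ho
    refine ⟨((Sum.inr o.1, dx), (Sum.inl o.1, da)), ?_, rfl⟩
    rw [hXE, List.zip_map', List.mem_map]
    exact ⟨o, ho, rfl⟩
  refine ⟨L ⊕ L, pts', Sym2.map g '' M' ∪ A2 XE (A.map fun o => (il o.1, da)), ⟨?_, ?_, ?_, Sum.elim κ κ, ?_, ?_⟩, ?_⟩
  · intro y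
    by_cases hy : y = x
    · have hd : List.Disjoint ((pts x).map il) Y := by
        intro l hl hl'
        obtain ⟨o, -, rfl⟩ := hYm l hl'
        simp [il] at hl
      have hn : ((pts x).map il).Nodup := List.Nodup.map Sum.inl_injective (h1 x)
      cases dx
      · simp only [pts', hy, if_true, Bool.false_eq_true, if_false]
        exact List.Nodup.append (List.nodup_reverse.2 hYn) hn (by
          intro l hl hl'; exact hd hl' (by simpa using hl))
      · simp only [pts', hy, if_true]
        exact List.Nodup.append hn hYn hd
    · rw [hp y hy]; exact List.Nodup.map Sum.inl_injective (h1 y)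
  · intro y z l hl hl'
    rcases hpm _ _ hl with ⟨o, ho, rfl⟩ | ⟨rfl, o, ho, rfl⟩ <;>
    rcases hpm _ _ hl' with ⟨o', ho', h⟩ | ⟨rfl, o', ho', h⟩
    · exact h2 y z o ho (by cases h; exact ho')
    · cases h
    · cases h
    · rfl
  · intro v hv
    have e1 : ∀ o ∈ A, v (Sum.inr o.1) dx = v (Sum.inl o.1) o.2 ∧ v (Sum.inr o.1) (!dx) = v (Sum.inl o.1) (!o.2) := by
      intro o ho
      have hd := (mem_E ho).2
      have := hv _ _ (Or.inr (hA2 o ho))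
      have h' := hv _ _ (Or.inr (Sym2.eq_swap ▸ hA2 o ho))
      simp only [hd, Bool.not_not] at this h' ⊢
      exact ⟨this, h'.symm⟩
    have e2 : Inv (fun l d => v (Sum.inl l) d) M := by
      intro p q hpq
      rw [h8] at hpq
      obtain ⟨z, hz, hzz⟩ := hpq
      induction z with | _ z1 z2
      have hm := h7.mem hz
      have key : ∀ z, z ∈ U.map tf ++ ((Ew pts B).map tf ++ (U.map tf ++ (A.map tt ++ (Ew pts C).map tf))) →
          v (g z).1 (g z).2 = v (Sum.inl z.1.1) z.1.2 ∧ v (g z).1 (!(g z).2) = v (Sum.inl z.1.1) (!z.1.2) := by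
        intro z hz
        by_cases h : z.2 = true
        · simpa [g, h] using e1 _ (hW z hz h)
        · simp [g, h]
      have e3 := hv (g z1) (g z2) (Or.inl ⟨_, hz, rfl⟩)
      have e4 := hv (g z2) (g z1) (Or.inl ⟨_, Sym2.eq_swap ▸ hz, rfl⟩)
      rw [(key _ hm.1).1, (key _ hm.2).2] at e3
      rw [(key _ hm.2).1, (key _ hm.1).2] at e4
      rw [Sym2.map_mk, Sym2.eq_iff] at hzz
      rcases hzz with ⟨rfl, rfl⟩ | ⟨rfl, rfl⟩
      · exact e3
      · exact e4
    have e3 := h3 _ e2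
    intro y l hl
    rcases hpm _ _ hl with ⟨o, ho, rfl⟩ | ⟨rfl, o, ho, rfl⟩
    · exact e3 y o ho
    · have : (o, !da) ∈ A := by cases da <;> simp [hA, E, ho]
      have := e1 _ this
      have h' := e3 a o ho
      exact bool_aux (v (Sum.inr o)) (v (Sum.inl o)) dx da this.1 this.2 h'
  · intro p q hpq
    rcases hpq with ⟨z, hz, hzz⟩ | ⟨z, hz, hzz⟩
    · induction z with | _ z1 z2
      have e := h4 z1.1 z2.1 (by rw [h8]; exact ⟨_, hz, rfl⟩)
      have key : ∀ z, Sum.elim κ κ (g z).1 = κ z.1.1 := by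
        intro z; by_cases h : z.2 = true <;> simp [g, h]
      rw [Sym2.map_mk, Sym2.eq_iff] at hzz
      rcases hzz with ⟨rfl, rfl⟩ | ⟨rfl, rfl⟩
      · rw [key, key, e]
      · rw [key, key, e]
    · rw [hXE, List.zip_map', List.mem_map] at hz
      obtain ⟨o, -, rfl⟩ := hz
      rw [Sym2.eq_iff] at hzz
      rcases hzz with ⟨rfl, rfl⟩ | ⟨rfl, rfl⟩ <;> simp [il]
  · intro j hj
    obtain ⟨y, l, hl, rfl⟩ := h5 j hj
    refine ⟨y, Sum.inl l, ?_, rfl⟩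
    by_cases hy : y = x
    · subst hy
      cases dx <;> simp [pts', il, hl]
    · rw [hp y hy]; exact List.mem_map.2 ⟨l, hl, rfl⟩
  · simp only [List.map_cons, List.map_nil, NCs_single, Ew_append, Ew_cons, List.cons_append]
    rw [hEx, ← hAe, Ew_congr fun y hy => hp y.1 (hB y hy), Ew_congr fun y hy => hp y.1 (hC y hy)]
    simpa using h10

theorem Good.isolate {k : ℕ} {x : Λ} {d : Bool} {A : List (Λ × Bool)}
    (hA : ∀ y ∈ A, y.1 ≠ x) (h : Good k [A]) : Good (k + 1) [(x, d) :: (x, d) :: A] := by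
  classical
  obtain ⟨L, pts, M, ⟨h1, h2, h3, κ, h4, h5⟩, h6⟩ := h
  rw [List.map_cons, List.map_nil, NCs_single] at h6
  let pts' : Λ → List (Option L) := fun y => if y = x then [none] else (pts y).map some
  have hp : ∀ y, y ≠ x → pts' y = (pts y).map some := fun y hy => by simp [pts', hy]
  have hx0 : pts x = [] := by
    rw [List.eq_nil_iff_forall_not_mem]
    intro l hl
    have hno : ∀ o ∈ Ew pts A, o.1 ≠ l := by
      rintro o ho rfl
      obtain ⟨y, hy, hoy⟩ := List.mem_flatMap.1 ho
      exact hA y hy (h2 _ _ _ (mem_E hoy).1 hl)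
    have := h3 (fun l' d => if l' = l then d else true) (by
      intro a b hab
      have := h6.mem hab
      simp [hno _ this.1, hno _ this.2]) x l hl
    simp at this
  let f : L × Bool → Option L × Bool := Prod.map some id
  have h7 := h6.map f
  have h8 := NC.ins [] _ (none, d) (none, d) _ (by simpa using h7)
  refine ⟨Option L, pts', insert s((none, d), (none, d)) (Sym2.map f '' M), ⟨?_, ?_, ?_, fun o => o.elim k κ, ?_, ?_⟩, NCs_single.2 ?_⟩
  · intro y
    by_cases hy : y = x
    · simp [pts', hy]
    · rw [hp y hy]; exact List.Nodup.map (Option.some_injective _) (h1 y)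
  · intro y z l hl hl'
    by_cases hy : y = x <;> by_cases hz : z = x <;> simp only [pts', hy, hz, if_true, if_false, List.mem_map, List.mem_singleton] at hl hl'
    · rw [hy, hz]
    · subst hl; simp at hl'
    · subst hl'; simp at hl
    · obtain ⟨o, ho, rfl⟩ := hl
      obtain ⟨o', ho', h⟩ := hl'
      cases h
      exact h2 _ _ _ ho ho'
  · intro v hv y l hl
    by_cases hy : y = x
    · simp only [pts', hy, if_true, List.mem_singleton] at hl
      subst hl
      have := hv (none, d) (none, d) (Or.inl rfl)
      cases d <;> simp_all
    · rw [hp y hy] at hl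
      obtain ⟨o, ho, rfl⟩ := List.mem_map.1 hl
      refine h3 (fun l d => v (some l) d) ?_ y o ho
      intro a b hab
      exact hv (f a) (f b) (Or.inr ⟨_, hab, rfl⟩)
  · rintro p q (h | ⟨z, hz, hzz⟩)
    · rw [Sym2.eq_iff] at h
      rcases h with ⟨rfl, rfl⟩ | ⟨rfl, rfl⟩ <;> rfl
    · induction z with | _ z1 z2
      have e := h4 z1 z2 hz
      rw [Sym2.map_mk, Sym2.eq_iff] at hzz
      rcases hzz with ⟨rfl, rfl⟩ | ⟨rfl, rfl⟩ <;> simp [f, e]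
  · intro j hj
    by_cases hjk : j = k
    · exact ⟨x, none, by simp [pts'], by simp [hjk]⟩
    · obtain ⟨y, l, hl, rfl⟩ := h5 j (by omega)
      have hy : y ≠ x := by rintro rfl; simp [hx0] at hl
      exact ⟨y, some l, by rw [hp y hy]; exact List.mem_map.2 ⟨l, hl, rfl⟩, rfl⟩
  · rw [Ew_cons, Ew_cons, Ew_congr fun y hy => hp y.1 (hA y hy)]
    have : E pts' (x, d) = [(none, d)] := by cases d <;> simp [E, pts']
    rw [this]
    simpa using h8

end Comb
end PaperAlg

namespace PaperAlg
section Comb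
set_option linter.unusedSectionVars false
set_option linter.unusedSimpArgs false
variable {Λ : Type*} [DecidableEq Λ]

def al (S : Λ → ZMod 2) (y : Λ) : List (Λ × Bool) → ZMod 2 → ZMod 2
  | [], _ => 0
  | z :: w, g => (if z.1 = y then (if z.2 then g else g + S z.1) else 0) + al S y w (g + S z.1)

def sm (S : Λ → ZMod 2) (w : List (Λ × Bool)) : ZMod 2 := (w.map fun z => S z.1).sum

def cn (y : Λ) (w : List (Λ × Bool)) : ℕ := w.count (y, true) + w.count (y, false)

theorem cn_append (y : Λ) (u v) : cn y (u ++ v) = cn y u + cn y v := by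
  simp [cn]; omega

theorem cn_cons (y : Λ) (z) (v) : cn y (z :: v) = cn y v + if z.1 = y then 1 else 0 := by
  obtain ⟨z, d⟩ := z
  by_cases h : z = y <;> cases d <;> simp [cn, h] <;> omega

theorem cn_nil (y : Λ) : cn y [] = 0 := by simp [cn]

def inv (w : List (Λ × Bool)) : List (Λ × Bool) := (w.map fun z => (z.1, !z.2)).reverse

theorem count_inv (w : List (Λ × Bool)) (y d) : (inv w).count (y, d) = w.count (y, !d) := by
  have : Function.Injective (fun z : Λ × Bool => (z.1, !z.2)) := by
    rintro ⟨a, b⟩ ⟨c, d⟩ h; simpa using h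
  rw [inv, List.count_reverse, ← List.count_map_of_injective w _ this (y, !d)]
  simp

theorem cn_inv (w : List (Λ × Bool)) (y) : cn y (inv w) = cn y w := by
  simp [cn, count_inv]; omega

theorem cn_eq_zero {y : Λ} {w} : cn y w = 0 ↔ ∀ z ∈ w, z.1 ≠ y := by
  induction w with
  | nil => simp [cn_nil]
  | cons z w ih => rw [cn_cons]; by_cases h : z.1 = y <;> simp [h, ih]

theorem z2 (a : ZMod 2) : a + a = 0 := CharTwo.add_self_eq_zero a

theorem al_append (S : Λ → ZMod 2) (y) (u v g) : al S y (u ++ v) g = al S y u g + al S y v (g + sm S u) := by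
  induction u generalizing g with
  | nil => simp [al, sm]
  | cons z u ih => simp [al, ih, sm, add_assoc]

theorem al_base (S : Λ → ZMod 2) (y) (u g) : al S y u g = al S y u 0 + g * cn y u := by
  induction u generalizing g with
  | nil => simp [al, cn]
  | cons z u ih =>
    rw [al, al, ih, ih (0 + S z.1), cn_cons]
    split_ifs <;> push_cast <;> ring

theorem al_zero {S : Λ → ZMod 2} {y} {u} (h : cn y u = 0) (g) : al S y u g = 0 := by
  induction u generalizing g with
  | nil => simp [al]
  | cons z u ih =>
    rw [cn_cons] at h
    have h1 : z.1 ≠ y := by intro h'; simp [h'] at h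
    rw [al, ih (by omega)]; simp [h1]

theorem al_congr {S S' : Λ → ZMod 2} {y} {u} (h : ∀ z ∈ u, S z.1 = S' z.1) (g) : al S y u g = al S' y u g := by
  induction u generalizing g with
  | nil => simp [al]
  | cons z u ih =>
    rw [al, al, ih (fun z hz => h z (by simp [hz])), h z (by simp)]

theorem sm_congr {S S' : Λ → ZMod 2} {u} (h : ∀ z ∈ u, S z.1 = S' z.1) : sm S u = sm S' u := by
  unfold sm; congr 1; exact List.map_congr_left h

theorem sm_append (S : Λ → ZMod 2) (u v) : sm S (u ++ v) = sm S u + sm S v := by simp [sm]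
theorem sm_cons (S : Λ → ZMod 2) (u v) : sm S (u :: v) = S u.1 + sm S v := by simp [sm]

theorem sm_eq_zero (S : Λ → ZMod 2) (u) (h : ∀ y, Even (cn y u)) : sm S u = 0 := by
  have : sm S u = ((u.map Prod.fst).map S).sum := by simp [sm, Function.comp_def]
  rw [this, Finset.sum_list_map_count]
  refine Finset.sum_eq_zero fun y _ => ?_
  have hc : ∀ w : List (Λ × Bool), (w.map Prod.fst).count y = cn y w := by
    intro w
    induction w with
    | nil => simp [cn]
    | cons z w ih => rw [List.map_cons, List.count_cons, ih, cn_cons]; simp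
  rw [hc]
  obtain ⟨r, hr⟩ := h y
  rw [hr, add_nsmul, z2]

def Twice (w : List (Λ × Bool)) : Prop := ∀ y, cn y w = 0 ∨ cn y w = 2

theorem Twice.even {w : List (Λ × Bool)} (h : Twice w) (y) : Even (cn y w) := by
  rcases h y with h | h <;> simp [h]

theorem Twice.of_cn {w w' : List (Λ × Bool)} (h : Twice w) (e : ∀ y, cn y w' = cn y w) : Twice w' := by
  intro y; rw [e]; exact h y

def Ind (m : ℕ) (w : List (Λ × Bool)) : Prop :=
  ∃ Φ : (Fin m → ZMod 2) →ₗ[ZMod 2] (Λ → ZMod 2), ∀ a, (∀ y, al (Φ a) y w 0 = 0) → a = 0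

def TT (w : List (Λ × Bool)) : Prop := ∀ m, Ind m w → Good m [w]

theorem Ind.rot {m} {u v : List (Λ × Bool)} (ht : Twice (u ++ v)) (h : Ind m (u ++ v)) : Ind m (v ++ u) := by
  obtain ⟨Φ, h⟩ := h
  refine ⟨Φ, fun a ha => h a fun y => ?_⟩
  have := ha y
  have hs := sm_eq_zero (Φ a) _ ht.even
  have he := ht.even y
  rw [al_append, al_base _ _ u] at this
  rw [al_append, al_base _ _ v]
  rw [sm_append] at hs
  rw [cn_append] at he
  have he' : (cn y u : ZMod 2) = cn y v := by
    have := (ZMod.natCast_eq_zero_iff_even).2 he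
    push_cast at this
    rwa [CharTwo.add_eq_zero] at this
  have hs' : sm (Φ a) u = sm (Φ a) v := by rwa [CharTwo.add_eq_zero] at hs
  rw [he'] at this
  rw [← hs'] at this
  linear_combination this

theorem TT.rot {u v : List (Λ × Bool)} (ht : Twice (u ++ v)) (h : TT (v ++ u)) : TT (u ++ v) :=
  fun m hm => (h m (hm.rot ht)).rot

theorem TT.slide {x a : Λ} {dx da : Bool} {B C : List (Λ × Bool)} (hax : a ≠ x)
    (hB : cn x B = 0) (hC : cn x C = 0)
    (h : TT ((x, dx) :: B ++ (x, dx) :: (a, !da) :: C)) :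
    TT ((x, dx) :: (a, da) :: B ++ (x, dx) :: C) := by
  intro m hm
  rw [cn_eq_zero] at hB hC
  refine Good.slide hax hB hC (h m ?_)
  obtain ⟨Φ, hΦ⟩ := hm
  let s : (Λ → ZMod 2) →ₗ[ZMod 2] (Λ → ZMod 2) :=
    { toFun := fun S y => S y + if y = x then S a else 0
      map_add' := by intro S S'; ext y; by_cases hy : y = x <;> simp [hy]; ring
      map_smul' := by intro c S; ext y; by_cases hy : y = x <;> simp [hy]; ring }
  refine ⟨s ∘ₗ Φ, fun b hb => hΦ b ?_⟩
  set S := Φ b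
  have hs : ∀ y, y ≠ x → s S y = S y := fun y hy => by simp [s, hy]
  have hsx : s S x = S x + S a := by simp [s]
  have hb' : ∀ y, al (s S) y ((x, dx) :: B ++ (x, dx) :: (a, !da) :: C) 0 = 0 := hb
  have eB := sm_congr (u := B) (fun z hz => hs z.1 (hB z hz))
  have aB := fun y g => al_congr (y := y) (u := B) (fun z hz => hs z.1 (hB z hz)) g
  have aC := fun y g => al_congr (y := y) (u := C) (fun z hz => hs z.1 (hC z hz)) g
  have hxB := fun g => al_zero (S := S) (cn_eq_zero.2 hB) g
  have hxC := fun g => al_zero (S := S) (cn_eq_zero.2 hC) g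
  have ex := hb' x
  simp only [List.cons_append, al, al_append, eB, hs a hax, hsx, aB, aC, hax, if_true, if_false, hxB, hxC] at ex hb' ⊢
  intro y
  have ey := hb' y
  have c1 : (0 : ZMod 2) + S x + S a + sm S B + S x = 0 + (S x + S a) + sm S B + (S x + S a) + S a := by
    have h2 : (2 : ZMod 2) = 0 := rfl
    linear_combination (-S a) * h2
  by_cases hya : y = a
  · subst hya
    have hxy : x ≠ y := fun h => hax h.symm
    rw [c1]
    have q1 := z2 (S x)
    have q2 := z2 (S y)
    have q3 := z2 (sm S B)
    cases dx <;> cases da <;> simp [hxy] at ex ey ⊢ <;> grind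
  · have hay : a ≠ y := fun h => hya h.symm
    by_cases hyx : y = x
    · subst hyx
      simp only [hax, hxB, hxC, if_true, if_false]
      have q1 := z2 (S y)
      have q2 := z2 (S a)
      cases dx <;> simp at ex ⊢ <;> grind
    · have hxy : x ≠ y := fun h => hyx h.symm
      simp only [hay, hxy, if_false] at ey ⊢
      rw [c1]; simpa [add_assoc] using ey

theorem TT.slideMany {x : Λ} {dx : Bool} (B1 : List (Λ × Bool)) : ∀ {B2 C : List (Λ × Bool)},
    cn x B1 = 0 → cn x B2 = 0 → cn x C = 0 →
    TT ((x, dx) :: B2 ++ (x, dx) :: (inv B1 ++ C)) →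
    TT ((x, dx) :: (B1 ++ B2) ++ (x, dx) :: C) := by
  induction B1 with
  | nil => intro B2 C _ _ _ h; simpa [inv] using h
  | cons a B1 ih =>
    intro B2 C h1 h2 h3 h
    obtain ⟨a, da⟩ := a
    rw [cn_cons] at h1
    have hax : a ≠ x := by intro h; simp [h] at h1
    refine TT.slide hax (by have := cn_append x B1 B2; simp only [List.append_eq] at *; omega) h3 ?_
    refine ih (C := (a, !da) :: C) (by omega) h2 (by rw [cn_cons]; simp [hax, h3]) ?_
    simpa [inv] using h

theorem restr {m : ℕ} (φ : (Fin (m + 1) → ZMod 2) →ₗ[ZMod 2] ZMod 2) :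
    ∃ j : (Fin m → ZMod 2) →ₗ[ZMod 2] (Fin (m + 1) → ZMod 2), Function.Injective j ∧ ∀ a, φ (j a) = 0 := by
  have h := LinearMap.finrank_range_add_finrank_ker φ
  have h1 : Module.finrank (ZMod 2) (LinearMap.range φ) ≤ 1 := by
    simpa using Submodule.finrank_le (LinearMap.range φ)
  rw [Module.finrank_fin_fun] at h
  obtain ⟨f, hf⟩ := exists_linearIndependent_of_le_finrank (R := ZMod 2) (M := LinearMap.ker φ) (n := m) (by omega)
  refine ⟨(LinearMap.ker φ).subtype ∘ₗ Fintype.linearCombination (ZMod 2) f, ?_, ?_⟩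
  · rw [LinearMap.coe_comp]
    exact (LinearMap.ker φ).injective_subtype.comp (linearIndependent_iff_injective_fintypeLinearCombination.1 hf)
  · intro a
    exact (Fintype.linearCombination (ZMod 2) f a).2

theorem Ind.drop {m} {x : Λ} {d} {D : List (Λ × Bool)} (h : Ind (m + 1) ((x, d) :: (x, d) :: D)) :
    Ind m D := by
  obtain ⟨Φ, h⟩ := h
  obtain ⟨j, hj, hj'⟩ := restr (LinearMap.proj x ∘ₗ Φ)
  refine ⟨Φ ∘ₗ j, fun a ha => hj ?_⟩
  rw [map_zero]
  refine h _ fun y => ?_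
  have h0 : Φ (j a) x = 0 := hj' a
  have := ha y
  simp only [LinearMap.coe_comp, Function.comp_apply] at this
  simp [al, h0, this]

theorem TT.L1 {x : Λ} {d} {D : List (Λ × Bool)} (hx : cn x D = 0) (h : TT D) : TT ((x, d) :: (x, d) :: D) := by
  rintro (_ | m) hm
  · exact Good.zero
  · exact Good.isolate (cn_eq_zero.1 hx) (h m hm.drop)

theorem TT.isol {x : Λ} {d} {A B C : List (Λ × Bool)} (ht : Twice (A ++ (x, d) :: B ++ (x, d) :: C))
    (h : TT ((x, d) :: (x, d) :: (inv B ++ (C ++ A)))) : TT (A ++ (x, d) :: B ++ (x, d) :: C) := by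
  have hx := ht x
  simp only [cn_append, cn_cons, if_true] at hx
  have := TT.slideMany (x := x) (dx := d) B (B2 := []) (C := C ++ A) (by omega) (by simp [cn]) (by rw [cn_append]; omega)
    (by simpa using h)
  have h2 := TT.rot (u := A) (v := (x, d) :: B ++ (x, d) :: C) (by simpa using ht) (by simpa using this)
  simpa using h2

theorem split2 {p : Λ × Bool} {w : List (Λ × Bool)} (h : 2 ≤ w.count p) :
    ∃ A B C, w = A ++ p :: B ++ p :: C := by
  obtain ⟨A, B, rfl, hA⟩ := List.eq_append_cons_of_mem (List.count_pos_iff.1 (show 0 < w.count p by omega))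
  have hA : A.count p = 0 := List.count_eq_zero.2 hA
  rw [List.count_append, List.count_cons_self] at h
  obtain ⟨B, C, rfl⟩ := List.append_of_mem (List.count_pos_iff.1 (show 0 < B.count p by omega))
  exact ⟨A, B, C, by simp⟩

theorem split2' {y : Λ} {w : List (Λ × Bool)} (h : 2 ≤ cn y w) :
    ∃ A d B d' C, w = A ++ (y, d) :: B ++ (y, d') :: C := by
  have h1 : ∃ z ∈ w, z.1 = y := by
    by_contra! hc; rw [cn_eq_zero.2 hc] at h; omega
  have key : ∀ w : List (Λ × Bool), cn y w ≠ 0 → ∃ A d B, w = A ++ (y, d) :: B ∧ cn y A = 0 := by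
    intro w
    induction w with
    | nil => simp [cn]
    | cons z w ih =>
      intro h
      by_cases hz : z.1 = y
      · exact ⟨[], z.2, w, by simp [← hz], by simp [cn]⟩
      · obtain ⟨A, d, B, rfl, hA⟩ := ih (by rw [cn_cons] at h; simpa [hz] using h)
        exact ⟨z :: A, d, B, by simp, by rw [cn_cons]; simp [hz, hA]⟩
  obtain ⟨A, d, B, rfl, hA⟩ := key w (by omega)
  rw [cn_append, cn_cons] at h
  simp only [if_true] at h
  obtain ⟨B, d', C, rfl, hB⟩ := key B (by omega)
  exact ⟨A, d, B, d', C, by simp⟩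

theorem S1 (N : ℕ) : ∀ w : List (Λ × Bool), w.length ≤ N → Twice w → (∃ p, 2 ≤ w.count p) → TT w := by
  induction N with
  | zero =>
    intro w hw _ ⟨p, hp⟩
    have : w = [] := by simpa using hw
    simp [this] at hp
  | succ N ih =>
    rintro w hw ht ⟨⟨x, d⟩, hp⟩
    obtain ⟨A, B, C, rfl⟩ := split2 hp
    apply TT.isol ht
    have htx := ht x
    simp only [cn_append, cn_cons, if_true] at htx
    have hxD : cn x (inv B ++ (C ++ A)) = 0 := by simp only [cn_append, cn_inv]; omega
    have hDt : Twice (inv B ++ (C ++ A)) := by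
      intro y
      have := ht y
      by_cases hy : x = y
      · subst hy; exact Or.inl hxD
      · simp only [cn_append, cn_cons, hy, if_false, cn_inv] at this ⊢; omega
    have hDl : (inv B ++ (C ++ A)).length + 1 ≤ N := by
      simp [inv] at hw ⊢; omega
    generalize inv B ++ (C ++ A) = D at hxD hDt hDl
    clear! A B C
    by_cases htw : ∃ p, 2 ≤ D.count p
    · exact TT.L1 hxD (ih D (by omega) hDt htw)
    push Not at htw
    rintro (_ | _ | m) hm
    · exact Good.zero
    · exact Good.isolate (cn_eq_zero.1 hxD) Good.zero
    revert hm
    intro hm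
    have hm0 := hm
    have hm1 : Ind (m + 1) D := hm.drop
    obtain ⟨Φ, hΦ⟩ := hm1
    have h1 : ¬ ∀ y, al (Φ 1) y D 0 = 0 := fun h => by
      have := congrFun (hΦ 1 h) 0
      simp at this
    push Not at h1
    obtain ⟨y, hy⟩ := h1
    set S := Φ 1
    have hcy : cn y D = 2 := by
      rcases hDt y with h | h
      · exact absurd (al_zero h 0) hy
      · exact h
    obtain ⟨A0, d1, A1, d2, A2, rfl⟩ := split2' hcy.ge
    have hd : d2 = !d1 := by
      have := htw (y, d1)
      by_contra hc
      have : d2 = d1 := by cases d1 <;> cases d2 <;> simp_all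
      subst this
      simp at this
      omega
    subst hd
    simp only [cn_append, cn_cons, if_true] at hcy
    have hs : sm S A1 ≠ 0 := by
      intro h
      apply hy
      have b0 := fun g => al_zero (S := S) (y := y) (u := A0) (by omega) g
      have b1 := fun g => al_zero (S := S) (y := y) (u := A1) (by omega) g
      have b2 := fun g => al_zero (S := S) (y := y) (u := A2) (by omega) g
      simp only [al_append, al, b0, b1, b2, sm_append, sm_cons, h, if_true]
      have := z2 (sm S A0)
      have := z2 (S y)
      cases d1 <;> simp <;> linear_combination z2 (sm S A0) + z2 (S y)
    have hz : ∃ z, ¬ Even (cn z A1) := by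
      by_contra! hc
      exact hs (sm_eq_zero S A1 hc)
    obtain ⟨z, hz⟩ := hz
    have hzy : y ≠ z := by
      rintro rfl
      apply hz
      rw [show cn y A1 = 0 by omega]; simp
    have hzx : x ≠ z := by
      rintro rfl
      apply hz
      simp only [cn_append, cn_cons] at hxD
      rw [show cn x A1 = 0 by omega]; simp
    have hxy : x ≠ y := by
      rintro rfl
      simp only [cn_append, cn_cons, if_true] at hxD
      omega
    suffices H : TT ((x, d) :: (x, d) :: (A0 ++ (y, d1) :: A1 ++ (y, !d1) :: A2)) from H _ hm0
    have htX : Twice ((x, d) :: (x, d) :: (A0 ++ (y, d1) :: A1 ++ (y, !d1) :: A2)) := by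
      intro u
      have := hDt u
      rw [cn_cons, cn_cons]
      by_cases hu : x = u
      · subst hu; rw [hxD]; simp
      · simpa [hu] using this
    refine TT.rot (u := [(x, d)]) (v := (x, d) :: (A0 ++ (y, d1) :: A1 ++ (y, !d1) :: A2)) (by simpa using htX) ?_
    have H := TT.slideMany (x := x) (dx := d) (A0 ++ [(y, d1)]) (B2 := A1 ++ (y, !d1) :: A2) (C := [])
    simp only [cn_append, cn_cons, cn_nil] at hxD
    simp only [cn_append, cn_cons, cn_nil, cn_inv] at H
    have H' := H (by omega) (by omega) (by simp)
    rw [show (x, d) :: (A0 ++ (y, d1) :: A1 ++ (y, !d1) :: A2) ++ [(x, d)] =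
      (x, d) :: (A0 ++ [(y, d1)] ++ (A1 ++ (y, !d1) :: A2)) ++ [(x, d)] by simp]
    apply H'
    have hinv : inv (A0 ++ [(y, d1)]) = (y, !d1) :: inv A0 := by simp [inv]
    rw [hinv]
    rw [show (x, d) :: (A1 ++ (y, !d1) :: A2) ++ (x, d) :: ((y, !d1) :: inv A0 ++ []) =
      ((x, d) :: A1) ++ (y, !d1) :: (A2 ++ [(x, d)]) ++ (y, !d1) :: inv A0 by simp]
    apply TT.isol
    · refine htX.of_cn fun u => ?_
      simp only [cn_append, cn_cons, cn_nil, cn_inv]; omega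
    have hD't : Twice (inv (A2 ++ [(x, d)]) ++ (inv A0 ++ (x, d) :: A1)) := by
      intro u
      have := htX u
      simp only [cn_append, cn_cons, cn_nil, cn_inv] at this ⊢
      by_cases hu : y = u
      · subst hu; left; simp [hxy]; omega
      · simp only [hu, if_false] at this ⊢; omega
    apply TT.L1
    · simp only [cn_append, cn_cons, cn_nil, cn_inv]; simp [hxy]; omega
    refine ih _ (by simp [inv] at hDl ⊢; omega) hD't ?_
    have hzt := hDt z
    have ht1 := htw (z, true)
    have ht2 := htw (z, false)
    have hne : ∀ e e' : Bool, ((y, e) == (z, e')) = false := by intro e e'; simp [hzy]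
    have hnx : ∀ e e' : Bool, ((x, e) == (z, e')) = false := by intro e e'; simp [hzx]
    rw [Nat.not_even_iff_odd] at hz
    obtain ⟨r, hr⟩ := hz
    simp only [cn, List.count_append, List.count_cons, hne, Bool.false_eq_true, if_false] at hzt ht1 ht2 hr
    by_cases hq : A1.count (z, true) = 1
    · refine ⟨(z, true), ?_⟩
      simp only [List.count_append, List.count_cons, count_inv, hnx, List.count_nil, Bool.false_eq_true, if_false, Bool.not_true, Bool.not_false]
      omega
    · refine ⟨(z, false), ?_⟩
      simp only [List.count_append, List.count_cons, count_inv, hnx, List.count_nil, Bool.false_eq_true, if_false, Bool.not_true, Bool.not_false]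
      omega

end Comb
end PaperAlg

namespace PaperAlg
section Comb
variable {α β : Type*} {Λ : Type*} {Lab : Type}

theorem NCs.map {ws : List (List α)} {M} (h : NCs ws M) (f : α → β) :
    NCs (ws.map (List.map f)) (Sym2.map f '' M) := by
  induction h with
  | nil => simpa using NCs.nil
  | cons w ws M N h1 _ ih =>
    rw [Set.image_union]
    exact NCs.cons _ _ _ _ (h1.map f) ih

theorem NCs.mem {ws : List (List α)} {M} (h : NCs ws M) {a b} (hab : s(a, b) ∈ M) :
    ∃ w ∈ ws, a ∈ w ∧ b ∈ w := by
  induction h with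
  | nil => simp at hab
  | cons w ws M N h1 _ ih =>
    rcases hab with hab | hab
    · exact ⟨w, by simp, h1.mem hab⟩
    · obtain ⟨w', h, h'⟩ := ih hab
      exact ⟨w', by simp [h], h'⟩

theorem mem_Ew {pts : Λ → List Lab} {w} {o : Lab × Bool} (h : o ∈ Ew pts w) :
    ∃ y ∈ w, o.1 ∈ pts y.1 := by
  obtain ⟨y, hy, hoy⟩ := List.mem_flatMap.1 h
  exact ⟨y, hy, (mem_E hoy).1⟩

theorem pts_nil {k : ℕ} {pts : Λ → List Lab} {M} {P : List (List (Λ × Bool))} (h : GoodS k pts M)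
    (h6 : NCs (P.map (Ew pts)) M) {x : Λ} (hx : ∀ w ∈ P, ∀ y ∈ w, y.1 ≠ x) : pts x = [] := by
  classical
  obtain ⟨h1, h2, h3, -⟩ := h
  rw [List.eq_nil_iff_forall_not_mem]
  intro l hl
  have hno : ∀ w ∈ P, ∀ o ∈ Ew pts w, o.1 ≠ l := by
    rintro w hw o ho rfl
    obtain ⟨y, hy, hoy⟩ := mem_Ew ho
    exact hx w hw y hy (h2 _ _ _ hoy hl)
  have := h3 (fun l' d => if l' = l then d else true) (by
    intro a b hab
    obtain ⟨w, hw, ha, hb⟩ := h6.mem hab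
    obtain ⟨w, hw', rfl⟩ := List.mem_map.1 hw
    simp [hno w hw' _ ha, hno w hw' _ hb]) x l hl
  simp at this

theorem A2_range (l : List β) (f : β → α) (g : ℕ → α) (z) :
    z ∈ A2 (l.map f) ((List.range l.length).map g) ↔ ∃ (i : ℕ) (h : i < l.length), z = s(f l[i], g i) := by
  constructor
  · rintro ⟨x, hx, rfl⟩
    obtain ⟨i, hi, rfl⟩ := List.mem_iff_getElem.1 hx
    simp at hi
    exact ⟨i, hi, by simp⟩
  · rintro ⟨i, h, rfl⟩
    refine ⟨(f l[i], g i), List.mem_iff_getElem.2 ⟨i, by simpa using h, by simp⟩, rfl⟩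

theorem Good.cut {k : ℕ} {e : Λ} {d : Bool} {q r : Λ × Bool} {A A' : List (Λ × Bool)}
    {ws : List (List (Λ × Bool))} (hA : ∀ y ∈ A ++ q :: r :: A', y.1 ≠ e) (hw : ∀ w ∈ ws, ∀ y ∈ w, y.1 ≠ e)
    (h : Good k ((A ++ q :: r :: A') :: ws)) :
    Good k ((A ++ (e, d) :: A') :: [(e, !d), q, r] :: ws) := by
  classical
  obtain ⟨L, pts, M, hS, h6⟩ := h
  have hpe : pts e = [] := pts_nil hS h6 (by
    intro w hw1
    rcases List.mem_cons.1 hw1 with rfl | hw1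
    · exact hA
    · exact hw w hw1)
  obtain ⟨h1, h2, h3, κ, h4, h5⟩ := hS
  let f : L × Bool → (L ⊕ ℕ) × Bool := Prod.map Sum.inl id
  simp only [List.map_cons] at h6
  have hmem : ∀ {a b}, s(a, b) ∈ M → ∃ y, a.1 ∈ pts y := by
    intro a b hab
    obtain ⟨w, hw, ha, hb⟩ := h6.mem hab
    rw [← List.map_cons (f := Ew pts)] at hw
    obtain ⟨w, hw, rfl⟩ := List.mem_map.1 hw
    obtain ⟨y, -, hy⟩ := mem_Ew ha
    exact ⟨_, hy⟩
  cases h6 with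
  | cons _ _ M1 N hM1 hN
  have hM1 : NC ((E pts q ++ E pts r) ++ (Ew pts A' ++ Ew pts A)) M1 := by
    have := hM1.rot (u := Ew pts A) (v := E pts q ++ (E pts r ++ Ew pts A')) (by simp [Ew_append, Ew_cons])
    simpa using this
  have hM1' := hM1.map f
  rw [List.map_append] at hM1'
  obtain ⟨l, Mu, Mv, c1, c2, c3, c4, c5, c6⟩ := hM1'.cut rfl
  set n := l.length with hn
  let ds : List ((L ⊕ ℕ) × Bool) := (List.range n).map fun i => (Sum.inr i, d)
  let cs : List ((L ⊕ ℕ) × Bool) := (List.range n).map fun i => (Sum.inr i, !d)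
  have c5 := c5 cs (by simp [cs])
  have c6 := c6 ds (by simp [ds])
  let nw : List (L ⊕ ℕ) := (List.range n).map Sum.inr
  let pts' : Λ → List (L ⊕ ℕ) := fun y => if y = e then (if d then nw.reverse else nw) else (pts y).map Sum.inl
  have hp : ∀ y, y ≠ e → pts' y = (pts y).map Sum.inl := fun y hy => by simp [pts', hy]
  have hpe' : ∀ x, x ∈ pts' e ↔ ∃ i < n, x = Sum.inr i := by
    intro x
    have : x ∈ pts' e ↔ x ∈ nw := by cases d <;> simp [pts']
    rw [this]; simp [nw, eq_comm]
  have hE1 : E pts' (e, d) = ds.reverse := by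
    cases d <;> simp [E, pts', nw, ds, Function.comp_def]
  have hE2 : E pts' (e, !d) = cs := by
    cases d <;> simp [E, pts', nw, cs, Function.comp_def]
  have hnew : ∀ i (h : i < l.length), s(l[i].1, (Sum.inr i, !d)) ∈ A2 (l.map Prod.fst) cs ∧
      s(l[i].2, (Sum.inr i, d)) ∈ A2 (l.map Prod.snd) ds := by
    intro i h
    exact ⟨(A2_range l Prod.fst _ _).2 ⟨i, h, rfl⟩, (A2_range l Prod.snd _ _).2 ⟨i, h, rfl⟩⟩
  have hl : ∀ x ∈ l, ∃ a b, x = (f a, f b) ∧ s(a, b) ∈ M1 := by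
    intro x hx
    have : s(x.1, x.2) ∈ Sym2.map f '' M1 := by rw [c1]; exact Or.inr ⟨x, hx, rfl⟩
    obtain ⟨z, hz, hzz⟩ := this
    induction z with | _ a b
    rw [Sym2.map_mk, Sym2.eq_iff] at hzz
    rcases hzz with ⟨h, h'⟩ | ⟨h, h'⟩
    · exact ⟨a, b, by ext1 <;> simp [*], hz⟩
    · exact ⟨b, a, by ext1 <;> simp [*], Sym2.eq_swap ▸ hz⟩
  let κ0 : L ⊕ ℕ → ℕ := Sum.elim κ (fun _ => 0)
  let κ' : L ⊕ ℕ → ℕ := Sum.elim κ (fun i => ((l.map fun x => κ0 x.1.1)[i]?).getD 0)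
  refine ⟨L ⊕ ℕ, pts', (Mv ∪ A2 (l.map Prod.snd) ds) ∪ ((Mu ∪ A2 (l.map Prod.fst) cs) ∪ Sym2.map f '' N), ⟨?_, ?_, ?_, κ', ?_, ?_⟩, ?_⟩
  · intro y
    by_cases hy : y = e
    · have : nw.Nodup := List.Nodup.map Sum.inr_injective List.nodup_range
      cases d
      · simpa [pts', hy] using this
      · simpa [pts', hy] using this
    · rw [hp y hy]; exact List.Nodup.map Sum.inl_injective (h1 y)
  · intro y z x hx hx'
    by_cases hy : y = e <;> by_cases hz : z = e
    · rw [hy, hz]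
    · subst hy; rw [hp z hz] at hx'
      obtain ⟨i, -, rfl⟩ := (hpe' x).1 hx
      simp at hx'
    · subst hz; rw [hp y hy] at hx
      obtain ⟨i, -, rfl⟩ := (hpe' x).1 hx'
      simp at hx
    · rw [hp y hy] at hx; rw [hp z hz] at hx'
      obtain ⟨o, ho, rfl⟩ := List.mem_map.1 hx
      obtain ⟨o', ho', h⟩ := List.mem_map.1 hx'
      cases h
      exact h2 _ _ _ ho ho'
  · intro v hv
    have hv1 : ∀ i (h : i < l.length), (v l[i].1.1 l[i].1.2 = v (Sum.inr i) d ∧ v (Sum.inr i) (!d) = v l[i].1.1 (!l[i].1.2)) ∧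
       (v l[i].2.1 l[i].2.2 = v (Sum.inr i) (!d) ∧ v (Sum.inr i) d = v l[i].2.1 (!l[i].2.2)) := by
      intro i h
      have := hnew i h
      have e1 := hv _ _ (Or.inr (Or.inl (Or.inr this.1)))
      have e2 := hv _ _ (Or.inl (Or.inr this.2))
      have e3 := hv _ _ (Or.inr (Or.inl (Or.inr (Sym2.eq_swap ▸ this.1))))
      have e4 := hv _ _ (Or.inl (Or.inr (Sym2.eq_swap ▸ this.2)))
      simp only [Bool.not_not] at e1
      exact ⟨⟨e1, e3⟩, ⟨e2, e4⟩⟩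
    have hI : Inv (fun l d => v (Sum.inl l) d) (M1 ∪ N) := by
      intro a b hab
      rcases hab with hab | hab
      · have : s(f a, f b) ∈ Sym2.map f '' M1 := ⟨_, hab, rfl⟩
        rw [c1] at this
        rcases this with (h | h) | ⟨x, hx, h⟩
        · exact hv _ _ (Or.inr (Or.inl (Or.inl h)))
        · exact hv _ _ (Or.inl (Or.inl h))
        · obtain ⟨i, hi, rfl⟩ := List.mem_iff_getElem.1 hx
          have := hv1 i hi
          rw [Sym2.eq_iff] at h
          rcases h with ⟨h, h'⟩ | ⟨h, h'⟩
          · have e1 := this.1.1.trans this.2.2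
            rw [← h, ← h'] at e1; exact e1
          · have e1 := this.2.1.trans this.1.2
            rw [← h, ← h'] at e1; exact e1
      · exact hv (f a) (f b) (Or.inr (Or.inr ⟨_, hab, rfl⟩))
    have h3' := h3 _ hI
    intro y x hx
    by_cases hy : y = e
    · subst hy
      obtain ⟨i, hi, rfl⟩ := (hpe' x).1 hx
      obtain ⟨a, b, hab, hm⟩ := hl l[i] (List.getElem_mem hi)
      obtain ⟨z, hz⟩ := hmem (Or.inl hm)
      have e1 := h3' z _ hz
      have e2 := (hv1 i hi).1
      rw [hab] at e2
      refine bool_aux (v (Sum.inr i)) (v (Sum.inl a.1)) d (!a.2) ?_ ?_ e1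
      · simpa [f] using e2.1.symm
      · simpa [f] using e2.2
    · rw [hp y hy] at hx
      obtain ⟨o, ho, rfl⟩ := List.mem_map.1 hx
      exact h3' y o ho
  · have hk : ∀ i (h : i < l.length), κ' (Sum.inr i) = κ' l[i].1.1 ∧ κ' (Sum.inr i) = κ' l[i].2.1 := by
      intro i hi
      obtain ⟨a, b, hab, hm⟩ := hl l[i] (List.getElem_mem hi)
      have := h4 a b (Or.inl hm)
      have e1 : κ' (Sum.inr i) = κ a.1 := by simp [κ', hi, hab, κ0, f]
      rw [e1, hab]
      exact ⟨rfl, this⟩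
    rintro a b ((h | h) | (h | h) | h)
    · have : s(a, b) ∈ Sym2.map f '' M1 := by rw [c1]; exact Or.inl (Or.inr h)
      obtain ⟨z, hz, hzz⟩ := this
      induction z with | _ z1 z2
      have e1 := h4 z1 z2 (Or.inl hz)
      rw [Sym2.map_mk, Sym2.eq_iff] at hzz
      rcases hzz with ⟨rfl, rfl⟩ | ⟨rfl, rfl⟩ <;> simp [f, κ', e1]
    · obtain ⟨i, hi, h⟩ := (A2_range l Prod.snd _ _).1 h
      rw [Sym2.eq_iff] at h
      rcases h with ⟨rfl, rfl⟩ | ⟨rfl, rfl⟩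
      · exact (hk i hi).2.symm
      · exact (hk i hi).2
    · have : s(a, b) ∈ Sym2.map f '' M1 := by rw [c1]; exact Or.inl (Or.inl h)
      obtain ⟨z, hz, hzz⟩ := this
      induction z with | _ z1 z2
      have e1 := h4 z1 z2 (Or.inl hz)
      rw [Sym2.map_mk, Sym2.eq_iff] at hzz
      rcases hzz with ⟨rfl, rfl⟩ | ⟨rfl, rfl⟩ <;> simp [f, κ', e1]
    · obtain ⟨i, hi, h⟩ := (A2_range l Prod.fst _ _).1 h
      rw [Sym2.eq_iff] at h
      rcases h with ⟨rfl, rfl⟩ | ⟨rfl, rfl⟩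
      · exact (hk i hi).1.symm
      · exact (hk i hi).1
    · obtain ⟨z, hz, hzz⟩ := h
      induction z with | _ z1 z2
      have e1 := h4 z1 z2 (Or.inr hz)
      rw [Sym2.map_mk, Sym2.eq_iff] at hzz
      rcases hzz with ⟨rfl, rfl⟩ | ⟨rfl, rfl⟩ <;> simp [f, κ', e1]
  · intro j hj
    obtain ⟨y, o, ho, rfl⟩ := h5 j hj
    have hy : y ≠ e := by rintro rfl; simp [hpe] at ho
    exact ⟨y, Sum.inl o, by rw [hp y hy]; exact List.mem_map.2 ⟨o, ho, rfl⟩, rfl⟩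
  · have hc : ∀ w : List (Λ × Bool), (∀ y ∈ w, y.1 ≠ e) → Ew pts' w = (Ew pts w).map f :=
      fun w hw => Ew_congr fun y hy => hp y.1 (hw y hy)
    have hcE : ∀ y : Λ × Bool, y.1 ≠ e → E pts' y = (E pts y).map f := fun y hy => E_congr (hp y.1 hy)
    simp only [List.map_cons]
    refine NCs.cons _ _ _ _ ?_ (NCs.cons _ _ _ _ ?_ ?_)
    · have := c6.rot (u := ds.reverse ++ (Ew pts A').map f) (v := (Ew pts A).map f) (by simp)
      rw [Ew_append, Ew_cons, hE1, hc A fun y hy => hA y (by simp [hy]), hc A' fun y hy => hA y (by simp [hy])]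
      exact this
    · have := c5.rot (u := (E pts q ++ E pts r).map f) (v := cs) rfl
      rw [Ew_cons, Ew_cons, Ew_cons, hE2, hcE q (hA q (by simp)), hcE r (hA r (by simp))]
      simpa [Ew] using this
    · have := hN.map f
      rw [List.map_map] at this
      convert this using 1
      apply List.map_congr_left
      intro w hww
      exact hc w (hw w hww)

end Comb
end PaperAlg

namespace PaperAlg
section Grow
set_option linter.unusedSectionVars false
set_option linter.unusedSimpArgs false
variable {P : Type*} [DecidableEq P]

def sd (lt : P → P → Bool) (u v : P) : Finset P × Bool := ({u, v}, lt u v)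
def tri (o : P × P × P) : Finset P := {o.1, o.2.1, o.2.2}
def bdw (lt : P → P → Bool) (o : P × P × P) : List (Finset P × Bool) :=
  [sd lt o.1 o.2.1, sd lt o.2.1 o.2.2, sd lt o.2.2 o.1]
def hl (lt : P → P → Bool) (h : P → ZMod 2) (e : Finset P) : ZMod 2 :=
  ∑ x ∈ e, if ∀ y ∈ e, y ≠ x → lt x y = true then h x else 0
def IsCoc (S : Finset P → ZMod 2) (t : Finset P) : Prop :=
  ∃ g : P → ZMod 2, ∀ x ∈ t, ∀ y ∈ t, x ≠ y → S {x, y} = g x + g y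
def IsCob (S : Finset P → ZMod 2) (T : Finset (Finset P)) : Prop :=
  ∃ g : P → ZMod 2, ∀ t ∈ T, ∀ x ∈ t, ∀ y ∈ t, x ≠ y → S {x, y} = g x + g y
def BB (lt : P → P → Bool) (S : Finset P → ZMod 2) (L : List (Finset P × Bool)) (R : Finset (Finset P)) : Prop :=
  ∃ h : Finset P → P → ZMod 2, (∀ t ∈ R, ∀ x ∈ t, ∀ y ∈ t, x ≠ y → S {x, y} = h t x + h t y) ∧
    ∀ e : Finset P, e.card = 2 → al S e L 0 + (∑ t ∈ R, if e ⊆ t then hl lt (h t) e else 0) = 0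
def IsLt (lt : P → P → Bool) : Prop := ∀ u v, u ≠ v → lt v u = !lt u v

theorem hl_pair {lt : P → P → Bool} (hlt : IsLt lt) (h : P → ZMod 2) {u v : P} (huv : u ≠ v) :
    hl lt h {u, v} = if lt u v then h u else h v := by
  have := hlt u v huv
  rw [hl, Finset.sum_pair huv]
  cases hc : lt u v <;> simp [huv, huv.symm, hc, this]

theorem al_sd {lt : P → P → Bool} (hlt : IsLt lt) (S : Finset P → ZMod 2) (h : P → ZMod 2) {u v : P} (huv : u ≠ v)
    (hS : h v = h u + S {u, v}) (e : Finset P) :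
    al S e [sd lt u v] (h u) = if {u, v} = e then hl lt h e else 0 := by
  simp only [al, sd, add_zero]
  by_cases h1 : {u, v} = e
  · subst h1; rw [hl_pair hlt h huv, hS]; by_cases hc : lt u v = true <;> simp [hc]
  · simp [h1]

theorem pair_sub {u v w : P} (huv : u ≠ v) (huw : u ≠ w) (hvw : v ≠ w) {e : Finset P} (he : e.card = 2) :
    e ⊆ {u, v, w} ↔ ({u, v} = e ∨ {u, w} = e ∨ {w, v} = e) := by
  obtain ⟨x, y, hxy, rfl⟩ := Finset.card_eq_two.1 he
  constructor
  · intro h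
    have hx := h (Finset.mem_insert_self x {y})
    have hy := h (show y ∈ ({x, y} : Finset P) by simp)
    simp only [Finset.mem_insert, Finset.mem_singleton] at hx hy
    rcases hx with rfl | rfl | rfl <;> rcases hy with rfl | rfl | rfl <;> simp_all [Finset.pair_comm]
  · rintro (h | h | h) <;> rw [← h] <;> intro z hz <;> simp at hz ⊢ <;> tauto

theorem pair_ite {M : Type*} [AddCommMonoid M] {u v w : P} (huv : u ≠ v) (huw : u ≠ w) (hvw : v ≠ w) {e : Finset P}
    (he : e.card = 2) (X : M) : (if e ⊆ {u, v, w} then X else 0) =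
     (if {u, v} = e then X else 0) + (if {u, w} = e then X else 0) + (if {w, v} = e then X else 0) := by
  have n1 : ({u, v} : Finset P) ≠ {u, w} := fun h => by
    have : v ∈ ({u, w} : Finset P) := h ▸ (by simp)
    simp at this; tauto
  have n2 : ({u, v} : Finset P) ≠ {w, v} := fun h => by
    have : u ∈ ({w, v} : Finset P) := h ▸ (by simp)
    simp at this; tauto
  have n3 : ({u, w} : Finset P) ≠ {w, v} := fun h => by
    have : u ∈ ({w, v} : Finset P) := h ▸ (by simp)
    simp at this; tauto
  have := pair_sub huv huw hvw he
  by_cases h1 : {u, v} = e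
  · subst h1; simp [this, n1.symm, n2.symm]
  by_cases h2 : {u, w} = e
  · subst h2; simp [this, n1, n3.symm]
  by_cases h3 : {w, v} = e
  · subst h3; simp [this, n2, n3]
  simp [this, h1, h2, h3]

theorem coc_rel {S : Finset P → ZMod 2} {u v w : P} (huv : u ≠ v) (huw : u ≠ w) (hvw : v ≠ w)
    (h : IsCoc S {u, v, w}) : S {u, v} = S {u, w} + S {w, v} := by
  obtain ⟨g, hg⟩ := h
  rw [hg u (by simp) v (by simp) huv, hg u (by simp) w (by simp) huw, hg w (by simp) v (by simp) hvw.symm]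
  linear_combination -z2 (g w)

theorem pot_ok {S : Finset P → ZMod 2} {h : P → ZMod 2} {u v w : P} (huv : u ≠ v) (huw : u ≠ w) (hvw : v ≠ w)
    (hc : S {u, v} = S {u, w} + S {w, v}) (h1 : h w = h u + S {u, w}) (h2 : h v = h w + S {w, v}) :
    ∀ x ∈ ({u, v, w} : Finset P), ∀ y ∈ ({u, v, w} : Finset P), x ≠ y → S {x, y} = h x + h y := by
  have e1 : S {u, v} = h u + h v := by rw [hc, h2, h1]; linear_combination -z2 (h u)
  have e2 : S {u, w} = h u + h w := by rw [h1]; linear_combination -z2 (h u)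
  have e3 : S {w, v} = h w + h v := by rw [h2]; linear_combination -z2 (h w)
  intro x hx y hy hxy
  simp only [Finset.mem_insert, Finset.mem_singleton] at hx hy
  rcases hx with rfl | rfl | rfl <;> rcases hy with rfl | rfl | rfl <;>
    first | exact absurd rfl hxy | assumption | (rw [Finset.pair_comm, add_comm]; assumption)

def dif (l : List (Finset P × Bool)) (e : Finset P) : ℤ := (l.count (e, true) : ℤ) - l.count (e, false)

theorem dif_append (l l' : List (Finset P × Bool)) (e) : dif (l ++ l') e = dif l e + dif l' e := by
  simp [dif]; ring

theorem dif_cons (p) (l' : List (Finset P × Bool)) (e) : dif (p :: l') e = dif [p] e + dif l' e :=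
  dif_append [p] l' e

theorem dif_flip {lt : P → P → Bool} (hlt : IsLt lt) {u v : P} (huv : u ≠ v) (e) : dif [sd lt v u] e = - dif [sd lt u v] e := by
  have := hlt u v huv
  simp only [dif, sd, this, Finset.pair_comm v u, List.count_singleton]
  cases lt u v <;> simp

def Cnt (L : List (Finset P × Bool)) (R : Finset (Finset P)) : Prop :=
  (∀ e : Finset P, e.card = 2 → cn e L + (R.filter (e ⊆ ·)).card = 0 ∨ cn e L + (R.filter (e ⊆ ·)).card = 2) ∧
  ∀ e : Finset P, e.card ≠ 2 → cn e L = 0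

theorem grow {lt : P → P → Bool} (hlt : IsLt lt) {T : Finset (Finset P)} (h3 : ∀ t ∈ T, t.card = 3)
    (two : ∀ e : Finset P, e.card = 2 → (T.filter (e ⊆ ·)).card = 0 ∨ (T.filter (e ⊆ ·)).card = 2)
    (dual : ∀ R ⊆ T, R.Nonempty → R ≠ T → ∃ t ∈ R, ∃ t' ∈ T \ R, ∃ e ⊆ t, e ⊆ t' ∧ e.card = 2) (k : ℕ) :
    ∀ R ⊆ T, R.card = k → R ≠ T → ∀ L, Cnt L R → ∃ Lf, ∃ l : List (P × P × P), Twice Lf ∧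
      (l.map tri).Nodup ∧ (∀ t, t ∈ l.map tri ↔ t ∈ R) ∧
      (∀ S, (∀ t ∈ T, IsCoc S t) → BB lt S Lf ∅ → BB lt S L R) ∧
      (∀ k, Good k [Lf] → Good k (L :: l.map (bdw lt))) ∧
      (∀ e, dif Lf e = dif L e + (l.map fun o => dif (bdw lt o) e).sum) := by
  induction k with
  | zero =>
    intro R hR hk hne L hL
    obtain rfl : R = ∅ := Finset.card_eq_zero.1 hk
    refine ⟨L, [], ?_, by simp, by simp, fun S _ h => h, fun k h => by simpa using h, by simp⟩
    intro e
    by_cases he : e.card = 2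
    · simpa using hL.1 e he
    · exact Or.inl (hL.2 e he)
  | succ k ih =>
    intro R hR hk hne L hL
    obtain ⟨t, ht, t', ht', e0, he0, he0', hc0⟩ := dual R hR (Finset.card_pos.1 (by omega)) hne
    rw [Finset.mem_sdiff] at ht'
    have hR0 : (R.filter (e0 ⊆ ·)).card = 1 ∧ cn e0 L = 1 := by
      have h1 : insert t' (R.filter (e0 ⊆ ·)) ⊆ T.filter (e0 ⊆ ·) := by
        intro x hx
        rcases Finset.mem_insert.1 hx with rfl | hx
        · simp [ht'.1, he0']
        · rw [Finset.mem_filter] at hx ⊢; exact ⟨hR hx.1, hx.2⟩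
      have h2 := Finset.card_le_card h1
      rw [Finset.card_insert_of_notMem (by simp [ht'.2])] at h2
      have h4 : 0 < (R.filter (e0 ⊆ ·)).card := Finset.card_pos.2 ⟨t, by simp [ht, he0]⟩
      have := two e0 hc0
      have := hL.1 e0 hc0
      omega
    have hsp : ∃ A d A', L = A ++ (e0, d) :: A' := by
      have : ∃ z ∈ L, z.1 = e0 := by
        by_contra! hc; have := cn_eq_zero.2 hc; omega
      obtain ⟨⟨z, d⟩, hz, rfl⟩ := this
      obtain ⟨A, A', h⟩ := List.append_of_mem hz
      exact ⟨A, d, A', h⟩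
    obtain ⟨A, d, A', rfl⟩ := hsp
    have huv : ∃ u v, u ≠ v ∧ e0 = {u, v} ∧ d = lt u v := by
      obtain ⟨a, b, hab, rfl⟩ := Finset.card_eq_two.1 hc0
      have := hlt a b hab
      by_cases hd : d = lt a b
      · exact ⟨a, b, hab, rfl, hd⟩
      · exact ⟨b, a, hab.symm, Finset.pair_comm _ _, by rw [this]; cases d <;> cases h : lt a b <;> simp_all⟩
    obtain ⟨u, v, huv, rfl, rfl⟩ := huv
    have hw : ∃ w, u ≠ w ∧ v ≠ w ∧ t = {u, v, w} := by
      have hct := h3 t (hR ht)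
      obtain ⟨w, hw⟩ := Finset.card_eq_one.1 (show (t \ {u, v}).card = 1 by
        rw [Finset.card_sdiff_of_subset he0, hct, hc0])
      have hwm : w ∈ t \ {u, v} := by rw [hw]; simp
      simp at hwm
      refine ⟨w, fun h => hwm.2.1 h.symm, fun h => hwm.2.2 h.symm, ?_⟩
      rw [← Finset.union_sdiff_of_subset he0, hw]
      ext; simp [or_assoc]
    obtain ⟨w, huw, hvw, rfl⟩ := hw
    set t : Finset P := {u, v, w} with htdef
    have hfil : ∀ e, (R.filter (e ⊆ ·)).card = ((R.erase t).filter (e ⊆ ·)).card + if e ⊆ t then 1 else 0 := by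
      intro e
      rw [Finset.card_filter, Finset.card_filter, add_comm]
      exact (Finset.add_sum_erase R (fun x => if e ⊆ x then 1 else 0) ht).symm
    have hL' : Cnt (A ++ sd lt u w :: sd lt w v :: A') (R.erase t) := by
      constructor
      · intro e he
        have := hL.1 e he
        rw [hfil, pair_ite huv huw hvw he] at this
        simp only [cn_append, cn_cons, sd] at this ⊢
        by_cases he' : {u, v} = e
        · subst he'
          simp only [cn_append, cn_cons, if_true, hfil {u, v}, pair_ite huv huw hvw he] at hR0 this ⊢
          omega
        · simp only [he', if_false] at this ⊢; omega
      · intro e he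
        have := hL.2 e he
        simp only [cn_append, cn_cons, sd] at this ⊢
        rw [if_neg (by rintro rfl; exact he (Finset.card_pair huw) : ¬ {u, w} = e), if_neg (by rintro rfl; exact he (Finset.card_pair hvw.symm) : ¬ {w, v} = e)]
        omega
    obtain ⟨Lf, l, i1, i2, i3, i4, i5, i6⟩ := ih (R.erase t) ((Finset.erase_subset _ _).trans hR)
      (by rw [Finset.card_erase_of_mem ht, hk]; rfl)
      (fun h => by have : t ∈ R.erase t := h ▸ hR ht
                   simp at this) _ hL'
    have htri : tri (v, u, w) = t := by
      rw [tri, htdef, Finset.insert_comm]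
    refine ⟨Lf, (v, u, w) :: l, i1, ?_, ?_, ?_, ?_, ?_⟩
    · rw [List.map_cons, List.nodup_cons, htri, i3]
      exact ⟨by simp, i2⟩
    · intro t1
      rw [List.map_cons, List.mem_cons, htri, i3, Finset.mem_erase]
      by_cases h : t1 = t
      · subst h; simp [ht]
      · simp [h]
    · intro S hS hf
      obtain ⟨h, b1, b2⟩ := i4 S hS hf
      have hrel := coc_rel huv huw hvw (hS t (hR ht))
      obtain ⟨g, hgd⟩ : ∃ g, g = sm S A := ⟨_, rfl⟩
      let ht0 : P → ZMod 2 := fun x => if x = u then g else if x = w then g + S {u, w} else g + S {u, w} + S {w, v}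
      have q1 : ht0 u = g := by simp [ht0]
      have q2 : ht0 w = g + S {u, w} := by simp [ht0, huw.symm]
      have q3 : ht0 v = g + S {u, w} + S {w, v} := by simp [ht0, huv.symm, hvw]
      refine ⟨Function.update h t ht0, ?_, ?_⟩
      · intro t1 ht1
        by_cases h1 : t1 = t
        · subst h1
          rw [Function.update_self]
          exact pot_ok huv huw hvw hrel (by rw [q1, q2]) (by rw [q3, q2])
        · rw [Function.update_of_ne h1]
          exact b1 t1 (Finset.mem_erase.2 ⟨h1, ht1⟩)
      · intro e he
        have := b2 e he
        rw [← Finset.add_sum_erase R _ ht]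
        rw [show ∑ x ∈ R.erase t, (if e ⊆ x then hl lt (Function.update h t ht0 x) e else 0) =
          ∑ x ∈ R.erase t, (if e ⊆ x then hl lt (h x) e else 0) from Finset.sum_congr rfl fun x hx => by
            rw [Function.update_of_ne (Finset.ne_of_mem_erase hx)]]
        rw [Function.update_self, pair_ite huv huw hvw he]
        have a1 := al_sd hlt S ht0 huv (by rw [q3, q1, hrel]; ring) e
        have a2 := al_sd hlt S ht0 huw (by rw [q2, q1]) e
        have a3 := al_sd hlt S ht0 hvw.symm (by rw [q2, q3]) e
        rw [← a1, ← a2, ← a3, q1, q2]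
        rw [show A ++ sd lt u w :: sd lt w v :: A' = A ++ ([sd lt u w] ++ ([sd lt w v] ++ A')) by simp] at this
        rw [show A ++ ({u, v}, lt u v) :: A' = A ++ ([sd lt u v] ++ A') by simp [sd]]
        simp only [al_append, zero_add, ← hgd] at this ⊢
        have s1 : sm S [sd lt u w] = S {u, w} := by simp [sm, sd]
        have s2 : sm S [sd lt w v] = S {w, v} := by simp [sm, sd]
        have s3 : sm S [sd lt u v] = S {u, w} + S {w, v} := by simp [sm, sd, hrel]
        rw [s1, s2] at this
        rw [s3, ← add_assoc g]
        generalize al S e A' (g + S {u, w} + S {w, v}) = X at this ⊢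
        linear_combination this + z2 (al S e [sd lt u v] g)
    · intro k hg
      have h1 := i5 k hg
      have hR0' := hR0
      rw [hfil, if_pos he0] at hR0'
      have h2 := Good.cut (e := {u, v}) (d := lt u v) ?_ ?_ h1
      · simpa [bdw, sd, hlt u v huv, Finset.pair_comm v u] using h2
      · rw [← cn_eq_zero]
        have := hL'.1 {u, v} hc0
        have q := hR0'.2
        simp only [cn_append, cn_cons, if_true] at q
        rw [cn_append, cn_cons, cn_cons]
        simp only [sd]
        have n1 : ({u, w} : Finset P) ≠ {u, v} := fun h => by
          have : v ∈ ({u, w} : Finset P) := h ▸ (by simp)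
          simp at this; tauto
        have n2 : ({w, v} : Finset P) ≠ {u, v} := fun h => by
          have : u ∈ ({w, v} : Finset P) := h ▸ (by simp)
          simp at this; tauto
        simp [n1, n2]; omega
      · intro ww hww y hy hye
        obtain ⟨o, ho, rfl⟩ := List.mem_map.1 hww
        have hoR := (i3 (tri o)).1 (List.mem_map.2 ⟨o, ho, rfl⟩)
        have hsub : y.1 ⊆ tri o := by
          simp only [bdw, List.mem_cons, List.not_mem_nil, or_false] at hy
          rcases hy with rfl | rfl | rfl <;> simp only [sd, tri] <;> intro z hz <;> simp at hz ⊢ <;> tauto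
        rw [hye] at hsub
        have : 0 < ((R.erase t).filter (({u, v} : Finset P) ⊆ ·)).card :=
          Finset.card_pos.2 ⟨tri o, Finset.mem_filter.2 ⟨hoR, hsub⟩⟩
        omega
    · intro e
      have e2 : dif (A ++ sd lt u w :: sd lt w v :: A') e = dif A e + (dif [sd lt u w] e + (dif [sd lt w v] e + dif A' e)) := by
        rw [dif_append, dif_cons, dif_cons (sd lt w v)]
      have e3 : dif (A ++ ({u, v}, lt u v) :: A') e = dif A e + (dif [sd lt u v] e + dif A' e) := by
        rw [dif_append, dif_cons]; rfl
      rw [i6, List.map_cons, List.sum_cons, e2, e3]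
      have e1 : dif (bdw lt (v, u, w)) e = dif [sd lt v u] e + dif [sd lt u w] e + dif [sd lt w v] e := by
        simp only [bdw]; rw [dif_cons, dif_cons (sd lt u w)]; ring
      rw [e1, dif_flip hlt huv]
      ring

theorem main_comb {lt : P → P → Bool} (hlt : IsLt lt) {T : Finset (Finset P)} (hT : T.Nonempty) (h3 : ∀ t ∈ T, t.card = 3)
    (two : ∀ e : Finset P, e.card = 2 → (T.filter (e ⊆ ·)).card = 0 ∨ (T.filter (e ⊆ ·)).card = 2)
    (dual : ∀ R ⊆ T, R.Nonempty → R ≠ T → ∃ t ∈ R, ∃ t' ∈ T \ R, ∃ e ⊆ t, e ⊆ t' ∧ e.card = 2)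
    (link : ∀ v : P, ∀ h : Finset P → ZMod 2, (∀ t ∈ T, ∀ t' ∈ T, ∀ e ⊆ t, e ⊆ t' → e.card = 2 → v ∈ e → h t = h t') →
      ∀ t ∈ T, ∀ t' ∈ T, v ∈ t → v ∈ t' → h t = h t')
    (hor : ¬ ∃ l : List (P × P × P), (l.map tri).Nodup ∧ (∀ t, t ∈ l.map tri ↔ t ∈ T) ∧
      ∀ e, (l.map fun o => dif (bdw lt o) e).sum = 0)
    {m : ℕ} (Φ : (Fin m → ZMod 2) →ₗ[ZMod 2] (Finset P → ZMod 2)) (hΦ : ∀ a, ∀ t ∈ T, IsCoc (Φ a) t)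
    (hΦ' : ∀ a, IsCob (Φ a) T → a = 0) :
    ∃ l : List (P × P × P), (l.map tri).Nodup ∧ (∀ t, t ∈ l.map tri ↔ t ∈ T) ∧ Good m (l.map (bdw lt)) := by
  obtain ⟨t0, ht0⟩ := hT
  obtain ⟨a, b, c, hab, hac, hbc, rfl⟩ := Finset.card_eq_three.1 (h3 t0 ht0)
  set t0 : Finset P := {a, b, c} with ht0d
  have hfil : ∀ e, (T.filter (e ⊆ ·)).card = ((T.erase t0).filter (e ⊆ ·)).card + if e ⊆ t0 then 1 else 0 := by
    intro e
    rw [Finset.card_filter, Finset.card_filter, add_comm]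
    exact (Finset.add_sum_erase T (fun x => if e ⊆ x then 1 else 0) ht0).symm
  have hsw : t0 = {a, c, b} := by rw [ht0d, Finset.pair_comm]
  have hL : Cnt (bdw lt (a, b, c)) (T.erase t0) := by
    constructor
    · intro e he
      have := two e he
      rw [hfil, hsw, pair_ite hac hab hbc.symm he] at this
      simp only [bdw, cn_cons, cn_nil, sd, Finset.pair_comm c a]
      rw [hsw]
      omega
    · intro e he
      simp only [bdw, cn_cons, cn_nil, sd]
      rw [if_neg, if_neg, if_neg] <;> rintro rfl
      · exact he (Finset.card_pair hab)
      · exact he (Finset.card_pair hbc)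
      · exact he (Finset.card_pair hac.symm)
  obtain ⟨Lf, l, i1, i2, i3, i4, i5, i6⟩ := grow hlt h3 two dual _ (T.erase t0) (Finset.erase_subset _ _) rfl
      (fun h => by have : t0 ∈ T.erase t0 := by rw [h]; exact ht0
                   simp at this) _ hL
  have j1 : (((a, b, c) :: l).map tri).Nodup := by
    rw [List.map_cons, List.nodup_cons, i3]; exact ⟨by simp [tri, ht0d], i2⟩
  have j2 : ∀ t, t ∈ ((a, b, c) :: l).map tri ↔ t ∈ T := by
    intro t1
    rw [List.map_cons, List.mem_cons, show tri (a, b, c) = t0 from rfl, i3, Finset.mem_erase]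
    by_cases h : t1 = t0
    · subst h; simp [ht0]
    · simp [h]
  refine ⟨(a, b, c) :: l, j1, j2, i5 m ?_⟩
  have htw : ∃ p, 2 ≤ Lf.count p := by
    by_contra! hc
    refine hor ⟨_, j1, j2, fun e => ?_⟩
    rw [List.map_cons, List.sum_cons, ← i6]
    have h1 := hc (e, true)
    have h2 := hc (e, false)
    have := i1 e
    simp only [cn, dif] at this ⊢
    omega
  refine S1 _ Lf le_rfl i1 htw m ⟨Φ, fun x hx => hΦ' x ?_⟩
  obtain ⟨h, b1, b2⟩ := i4 (Φ x) (hΦ x) ⟨fun _ _ => 0, by simp, fun e _ => by simpa using hx e⟩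
  set S := Φ x
  have hrel : S {a, c} = S {a, b} + S {b, c} := coc_rel hac hab hbc.symm (hsw ▸ hΦ x t0 ht0)
  let g0 : P → ZMod 2 := fun x => if x = a then 0 else if x = b then S {a, b} else S {a, b} + S {b, c}
  have q1 : g0 a = 0 := by simp [g0]
  have q2 : g0 b = S {a, b} := by simp [g0, hab.symm]
  have q3 : g0 c = S {a, b} + S {b, c} := by simp [g0, hac.symm, hbc.symm]
  let h' := Function.update h t0 g0
  have c1 : ∀ t ∈ T, ∀ x ∈ t, ∀ y ∈ t, x ≠ y → S {x, y} = h' t x + h' t y := by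
    intro t1 ht1
    by_cases h1 : t1 = t0
    · subst h1
      rw [show h' t0 = g0 from Function.update_self _ _ _, hsw]
      exact pot_ok hac hab hbc.symm hrel (by rw [q1, q2, zero_add]) (by rw [q3, q2])
    · rw [show h' t1 = h t1 from Function.update_of_ne h1 _ _]
      exact b1 t1 (Finset.mem_erase.2 ⟨h1, ht1⟩)
  have c2 : ∀ e : Finset P, e.card = 2 → (∑ t ∈ T, if e ⊆ t then hl lt (h' t) e else 0) = 0 := by
    intro e he
    refine Eq.trans ?_ (b2 e he)
    rw [← Finset.add_sum_erase T _ ht0]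
    congr 1
    · rw [show h' t0 = g0 from Function.update_self _ _ _, hsw, pair_ite hac hab hbc.symm he]
      have a2 := al_sd hlt S g0 hab (by rw [q2, q1, zero_add]) e
      have a3 := al_sd hlt S g0 hbc (by rw [q2, q3]) e
      have a1 := al_sd hlt S g0 hac.symm (by rw [Finset.pair_comm c a, q1, q3, hrel, z2]) e
      rw [Finset.pair_comm c a] at a1
      rw [← a1, ← a2, ← a3, q1, q2, q3]
      rw [show bdw lt (a, b, c) = [sd lt a b] ++ ([sd lt b c] ++ [sd lt c a]) by simp [bdw]]
      simp only [al_append, zero_add]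
      have s1 : sm S [sd lt a b] = S {a, b} := by simp [sm, sd]
      have s2 : sm S [sd lt b c] = S {b, c} := by simp [sm, sd]
      rw [s1, s2]; ring
    · refine Finset.sum_congr rfl fun x hx => ?_
      rw [show h' x = h x from Function.update_of_ne (Finset.ne_of_mem_erase hx) _ _]
  have c3 : ∀ t ∈ T, ∀ t' ∈ T, ∀ e ⊆ t, e ⊆ t' → e.card = 2 → ∀ v ∈ e, h' t v = h' t' v := by
    intro t ht t' ht' e he he' hc v hv
    by_cases hne : t = t'
    · rw [hne]
    have hs := c2 e hc
    rw [← Finset.sum_filter] at hs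
    have hft : T.filter (e ⊆ ·) = {t, t'} := by
      symm
      apply Finset.eq_of_subset_of_card_le
      · intro x hx; simp at hx; rcases hx with rfl | rfl <;> simp [*]
      · rw [Finset.card_pair hne]; have := two e hc; omega
    rw [hft, Finset.sum_pair hne, CharTwo.add_eq_zero] at hs
    obtain ⟨p, q, hpq, rfl⟩ := Finset.card_eq_two.1 hc
    rw [hl_pair hlt _ hpq, hl_pair hlt _ hpq] at hs
    have hp := he (show p ∈ ({p, q} : Finset P) by simp)
    have hq := he (show q ∈ ({p, q} : Finset P) by simp)
    have hp' := he' (show p ∈ ({p, q} : Finset P) by simp)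
    have hq' := he' (show q ∈ ({p, q} : Finset P) by simp)
    have k1 := c1 t ht p hp q hq hpq
    have k2 := c1 t' ht' p hp' q hq' hpq
    rw [k1] at k2
    have : h' t p = h' t' p ∧ h' t q = h' t' q := by
      split_ifs at hs
      · rw [hs] at k2 ⊢; exact ⟨rfl, add_left_cancel k2⟩
      · rw [hs] at k2 ⊢; exact ⟨add_right_cancel k2, rfl⟩
    simp at hv
    rcases hv with rfl | rfl
    · exact this.1
    · exact this.2
  have c4 : ∀ v : P, ∀ t ∈ T, ∀ t' ∈ T, v ∈ t → v ∈ t' → h' t v = h' t' v := fun v =>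
    link v (fun t => h' t v) fun t ht t' ht' e he he' hc hv => c3 t ht t' ht' e he he' hc v hv
  classical
  let G : P → ZMod 2 := fun v => if hv : ∃ t ∈ T, v ∈ t then h' hv.choose v else 0
  have hG : ∀ t ∈ T, ∀ v ∈ t, G v = h' t v := by
    intro t ht v hv
    have hex : ∃ t ∈ T, v ∈ t := ⟨t, ht, hv⟩
    simp only [G, dif_pos hex]
    exact c4 v _ hex.choose_spec.1 t ht hex.choose_spec.2 hv
  refine ⟨G, fun t ht x hx y hy hxy => ?_⟩
  rw [c1 t ht x hx y hy hxy, hG t ht x hx, hG t ht y hy]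

end Grow
end PaperAlg

namespace PaperAlg
section LinAlg
variable {P : Type*} [DecidableEq P]

theorem LA {X : Type*} [DecidableEq X] (N : Finset X) (S : Submodule (ZMod 2) (X → ZMod 2))
    (conn : ∀ R ⊆ N, R.Nonempty → R ≠ N → ∃ t ∈ R, ∃ t' ∈ N \ R, (Pi.single t 1 + Pi.single t' 1 : X → ZMod 2) ∈ S)
    (y : X → ZMod 2) (hy : ∀ t ∉ N, y t = 0) (hs : ∑ t ∈ N, y t = 0) : y ∈ S := by
  classical
  have h2 : ∀ f : X → ZMod 2, f + f = 0 := fun f => by ext; simp [z2]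
  rcases N.eq_empty_or_nonempty with rfl | ⟨t0, ht0⟩
  · rw [show y = 0 from funext fun t => hy t (by simp)]; exact S.zero_mem
  let R := N.filter fun t => (Pi.single t 1 + Pi.single t0 1 : X → ZMod 2) ∈ S
  have hR : R = N := by
    by_contra hne
    obtain ⟨t, ht, t', ht', h⟩ := conn R (Finset.filter_subset _ _) ⟨t0, by simp [R, ht0, h2]⟩ hne
    rw [Finset.mem_sdiff] at ht'
    refine ht'.2 (Finset.mem_filter.2 ⟨ht'.1, ?_⟩)
    have := S.add_mem h (Finset.mem_filter.1 ht).2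
    convert this using 1
    have := h2 (Pi.single t 1)
    linear_combination -this
  have hy' : y = ∑ t ∈ N, y t • (Pi.single t 1 + Pi.single t0 1 : X → ZMod 2) := by
    simp only [smul_add, Finset.sum_add_distrib, ← Finset.sum_smul, hs, zero_smul, add_zero]
    ext t
    simp only [Finset.sum_apply, Pi.smul_apply, Pi.single_apply, smul_eq_mul, mul_ite, mul_one, mul_zero]
    rw [Finset.sum_ite_eq]
    split_ifs with h
    · rfl
    · exact hy t h
  rw [hy']
  refine S.sum_mem fun t ht => S.smul_mem _ ?_
  rw [← hR] at ht
  exact (Finset.mem_filter.1 ht).2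

def del (T : Finset (Finset P)) : (Finset P → ZMod 2) →ₗ[ZMod 2] (Finset P → ZMod 2) where
  toFun c t := if t ∈ T then ∑ e ∈ Finset.powersetCard 2 t, c e else 0
  map_add' c d := by ext t; by_cases h : t ∈ T <;> simp [h, Finset.sum_add_distrib]
  map_smul' a c := by ext t; by_cases h : t ∈ T <;> simp [h, Finset.mul_sum]

theorem sum_pc {M : Type*} [AddCommMonoid M] {u v w : P} (huv : u ≠ v) (huw : u ≠ w) (hvw : v ≠ w) (S : Finset P → M) :
    ∑ e ∈ Finset.powersetCard 2 {u, v, w}, S e = S {u, v} + S {u, w} + S {w, v} := by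
  rw [show Finset.powersetCard 2 {u, v, w} = ({{u, v}, {u, w}, {w, v}} : Finset (Finset P)) from ?_]
  · rw [Finset.sum_insert, Finset.sum_pair, add_assoc]
    · intro h
      have : u ∈ ({w, v} : Finset P) := h ▸ (by simp)
      simp at this; tauto
    · simp only [Finset.mem_insert, Finset.mem_singleton, not_or]
      constructor <;> intro h
      · have : v ∈ ({u, w} : Finset P) := h ▸ (by simp)
        simp at this; tauto
      · have : u ∈ ({w, v} : Finset P) := h ▸ (by simp)
        simp at this; tauto
  · ext e
    simp only [Finset.mem_powersetCard, Finset.mem_insert, Finset.mem_singleton]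
    constructor
    · rintro ⟨h1, h2⟩
      rcases (pair_sub huv huw hvw h2).1 h1 with h | h | h <;> simp [← h]
    · intro h
      have h2 : e.card = 2 := by
        rcases h with rfl | rfl | rfl
        exacts [Finset.card_pair huv, Finset.card_pair huw, Finset.card_pair hvw.symm]
      exact ⟨(pair_sub huv huw hvw h2).2 (by tauto), h2⟩

theorem coc_iff {S : Finset P → ZMod 2} {t : Finset P} (ht : t.card = 3) :
    IsCoc S t ↔ ∑ e ∈ Finset.powersetCard 2 t, S e = 0 := by
  obtain ⟨u, v, w, huv, huw, hvw, rfl⟩ := Finset.card_eq_three.1 ht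
  rw [sum_pc huv huw hvw]
  constructor
  · intro h
    rw [coc_rel huv huw hvw h]
    linear_combination z2 (S {u, w}) + z2 (S {w, v})
  · intro h
    refine ⟨fun x => if x = u then 0 else if x = w then S {u, w} else S {u, w} + S {w, v}, ?_⟩
    apply pot_ok huv huw hvw
    · linear_combination h - z2 (S {u, w}) - z2 (S {w, v})
    · simp [huw.symm]
    · simp [huw.symm, huv.symm, hvw]

def ed (T : Finset (Finset P)) : Finset (Finset P) := T.biUnion (Finset.powersetCard 2)
def vs (T : Finset (Finset P)) : Finset P := T.biUnion id

theorem mem_ed {T : Finset (Finset P)} {e} : e ∈ ed T ↔ ∃ t ∈ T, e ⊆ t ∧ e.card = 2 := by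
  simp [ed, Finset.mem_powersetCard]

theorem sum_del {T : Finset (Finset P)}
    (two : ∀ e : Finset P, e.card = 2 → (T.filter (e ⊆ ·)).card = 0 ∨ (T.filter (e ⊆ ·)).card = 2)
    (c : Finset P → ZMod 2) : ∑ t ∈ T, del T c t = 0 := by
  have h1 : ∀ t ∈ T, del T c t = ∑ e ∈ ed T, if e ⊆ t then c e else 0 := by
    intro t ht
    simp only [del, LinearMap.coe_mk, AddHom.coe_mk, if_pos ht]
    rw [← Finset.sum_filter]
    apply Finset.sum_congr _ fun _ _ => rfl
    ext e
    rw [Finset.mem_filter, mem_ed, Finset.mem_powersetCard]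
    exact ⟨fun h => ⟨⟨t, ht, h⟩, h.1⟩, fun h => ⟨h.2, h.1.choose_spec.2.2⟩⟩
  rw [Finset.sum_congr rfl h1, Finset.sum_comm]
  refine Finset.sum_eq_zero fun e he => ?_
  rw [← Finset.sum_filter, Finset.sum_const]
  obtain ⟨_, _, _, h⟩ := mem_ed.1 he
  rcases two e h with h | h <;> rw [h]
  · simp
  · rw [two_smul, z2]

theorem card_ed {T : Finset (Finset P)} (h3 : ∀ t ∈ T, t.card = 3)
    (two : ∀ e : Finset P, e.card = 2 → (T.filter (e ⊆ ·)).card = 0 ∨ (T.filter (e ⊆ ·)).card = 2) :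
    2 * (ed T).card = 3 * T.card := by
  have h1 : ∑ t ∈ T, ∑ e ∈ ed T, (if e ⊆ t then 1 else 0) = 3 * T.card := by
    rw [mul_comm, ← smul_eq_mul, ← Finset.sum_const]
    refine Finset.sum_congr rfl fun t ht => ?_
    rw [← Finset.card_filter, show (ed T).filter (· ⊆ t) = Finset.powersetCard 2 t from ?_,
      Finset.card_powersetCard, h3 t ht]
    · rfl
    ext e
    rw [Finset.mem_filter, mem_ed, Finset.mem_powersetCard]
    exact ⟨fun h => ⟨h.2, h.1.choose_spec.2.2⟩, fun h => ⟨⟨t, ht, h⟩, h.1⟩⟩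
  rw [← h1, Finset.sum_comm, mul_comm, ← smul_eq_mul, ← Finset.sum_const]
  refine Finset.sum_congr rfl fun e he => ?_
  rw [← Finset.card_filter]
  obtain ⟨t, ht, hs, h⟩ := mem_ed.1 he
  rcases two e h with h | h
  · rw [Finset.card_eq_zero] at h
    have : t ∈ T.filter (e ⊆ ·) := by simp [ht, hs]
    rw [h] at this; simp at this
  · exact h.symm

theorem del_single {T : Finset (Finset P)} {e t t' : Finset P}
    (two : ∀ e : Finset P, e.card = 2 → (T.filter (e ⊆ ·)).card = 0 ∨ (T.filter (e ⊆ ·)).card = 2)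
    (ht : t ∈ T) (ht' : t' ∈ T) (hne : t ≠ t') (he : e ⊆ t) (he' : e ⊆ t') (hc : e.card = 2) :
    del T (Pi.single e 1) = Pi.single t 1 + Pi.single t' 1 := by
  have hft : T.filter (e ⊆ ·) = {t, t'} := by
    symm
    apply Finset.eq_of_subset_of_card_le
    · intro x hx; simp at hx; rcases hx with rfl | rfl <;> simp [*]
    · rw [Finset.card_pair hne]; have := two e hc; omega
  ext s
  have hs : s ∈ T ∧ e ⊆ s ↔ s = t ∨ s = t' := by
    have : s ∈ T.filter (e ⊆ ·) ↔ s ∈ ({t, t'} : Finset _) := by rw [hft]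
    simpa using this
  simp only [del, LinearMap.coe_mk, AddHom.coe_mk, Pi.add_apply, Pi.single_apply, Finset.sum_ite_eq',
    Finset.mem_powersetCard, hc, and_true]
  by_cases h1 : s = t
  · subst h1; simp [ht, he, hne]
  · by_cases h2 : s = t'
    · subst h2; simp [ht', he', h1]
    · have : ¬ (s ∈ T ∧ e ⊆ s) := by tauto
      simp only [h1, h2, if_false, add_zero]
      split_ifs <;> tauto

theorem b_char {T : Finset (Finset P)} (hT : T.Nonempty) (h3 : ∀ t ∈ T, t.card = 3)
    (two : ∀ e : Finset P, e.card = 2 → (T.filter (e ⊆ ·)).card = 0 ∨ (T.filter (e ⊆ ·)).card = 2)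
    (dual : ∀ R ⊆ T, R.Nonempty → R ≠ T → ∃ t ∈ R, ∃ t' ∈ T \ R, ∃ e ⊆ t, e ⊆ t' ∧ e.card = 2) :
    ∃ b : ℕ, (b : ℤ) = 2 - ((vs T).card - (ed T).card + T.card) ∧
     (∃ Φ : (Fin b → ZMod 2) →ₗ[ZMod 2] (Finset P → ZMod 2), (∀ a, ∀ t ∈ T, IsCoc (Φ a) t) ∧ ∀ a, IsCob (Φ a) T → a = 0) ∧
     ∀ m, ∀ Φ : (Fin m → ZMod 2) →ₗ[ZMod 2] (Finset P → ZMod 2), (∀ a, ∀ t ∈ T, IsCoc (Φ a) t) →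
        (∀ a, IsCob (Φ a) T → a = 0) → m ≤ b := by
  classical
  let x1 : (ed T → ZMod 2) →ₗ[ZMod 2] (Finset P → ZMod 2) := Function.ExtendByZero.linearMap (ZMod 2) Subtype.val
  let x2 : (T → ZMod 2) →ₗ[ZMod 2] (Finset P → ZMod 2) := Function.ExtendByZero.linearMap (ZMod 2) Subtype.val
  have x1v : ∀ c, ∀ e : ed T, x1 c e.1 = c e := fun c e => Subtype.val_injective.extend_apply _ _ _
  have x2v : ∀ c, ∀ e : T, x2 c e.1 = c e := fun c e => Subtype.val_injective.extend_apply _ _ _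
  have x2n : ∀ c, ∀ e ∉ T, x2 c e = 0 := fun c e he => Function.extend_apply' _ _ _ (by simpa using he)
  let d1 := (del T).comp x1
  let d0 : (vs T → ZMod 2) →ₗ[ZMod 2] (ed T → ZMod 2) :=
    { toFun := fun g e => ∑ v : vs T, if v.1 ∈ e.1 then g v else 0
      map_add' := fun g h => by
        ext e; simp only [Pi.add_apply, ← Finset.sum_add_distrib]
        exact Finset.sum_congr rfl fun v _ => by split_ifs <;> simp
      map_smul' := fun a g => by
        ext e; simp only [Pi.smul_apply, smul_eq_mul, Finset.mul_sum, RingHom.id_apply]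
        exact Finset.sum_congr rfl fun v _ => by split_ifs <;> simp }
  have memv : ∀ {t x}, t ∈ T → x ∈ t → x ∈ vs T := fun ht hx => Finset.mem_biUnion.2 ⟨_, ht, hx⟩
  have meme : ∀ {t x y}, t ∈ T → x ∈ t → y ∈ t → x ≠ y → {x, y} ∈ ed T := fun {t x y} ht hx hy hxy =>
    mem_ed.2 ⟨t, ht, by intro z; simp; rintro (rfl | rfl) <;> assumption, Finset.card_pair hxy⟩
  have d0v : ∀ g : P → ZMod 2, ∀ {x y} (h : {x, y} ∈ ed T), x ≠ y → d0 (fun v => g v) ⟨{x, y}, h⟩ = g x + g y := by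
    intro g x y h hxy
    obtain ⟨t, ht, hs, hc⟩ := mem_ed.1 h
    have := Finset.sum_coe_sort (vs T) (fun v => if v ∈ ({x, y} : Finset P) then g v else 0)
    change ∑ v : vs T, _ = _
    rw [this, ← Finset.sum_filter, ← Finset.sum_pair hxy]
    refine Finset.sum_congr ?_ fun _ _ => rfl
    ext z
    simp only [Finset.mem_filter]
    exact ⟨fun h => h.2, fun h => ⟨memv ht (hs h), h⟩⟩
  let ex : (vs T → ZMod 2) → P → ZMod 2 := fun g => Function.extend Subtype.val g 0
  have exv : ∀ g, (fun v : vs T => ex g v.1) = g := fun g => funext fun v => Subtype.val_injective.extend_apply _ _ _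
  let Z := LinearMap.ker d1
  have hZ : ∀ c, c ∈ Z ↔ ∀ t ∈ T, IsCoc (x1 c) t := by
    intro c
    rw [LinearMap.mem_ker]
    constructor
    · intro h t ht
      have := congrFun h t
      simp only [d1, del, LinearMap.coe_comp, Function.comp, LinearMap.coe_mk, AddHom.coe_mk, if_pos ht] at this
      exact (coc_iff (h3 t ht)).2 this
    · intro h
      ext t
      simp only [d1, del, LinearMap.coe_comp, Function.comp, LinearMap.coe_mk, AddHom.coe_mk]
      split_ifs with ht
      · exact (coc_iff (h3 t ht)).1 (h t ht)
      · rfl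
  have hB : ∀ c, c ∈ LinearMap.range d0 ↔ IsCob (x1 c) T := by
    intro c
    constructor
    · rintro ⟨g, rfl⟩
      refine ⟨ex g, fun t ht x hx y hy hxy => ?_⟩
      rw [← d0v (ex g) (meme ht hx hy hxy) hxy, exv]
      exact x1v _ ⟨{x, y}, meme ht hx hy hxy⟩
    · rintro ⟨g, hg⟩
      refine ⟨fun v => g v, ?_⟩
      ext ⟨e, he⟩
      obtain ⟨t, ht, hs, hc⟩ := mem_ed.1 he
      obtain ⟨x, y, hxy, rfl⟩ := Finset.card_eq_two.1 hc
      rw [d0v g he hxy, ← hg t ht x (hs (by simp)) y (hs (by simp)) hxy]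
      exact x1v _ ⟨{x, y}, he⟩
  have hBZ : LinearMap.range d0 ≤ Z := by
    intro c hc
    obtain ⟨g, hg⟩ := (hB c).1 hc
    exact (hZ c).2 fun t ht => ⟨g, hg t ht⟩
  have hrB : Module.finrank (ZMod 2) (LinearMap.range d0) + 1 = (vs T).card := by
    have h1 := LinearMap.finrank_range_add_finrank_ker d0
    rw [Module.finrank_fintype_fun_eq_card, Fintype.card_coe] at h1
    rw [← h1]; congr 1; symm
    obtain ⟨t0, ht0⟩ := hT
    obtain ⟨p0, hp0⟩ := Finset.card_pos.1 (show 0 < t0.card by rw [h3 t0 ht0]; norm_num)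
    rw [finrank_eq_one_iff']
    have one0 : d0 (fun _ => 1) = 0 := by
      ext ⟨e, he⟩
      obtain ⟨t, ht, hs, hc⟩ := mem_ed.1 he
      obtain ⟨x, y, hxy, rfl⟩ := Finset.card_eq_two.1 hc
      rw [d0v (fun _ => 1) he hxy]; rfl
    refine ⟨⟨fun _ => 1, one0⟩, ?_, ?_⟩
    · intro h
      have := congrFun (congrArg Subtype.val h) ⟨p0, memv ht0 hp0⟩
      simp at this
    rintro ⟨g, hg⟩
    have hconst : ∀ {t x y}, t ∈ T → x ∈ t → y ∈ t → ex g x = ex g y := by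
      intro t x y ht hx hy
      by_cases hxy : x = y
      · rw [hxy]
      have := d0v (ex g) (meme ht hx hy hxy) hxy
      rw [exv, LinearMap.mem_ker.1 hg] at this
      exact (CharTwo.add_eq_zero.1 this.symm)
    let R := T.filter fun t => ∀ x ∈ t, ex g x = ex g p0
    have hR : R = T := by
      by_contra hne
      obtain ⟨t, ht, t', ht', e, he, he', hc⟩ := dual R (Finset.filter_subset _ _)
        ⟨t0, Finset.mem_filter.2 ⟨ht0, fun x hx => hconst ht0 hx hp0⟩⟩ hne
      rw [Finset.mem_sdiff] at ht'
      obtain ⟨y, hy⟩ := Finset.card_pos.1 (show 0 < e.card by omega)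
      exact ht'.2 (Finset.mem_filter.2 ⟨ht'.1, fun x hx =>
        (hconst ht'.1 hx (he' hy)).trans ((Finset.mem_filter.1 ht).2 y (he hy))⟩)
    refine ⟨ex g p0, Subtype.ext ?_⟩
    ext ⟨v, hv⟩
    obtain ⟨t, ht, hvt⟩ := Finset.mem_biUnion.1 hv
    rw [← hR] at ht
    have := (Finset.mem_filter.1 ht).2 v hvt
    rw [← this]
    change ex g v * 1 = _
    rw [mul_one]
    exact congrFun (exv g) ⟨v, hv⟩
  have hrd : Module.finrank (ZMod 2) (LinearMap.range d1) + 1 = T.card := by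
    let σ : (T → ZMod 2) →ₗ[ZMod 2] ZMod 2 := ∑ t, LinearMap.proj t
    have hσ : ∀ y, σ y = ∑ t ∈ T, x2 y t := fun y => by
      rw [← Finset.sum_coe_sort T (fun t => x2 y t)]
      simp [σ, x2v]
    have h0 : LinearMap.range d1 = (LinearMap.ker σ).map x2 := by
      apply le_antisymm
      · rintro _ ⟨c, rfl⟩
        have hx : x2 (fun t => d1 c t.1) = d1 c := by
          ext t
          by_cases ht : t ∈ T
          · exact x2v _ ⟨t, ht⟩
          · rw [x2n _ t ht]; simp [d1, del, ht]
        refine ⟨fun t => d1 c t.1, ?_, hx⟩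
        rw [SetLike.mem_coe, LinearMap.mem_ker, hσ, hx]
        exact sum_del two _
      · rintro _ ⟨y, hy, rfl⟩
        refine LA T _ ?_ _ (x2n y) ?_
        · intro R hR hRn hne
          obtain ⟨t, ht, t', ht', e, he, he', hc⟩ := dual R hR hRn hne
          refine ⟨t, ht, t', ht', ?_⟩
          rw [Finset.mem_sdiff] at ht'
          have hee : e ∈ ed T := mem_ed.2 ⟨t, hR ht, he, hc⟩
          refine ⟨Pi.single ⟨e, hee⟩ 1, ?_⟩
          rw [← del_single two (hR ht) ht'.1 (fun h => ht'.2 (h ▸ ht)) he he' hc]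
          change del T _ = _
          congr 1
          ext e'
          by_cases hf : e' ∈ ed T
          · rw [x1v _ ⟨e', hf⟩]; simp [Pi.single_apply]
          · rw [show x1 _ e' = 0 from Function.extend_apply' _ _ _ (by simpa using hf)]
            rw [Pi.single_eq_of_ne (by rintro rfl; exact hf hee)]
        · rw [← hσ]; exact hy
    have hinj : Function.Injective x2 := fun a b h => funext fun t => by rw [← x2v a, h, x2v]
    rw [h0, ← (Submodule.equivMapOfInjective x2 hinj _).finrank_eq]
    have h1 := LinearMap.finrank_range_add_finrank_ker σ
    rw [Module.finrank_fintype_fun_eq_card, Fintype.card_coe] at h1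
    have hs : LinearMap.range σ = ⊤ := by
      rw [LinearMap.range_eq_top]
      intro a
      obtain ⟨t0, ht0⟩ := hT
      exact ⟨Pi.single ⟨t0, ht0⟩ a, by simp [σ]⟩
    rw [hs, finrank_top, Module.finrank_self] at h1
    omega
  let B := (LinearMap.range d0).comap Z.subtype
  have hb1 : Module.finrank (ZMod 2) (Z ⧸ B) + Module.finrank (ZMod 2) B = Module.finrank (ZMod 2) Z :=
    Submodule.finrank_quotient_add_finrank B
  have hb2 : Module.finrank (ZMod 2) B = Module.finrank (ZMod 2) (LinearMap.range d0) :=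
    (Submodule.comapSubtypeEquivOfLe hBZ).finrank_eq
  have hb3 := LinearMap.finrank_range_add_finrank_ker d1
  rw [Module.finrank_fintype_fun_eq_card, Fintype.card_coe] at hb3
  refine ⟨Module.finrank (ZMod 2) (Z ⧸ B), ?_, ?_, ?_⟩
  · have := card_ed h3 two
    change _ + Module.finrank (ZMod 2) Z = _ at hb3
    omega
  · let eq : (Fin (Module.finrank (ZMod 2) (Z ⧸ B)) → ZMod 2) ≃ₗ[ZMod 2] (Z ⧸ B) :=
      LinearEquiv.ofFinrankEq _ _ (by simp)
    obtain ⟨s, hs⟩ := B.mkQ.exists_rightInverse_of_surjective (Submodule.range_mkQ B)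
    refine ⟨x1.comp (Z.subtype.comp (s.comp eq.toLinearMap)), fun a => (hZ _).1 (s (eq a)).2, fun a ha => ?_⟩
    have h1 : s (eq a) ∈ B := (hB _).2 ha
    have h2 : B.mkQ (s (eq a)) = eq a := LinearMap.congr_fun hs (eq a)
    rw [Submodule.mkQ_apply, (Submodule.Quotient.mk_eq_zero B).2 h1] at h2
    simpa using h2.symm
  · intro m Φ h1 h2
    let ρ : (Finset P → ZMod 2) →ₗ[ZMod 2] (ed T → ZMod 2) := LinearMap.funLeft _ _ Subtype.val
    have hρ : ∀ c, ∀ {t x y}, t ∈ T → x ∈ t → y ∈ t → x ≠ y → x1 (ρ c) {x, y} = c {x, y} := fun c {t x y} ht hx hy hxy =>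
      x1v (ρ c) ⟨_, meme ht hx hy hxy⟩
    let Ψ := (ρ.comp Φ).codRestrict Z fun a => (hZ _).2 fun t ht => by
      obtain ⟨g, hg⟩ := h1 a t ht
      exact ⟨g, fun x hx y hy hxy => (hρ (Φ a) ht hx hy hxy).trans (hg x hx y hy hxy)⟩
    have : Function.Injective (B.mkQ.comp Ψ) := by
      rw [← LinearMap.ker_eq_bot, LinearMap.ker_eq_bot']
      intro a ha
      rw [LinearMap.comp_apply, Submodule.mkQ_apply, Submodule.Quotient.mk_eq_zero] at ha
      obtain ⟨g, hg⟩ := (hB _).1 ha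
      exact h2 a ⟨g, fun t ht x hx y hy hxy => (hρ (Φ a) ht hx hy hxy).symm.trans (hg t ht x hx y hy hxy)⟩
    simpa using LinearMap.finrank_le_finrank_of_injective this
end LinAlg
end PaperAlg

namespace PaperAlg
open Geometry Set
section Topo

theorem convex_diff {C : Set (ℝ × ℝ)} (hC : Convex ℝ C) (hi : (interior C).Nonempty) (p : ℝ × ℝ) :
    IsPreconnected (C \ {p}) := by
  have key : ∀ x : ℝ × ℝ, affineSpan ℝ {x, p} ≠ ⊤ := by
    intro x h
    have h1 := (collinear_pair ℝ x p).finrank_le_one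
    rw [← direction_affineSpan, h, AffineSubspace.direction_top, finrank_top] at h1
    simp at h1
  have seg : ∀ x z, x ≠ p → z ∉ affineSpan ℝ {x, p} → p ∉ segment ℝ x z := by
    intro x z hx hz hp
    rw [segment_eq_image_lineMap] at hp
    obtain ⟨t, ht, rfl⟩ := hp
    have ht0 : t ≠ 0 := by rintro rfl; simp at hx
    apply hz
    have : z = AffineMap.lineMap x (AffineMap.lineMap x z t : ℝ × ℝ) t⁻¹ := by
      simp [AffineMap.lineMap_apply, ht0, smul_smul]
    have h2 := AffineMap.lineMap_mem_affineSpan_pair t⁻¹ x (AffineMap.lineMap x z t : ℝ × ℝ)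
    rwa [← this] at h2
  refine isPreconnected_of_forall_pair fun x hx y hy => ?_
  have : ∃ z ∈ interior C, z ∉ affineSpan ℝ {x, p} ∧ z ∉ affineSpan ℝ {y, p} := by
    by_contra! hc
    have h1 : interior C ⊆ (affineSpan ℝ {x, p} : Set (ℝ × ℝ)) ∪ (affineSpan ℝ {y, p} : Set (ℝ × ℝ)) := by
      intro z hz
      by_cases h : z ∈ affineSpan ℝ {x, p}
      · exact Or.inl h
      · exact Or.inr (hc z hz h)
    have h2 := MeasureTheory.measure_mono_null (μ := MeasureTheory.volume) h1
      (MeasureTheory.measure_union_null (MeasureTheory.Measure.addHaar_affineSubspace _ _ (key x))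
        (MeasureTheory.Measure.addHaar_affineSubspace _ _ (key y)))
    exact (isOpen_interior.measure_pos MeasureTheory.volume hi).ne' h2
  obtain ⟨z, hz, hzx, hzy⟩ := this
  have hzC := interior_subset hz
  refine ⟨segment ℝ x z ∪ segment ℝ y z, ?_, Or.inl (left_mem_segment _ _ _), Or.inr (left_mem_segment _ _ _),
    (convex_segment x z).isPreconnected.union z (right_mem_segment _ _ _) (right_mem_segment _ _ _)
      (convex_segment y z).isPreconnected⟩
  rintro q (hq | hq)
  · exact ⟨hC.segment_subset hx.1 hzC hq, fun h => seg x z hx.2 hzx (h ▸ hq)⟩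
  · exact ⟨hC.segment_subset hy.1 hzC hq, fun h => seg y z hy.2 hzy (h ▸ hq)⟩

variable {E : Type*} [NormedAddCommGroup E] [NormedSpace ℝ E]

def LC (M : Set E) : Prop := ∀ x ∈ M, ∀ U, IsOpen U → x ∈ U →
  ∃ W, IsOpen W ∧ x ∈ W ∧ M ∩ W ⊆ U ∧ IsPreconnected (M ∩ W) ∧ IsPreconnected ((M ∩ W) \ {x})

theorem LC_aux {M U' : Set E} {x : E} (hU' : U' ⊆ M) (hn : U' ∈ nhdsWithin x M) (hx : x ∈ M)
    {S V : Set (ℝ × ℝ)} (hS : Convex ℝ S) (hSi : (interior S).Nonempty) {W' : Set (ℝ × ℝ)} (hW' : IsOpen W')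
    (hV : V = S ∩ W') (h : U' ≃ₜ V) (U : Set E) (hU : IsOpen U) (hxU : x ∈ U) :
    ∃ W, IsOpen W ∧ x ∈ W ∧ M ∩ W ⊆ U ∧ IsPreconnected (M ∩ W) ∧ IsPreconnected ((M ∩ W) \ {x}) := by
  have hVs : ∀ q : V, (q : ℝ × ℝ) ∈ S ∩ W' := fun q => by have := q.2; simp only [hV] at this; exact this
  obtain ⟨W0, hW0, hxW0, hW0U⟩ := mem_nhdsWithin.1 hn
  have hxU' : x ∈ U' := hW0U ⟨hxW0, hx⟩
  let p : V := h ⟨x, hxU'⟩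
  have hN : {q : V | (h.symm q : E) ∈ U ∩ W0} ∈ nhds p := by
    apply IsOpen.mem_nhds
    · exact (hU.inter hW0).preimage (continuous_subtype_val.comp h.symm.continuous)
    · simp [p, hxU, hxW0]
  have hN2 : ∃ ε > 0, Metric.ball (p : ℝ × ℝ) ε ⊆ W' ∧ ∀ q : V, (q : ℝ × ℝ) ∈ Metric.ball (p : ℝ × ℝ) ε → (h.symm q : E) ∈ U ∩ W0 := by
    obtain ⟨ε1, h1, h2⟩ := Metric.mem_nhds_iff.1 hN
    obtain ⟨ε2, h3, h4⟩ := Metric.isOpen_iff.1 hW' p (hVs p).2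
    refine ⟨min ε1 ε2, lt_min h1 h3, (Metric.ball_subset_ball (min_le_right _ _)).trans h4, fun q hq => h2 ?_⟩
    exact Metric.ball_subset_ball (min_le_left _ _) hq
  obtain ⟨ε, hε, hB1, hB2⟩ := hN2
  set B := Metric.ball (p : ℝ × ℝ) ε
  have hSB : S ∩ B ⊆ V := by rw [hV]; exact inter_subset_inter_right _ hB1
  have hpS : (p : ℝ × ℝ) ∈ S := (hVs p).1
  have hC : Convex ℝ (S ∩ B) := hS.inter (convex_ball _ _)
  have hCi : (interior (S ∩ B)).Nonempty := by
    rw [interior_inter, Metric.isOpen_ball.interior_eq]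
    have : (p : ℝ × ℝ) ∈ closure (interior S) := by
      rw [hS.closure_interior_eq_closure_of_nonempty_interior hSi]; exact subset_closure hpS
    obtain ⟨z, hz1, hz2⟩ := mem_closure_iff.1 this B Metric.isOpen_ball (Metric.mem_ball_self hε)
    exact ⟨z, hz2, hz1⟩
  have hop : IsOpen {y : U' | (h y : ℝ × ℝ) ∈ B} :=
    Metric.isOpen_ball.preimage (continuous_subtype_val.comp h.continuous)
  obtain ⟨W1, hW1, hW1e⟩ := isOpen_induced_iff.1 hop
  have hmem : ∀ y (hy : y ∈ U'), y ∈ W1 ↔ (h ⟨y, hy⟩ : ℝ × ℝ) ∈ B := by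
    intro y hy
    have : (⟨y, hy⟩ : U') ∈ Subtype.val ⁻¹' W1 ↔ (⟨y, hy⟩ : U') ∈ {y : U' | (h y : ℝ × ℝ) ∈ B} := by rw [hW1e]
    exact this
  have hpre : ∀ D ⊆ S ∩ B, IsPreconnected D → IsPreconnected ((fun q : V => (h.symm q : E)) '' {q | (q : ℝ × ℝ) ∈ D}) := by
    intro D hD hDc
    apply IsPreconnected.image _ _ (continuous_subtype_val.comp h.symm.continuous).continuousOn
    have hem : Topology.IsInducing (Subtype.val : V → ℝ × ℝ) := Topology.IsInducing.subtypeVal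
    rw [← hem.isPreconnected_image]
    convert hDc
    ext z
    simp only [mem_image, mem_setOf_eq]
    exact ⟨by rintro ⟨q, hq, rfl⟩; exact hq, fun hz => ⟨⟨z, hSB (hD hz)⟩, hz, rfl⟩⟩
  have hMW : M ∩ (W0 ∩ W1) = (fun q : V => (h.symm q : E)) '' {q | (q : ℝ × ℝ) ∈ S ∩ B} := by
    ext y
    constructor
    · rintro ⟨hyM, hy0, hy1⟩
      have hyU : y ∈ U' := hW0U ⟨hy0, hyM⟩
      refine ⟨h ⟨y, hyU⟩, ⟨?_, (hmem y hyU).1 hy1⟩, by simp⟩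
      exact (hVs _).1
    · rintro ⟨q, ⟨hq1, hq2⟩, rfl⟩
      refine ⟨hU' (h.symm q).2, (hB2 q hq2).2, ?_⟩
      rw [hmem _ (h.symm q).2]; simpa using hq2
  refine ⟨W0 ∩ W1, hW0.inter hW1, ⟨hxW0, (hmem x hxU').2 (Metric.mem_ball_self hε)⟩, ?_, ?_, ?_⟩
  · rw [hMW]; rintro _ ⟨q, hq, rfl⟩; exact (hB2 q hq.2).1
  · rw [hMW]; exact hpre _ Subset.rfl hC.isPreconnected
  · have := hpre _ sdiff_subset (convex_diff hC hCi p)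
    convert this using 1
    rw [hMW]
    ext y
    constructor
    · rintro ⟨⟨q, hq, rfl⟩, hne⟩
      refine ⟨q, ⟨hq, fun h1 => hne ?_⟩, rfl⟩
      rw [mem_singleton_iff, ← Subtype.ext_iff] at h1
      simp [h1, p]
    · rintro ⟨q, hq, rfl⟩
      refine ⟨⟨q, hq.1, rfl⟩, fun h1 => hq.2 ?_⟩
      have : h.symm q = ⟨x, hxU'⟩ := Subtype.ext h1
      rw [mem_singleton_iff, ← Subtype.ext_iff]
      exact h.symm_apply_eq.1 this

theorem lc_of_planar {n : ℕ} (K : SimplicialComplex ℝ (Pt n)) (h : LocallyPlanar K) : LC K.space := by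
  intro x hx U hU hxU
  obtain ⟨-, ⟨U', h1, h2, V, hV, ⟨f⟩⟩ | ⟨U', h1, h2, V, hV, ⟨f⟩⟩⟩ := h x hx
  · exact LC_aux h1 h2 hx convex_univ (by simp) hV (univ_inter V).symm f U hU hxU
  · obtain ⟨W', hW', rfl⟩ := isOpen_induced_iff.1 hV
    refine LC_aux h1 h2 hx (S := HalfPlane) (V := Subtype.val '' (Subtype.val ⁻¹' W' : Set HalfPlane)) ?_ ?_ hW' ?_
      (f.trans (Topology.IsEmbedding.subtypeVal.homeomorphImage _)) U hU hxU
    · exact convex_halfSpace_ge (f := fun p : ℝ × ℝ => p.2) (LinearMap.snd ℝ ℝ ℝ).isLinear 0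
    · refine ⟨(0, 1), mem_interior.2 ⟨{p | 0 < p.2}, fun p hp => le_of_lt (show (0:ℝ) < p.2 from hp), isOpen_lt continuous_const continuous_snd, by simp⟩⟩
    · rw [Subtype.image_preimage_coe]

theorem minus_pt {M W : Set E} (hM : LC M) (hW : IsOpen W) (hc : IsPreconnected (M ∩ W)) (x : E) :
    IsPreconnected ((M ∩ W) \ {x}) := by
  by_cases hx : x ∈ M ∩ W
  swap
  · rwa [sdiff_singleton_eq_self hx]
  obtain ⟨N, hN, hxN, hNW, -, hN'⟩ := hM x hx.1 W hW hx.2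
  rw [isPreconnected_iff_subset_of_disjoint] at hN' hc ⊢
  have main : ∀ u v : Set E, IsOpen u → IsOpen v → (M ∩ W) \ {x} ⊆ u ∪ v → (M ∩ W) \ {x} ∩ (u ∩ v) = ∅ →
      (M ∩ N) \ {x} ⊆ u → (M ∩ W) \ {x} ⊆ u := by
    intro u v hu hv huv hd hNu
    have := hc (u ∪ N) (v \ {x}) (hu.union hN) (hv.sdiff isClosed_singleton) ?_ ?_
    rcases this with h | h
    · rintro y ⟨hy, hyx⟩
      rcases h hy with h | h
      · exact h
      · exact hNu ⟨⟨hy.1, h⟩, hyx⟩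
    · exact absurd rfl (h hx).2
    · intro y hy
      by_cases hyx : y = x
      · subst hyx; exact Or.inl (Or.inr hxN)
      · rcases huv ⟨hy, hyx⟩ with h | h
        · exact Or.inl (Or.inl h)
        · exact Or.inr ⟨h, hyx⟩
    · rw [eq_empty_iff_forall_notMem]
      rintro y ⟨hy, hy1, hy2, hyx⟩
      rcases hy1 with hy1 | hy1
      · exact (eq_empty_iff_forall_notMem.1 hd y) ⟨⟨hy, hyx⟩, hy1, hy2⟩
      · exact (eq_empty_iff_forall_notMem.1 hd y) ⟨⟨hy, hyx⟩, hNu ⟨⟨hy.1, hy1⟩, hyx⟩, hy2⟩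
  intro u v hu hv huv hd
  have hsub : (M ∩ N) \ {x} ⊆ (M ∩ W) \ {x} := sdiff_subset_sdiff_left fun y hy => ⟨hy.1, hNW hy⟩
  rcases hN' u v hu hv (hsub.trans huv) (subset_empty_iff.1 (hd ▸ inter_subset_inter_left _ hsub)) with h | h
  · exact Or.inl (main u v hu hv huv hd h)
  · exact Or.inr (main v u hv hu (union_comm u v ▸ huv) (inter_comm u v ▸ hd) h)

theorem minus_fin {M W : Set E} (hM : LC M) (hW : IsOpen W) (hc : IsPreconnected (M ∩ W)) {V : Set E} (hV : V.Finite) :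
    IsPreconnected ((M ∩ W) \ V) := by
  induction V, hV using Set.Finite.induction_on with
  | empty => simpa using hc
  | @insert a s _ hs ih =>
    have h1 : (M ∩ W) \ insert a s = (M ∩ (W \ s)) \ {a} := by ext; simp; tauto
    rw [h1]
    refine minus_pt hM (hW.sdiff hs.isClosed) ?_ a
    rwa [← inter_sdiff_assoc]

end Topo
end PaperAlg

namespace PaperAlg
open Geometry Set
section TriS
variable {E : Type*} [NormedAddCommGroup E] [NormedSpace ℝ E] [DecidableEq E]

def Wt (t : Finset E) (w : E → ℝ) (x : E) : Prop :=
  (∀ y, 0 ≤ w y) ∧ (∀ y ∉ t, w y = 0) ∧ ∑ y ∈ t, w y = 1 ∧ ∑ y ∈ t, w y • y = x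

theorem mem_hull {t : Finset E} {x : E} : x ∈ convexHull ℝ (t : Set E) ↔ ∃ w, Wt t w x := by
  rw [Finset.mem_convexHull']
  constructor
  · rintro ⟨w, h1, h2, h3⟩
    refine ⟨fun y => if y ∈ t then w y else 0, fun y => ?_, fun y hy => by simp [hy], ?_, ?_⟩
    · dsimp only; split_ifs with h
      exacts [h1 y h, le_rfl]
    · rw [← h2]; exact Finset.sum_congr rfl fun y hy => by simp [hy]
    · rw [← h3]; exact Finset.sum_congr rfl fun y hy => by simp [hy]
  · rintro ⟨w, h1, _, h2, h3⟩
    exact ⟨w, fun y _ => h1 y, h2, h3⟩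

structure Tri (M : Set E) (T : Finset (Finset E)) : Prop where
  c3 : ∀ t ∈ T, t.card = 3
  uw : ∀ s ∈ T, ∀ t ∈ T, ∀ x w w', Wt s w x → Wt t w' x → w = w'
  cov : ∀ x, x ∈ M ↔ ∃ t ∈ T, x ∈ convexHull ℝ (t : Set E)
  two : ∀ e : Finset E, e.card = 2 → (T.filter (e ⊆ ·)).card = 0 ∨ (T.filter (e ⊆ ·)).card = 2

theorem hull_closed (t : Finset E) : IsClosed (convexHull ℝ (t : Set E)) :=
  t.finite_toSet.isClosed_convexHull _

theorem Wt_single {t : Finset E} {x : E} (hx : x ∈ t) : Wt t (Pi.single x 1) x := by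
  refine ⟨fun y => ?_, fun y hy => ?_, ?_, ?_⟩
  · by_cases h : y = x
    · subst h; simp
    · simp [h]
  · exact Pi.single_eq_of_ne (by rintro rfl; exact hy hx) _
  · simp [Finset.sum_pi_single', hx]
  · rw [Finset.sum_eq_single x]
    · simp
    · intro b _ hb; simp [hb]
    · intro h; exact absurd hx h

variable {M : Set E} {T : Finset (Finset E)}

theorem Tri.wt_inter (H : Tri M T) {s t : Finset E} (hs : s ∈ T) (ht : t ∈ T) {x : E} {w}
    (h1 : Wt s w x) (h2 : x ∈ convexHull ℝ (t : Set E)) : Wt (s ∩ t) w x := by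
  obtain ⟨w', h2⟩ := mem_hull.1 h2
  obtain rfl := H.uw s hs t ht x w w' h1 h2
  have h0 : ∀ y ∉ s ∩ t, w y = 0 := fun y hy => by
    rw [Finset.mem_inter, not_and_or] at hy
    exact hy.elim (h1.2.1 y) (h2.2.1 y)
  refine ⟨h1.1, h0, ?_, ?_⟩
  · rw [← h1.2.2.1]; exact Finset.sum_subset Finset.inter_subset_left fun y _ hy => h0 y hy
  · rw [← h1.2.2.2]; exact Finset.sum_subset Finset.inter_subset_left fun y _ hy => by simp [h0 y hy]

theorem Tri.vert_mem (H : Tri M T) {t : Finset E} (ht : t ∈ T) {v : E} (hv : v ∈ vs T)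
    (h : v ∈ convexHull ℝ (t : Set E)) : v ∈ t := by
  obtain ⟨s, hs, hvs⟩ := Finset.mem_biUnion.1 hv
  by_contra hn
  have := (H.wt_inter hs ht (Wt_single hvs) h).2.1 v (by simp [hn])
  simp at this

theorem Tri.inter_two (H : Tri M T) {s t : Finset E} (hs : s ∈ T) (ht : t ∈ T) (hne : s ≠ t) {x : E} (hx : x ∉ vs T)
    (h1 : x ∈ convexHull ℝ (s : Set E)) (h2 : x ∈ convexHull ℝ (t : Set E)) : (s ∩ t).card = 2 := by
  obtain ⟨w, h1⟩ := mem_hull.1 h1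
  have h := H.wt_inter hs ht h1 h2
  have hlt : (s ∩ t).card < 3 := by
    rw [← H.c3 s hs]
    refine Finset.card_lt_card (Finset.ssubset_iff_subset_ne.2 ⟨Finset.inter_subset_left, fun h => hne ?_⟩)
    exact Finset.eq_of_subset_of_card_le (Finset.inter_eq_left.1 h) (by rw [H.c3 s hs, H.c3 t ht])
  have h0 : (s ∩ t).card ≠ 0 := by
    intro h0; rw [Finset.card_eq_zero] at h0
    have := h.2.2.1; rw [h0] at this; simp at this
  have h1 : (s ∩ t).card ≠ 1 := by
    intro h0; obtain ⟨v, hv⟩ := Finset.card_eq_one.1 h0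
    have e1 := h.2.2.1
    have e2 := h.2.2.2
    rw [hv, Finset.sum_singleton] at e1 e2
    rw [e1, one_smul] at e2
    have : v ∈ s ∩ t := by rw [hv]; simp
    exact hx (e2 ▸ Finset.mem_biUnion.2 ⟨s, hs, (Finset.mem_inter.1 this).1⟩)
  omega

theorem off_fin {t : Finset E} (ht : t.card = 3) {W : Set E} (hW : IsOpen W) {x : E} (hx : x ∈ convexHull ℝ (t : Set E))
    (hxW : x ∈ W) (V : Finset E) : ∃ y ∈ convexHull ℝ (t : Set E), y ∈ W ∧ y ∉ V := by
  obtain ⟨y, hy, hyx⟩ : ∃ y ∈ t, y ≠ x := by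
    by_contra! hc
    have : t ⊆ {x} := fun y hy => by simp [hc y hy]
    have := Finset.card_le_card this
    simp at this; omega
  let f : ℝ → E := AffineMap.lineMap x y
  have hf : Continuous f := AffineMap.lineMap_continuous
  have hinj : Function.Injective f := AffineMap.lineMap_injective ℝ hyx.symm
  have h0 : f ⁻¹' W ∈ nhds (0 : ℝ) := (hW.preimage hf).mem_nhds (by simpa [f] using hxW)
  obtain ⟨ε, hε, hb⟩ := Metric.mem_nhds_iff.1 h0
  have hinf : (f '' Ioo 0 (min ε 1)).Infinite := (Ioo_infinite (lt_min hε one_pos)).image hinj.injOn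
  obtain ⟨_, ⟨s, hs, rfl⟩, hsV⟩ := hinf.exists_notMem_finset V
  refine ⟨f s, ?_, hb ?_, hsV⟩
  · exact (convex_convexHull ℝ _).lineMap_mem hx (subset_convexHull ℝ _ hy) ⟨hs.1.le, hs.2.le.trans (min_le_right _ _)⟩
  · rw [Metric.mem_ball, dist_zero_right, Real.norm_of_nonneg hs.1.le]
    exact hs.2.trans_le (min_le_left _ _)

theorem Tri.dualO (H : Tri M T) (hM : LC M) {W : Set E} (hW : IsOpen W) (hc : IsPreconnected (M ∩ W))
    (R : Finset (Finset E)) (hR : R ⊆ T) (h1 : ∃ t ∈ R, (convexHull ℝ (t : Set E) ∩ W).Nonempty)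
    (h2 : ∃ t ∈ T \ R, (convexHull ℝ (t : Set E) ∩ W).Nonempty) :
    ∃ t ∈ R, ∃ t' ∈ T \ R, ∃ x ∈ W, x ∈ convexHull ℝ (t : Set E) ∧ x ∈ convexHull ℝ (t' : Set E) ∧ (t ∩ t').card = 2 := by
  have hcl : ∀ Q : Finset (Finset E), IsClosed (⋃ t ∈ Q, convexHull ℝ (t : Set E)) := fun Q =>
    Q.finite_toSet.isClosed_biUnion fun t _ => hull_closed t
  have hne : ∀ Q ⊆ T, (∃ t ∈ Q, (convexHull ℝ (t : Set E) ∩ W).Nonempty) →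
      ((M ∩ W) \ (vs T : Set E) ∩ ⋃ t ∈ Q, convexHull ℝ (t : Set E)).Nonempty := by
    rintro Q hQ ⟨t, ht, x, hx, hxW⟩
    obtain ⟨y, hy1, hy2, hy3⟩ := off_fin (H.c3 t (hQ ht)) hW hx hxW (vs T)
    exact ⟨y, ⟨⟨(H.cov y).2 ⟨t, hQ ht, hy1⟩, hy2⟩, hy3⟩, mem_biUnion (Finset.mem_coe.2 ht) hy1⟩
  have := isPreconnected_closed_iff.1 (minus_fin hM hW hc (vs T).finite_toSet) _ _ (hcl R) (hcl (T \ R)) ?_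
    (hne R hR h1) (hne _ Finset.sdiff_subset h2)
  · obtain ⟨x, ⟨⟨hxM, hxW⟩, hxV⟩, hx1, hx2⟩ := this
    simp only [mem_iUnion] at hx1 hx2
    obtain ⟨t, ht, hxt⟩ := hx1
    obtain ⟨t', ht', hxt'⟩ := hx2
    refine ⟨t, ht, t', ht', x, hxW, hxt, hxt', ?_⟩
    rw [Finset.mem_sdiff] at ht'
    exact H.inter_two (hR ht) ht'.1 (fun h => ht'.2 (h ▸ ht)) hxV hxt hxt'
  · rintro x ⟨⟨hxM, -⟩, -⟩
    obtain ⟨t, ht, hx⟩ := (H.cov x).1 hxM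
    by_cases h : t ∈ R
    · exact Or.inl (mem_biUnion (Finset.mem_coe.2 h) hx)
    · exact Or.inr (mem_biUnion (Finset.mem_coe.2 (Finset.mem_sdiff.2 ⟨ht, h⟩)) hx)

theorem Tri.ne (H : Tri M T) {t : Finset E} (ht : t ∈ T) : t.Nonempty :=
  Finset.card_pos.1 (by rw [H.c3 t ht]; norm_num)

theorem Tri.dual (H : Tri M T) (hM : LC M) (hc : IsPreconnected M) :
    ∀ R ⊆ T, R.Nonempty → R ≠ T → ∃ t ∈ R, ∃ t' ∈ T \ R, ∃ e ⊆ t, e ⊆ t' ∧ e.card = 2 := by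
  rintro R hR ⟨t0, h0⟩ hne
  obtain ⟨t1, h1⟩ : (T \ R).Nonempty := by
    rw [Finset.nonempty_iff_ne_empty, Ne, Finset.sdiff_eq_empty_iff_subset]
    exact fun h => hne (Finset.Subset.antisymm hR h)
  have hin : ∀ t ∈ T, (convexHull ℝ (t : Set E) ∩ univ).Nonempty := fun t ht => by
    obtain ⟨x, hx⟩ := H.ne ht
    exact ⟨x, subset_convexHull ℝ _ hx, trivial⟩
  obtain ⟨t, ht, t', ht', x, -, -, -, h⟩ := H.dualO hM isOpen_univ (by simpa using hc) R hR ⟨t0, h0, hin t0 (hR h0)⟩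
    ⟨t1, h1, hin t1 (Finset.sdiff_subset h1)⟩
  exact ⟨t, ht, t', ht', t ∩ t', Finset.inter_subset_left, Finset.inter_subset_right, h⟩

theorem Tri.link (H : Tri M T) (hM : LC M) (v : E) (h : Finset E → ZMod 2)
    (hh : ∀ t ∈ T, ∀ t' ∈ T, ∀ e ⊆ t, e ⊆ t' → e.card = 2 → v ∈ e → h t = h t') :
      ∀ t ∈ T, ∀ t' ∈ T, v ∈ t → v ∈ t' → h t = h t' := by
  intro t0 ht0 t1 ht1 hv0 hv1
  by_contra hne
  have hvM : v ∈ M := (H.cov v).2 ⟨t0, ht0, subset_convexHull ℝ _ hv0⟩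
  let U : Set E := (⋃ t ∈ T.filter (v ∉ ·), convexHull ℝ (t : Set E))ᶜ
  have hU : IsOpen U := ((T.filter (v ∉ ·)).finite_toSet.isClosed_biUnion fun t _ => hull_closed t).isOpen_compl
  have hvU : v ∈ U := by
    simp only [U, mem_compl_iff, mem_iUnion, not_exists]
    intro t ht h
    rw [Finset.mem_filter] at ht
    exact ht.2 (H.vert_mem ht.1 (Finset.mem_biUnion.2 ⟨t0, ht0, hv0⟩) h)
  obtain ⟨W, hW, hvW, hWU, hc, -⟩ := hM v hvM U hU hvU
  obtain ⟨t, ht, t', ht', x, hxW, hxt, hxt', hc2⟩ := H.dualO hM hW hc (T.filter fun t => h t = h t0) (Finset.filter_subset _ _)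
    ⟨t0, by simp [ht0], v, subset_convexHull ℝ _ hv0, hvW⟩
    ⟨t1, by simp [ht1]; exact fun h => hne h.symm, v, subset_convexHull ℝ _ hv1, hvW⟩
  simp only [Finset.mem_filter, Finset.mem_sdiff, not_and] at ht ht'
  have hmem : ∀ s ∈ T, x ∈ convexHull ℝ (s : Set E) → v ∈ s := by
    intro s hs hx
    by_contra hn
    exact hWU ⟨(H.cov x).2 ⟨s, hs, hx⟩, hxW⟩ (mem_biUnion (Finset.mem_coe.2 (Finset.mem_filter.2 ⟨hs, hn⟩)) hx)
  refine ht'.2 ht'.1 ?_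
  rw [← ht.2]
  exact (hh t ht.1 t' ht'.1 (t ∩ t') Finset.inter_subset_left Finset.inter_subset_right hc2
    (Finset.mem_inter.2 ⟨hmem t ht.1 hxt, hmem t' ht'.1 hxt'⟩)).symm
end TriS

end PaperAlg

namespace PaperAlg
open Geometry Set
section KK

theorem exists_lt (P : Type*) : ∃ lt : P → P → Bool, IsLt lt := by
  classical
  refine ⟨fun u v => decide (WellOrderingRel u v), fun u v huv => ?_⟩
  have h1 : WellOrderingRel u v → ¬ WellOrderingRel v u := fun h h' => asymm h h'
  have h2 : WellOrderingRel u v ∨ WellOrderingRel v u := by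
    rcases trichotomous_of WellOrderingRel u v with h | h | h
    exacts [Or.inl h, absurd h huv, Or.inr h]
  by_cases h : WellOrderingRel u v
  · simp [h, h1 h]
  · simp [h, h2.resolve_left h]

variable {n : ℕ} [DecidableEq (Pt n)]

theorem dif_dir {lt : Pt n → Pt n → Bool} (hlt : IsLt lt) {o : Pt n × Pt n × Pt n} (ho : (tri o).card = 3) {x y : Pt n}
    (hxy : x ≠ y) (h : (x, y) ∈ triDirs o) : dif (bdw lt o) {x, y} = dif [sd lt x y] {x, y} := by
  obtain ⟨a, b, c⟩ := o
  have hab : a ≠ b := by rintro rfl; simp [tri] at ho; have := Finset.card_le_two (a := a) (b := c); omega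
  have hac : a ≠ c := by
    rintro rfl; simp [tri] at ho
    have := Finset.card_le_two (a := b) (b := a); omega
  have hbc : b ≠ c := by rintro rfl; simp [tri] at ho; have := Finset.card_le_two (a := a) (b := b); omega
  have hz : ∀ u v : Pt n, ({u, v} : Finset (Pt n)) ≠ {x, y} → dif [sd lt u v] {x, y} = 0 := by
    intro u v huv
    simp [dif, sd, List.count_singleton, huv]
  have hp : ∀ u v w : Pt n, u ≠ w → v ≠ w → ({v, w} : Finset (Pt n)) ≠ {u, v} ∧ ({w, u} : Finset (Pt n)) ≠ {u, v} := by
    intro u v w h1 h2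
    constructor <;> intro h <;> have : w ∈ ({u, v} : Finset (Pt n)) := by rw [← h]; simp
    all_goals simp at this; tauto
  have e1 : dif (bdw lt (a, b, c)) {x, y} = dif [sd lt a b] {x, y} + dif [sd lt b c] {x, y} + dif [sd lt c a] {x, y} := by
    simp only [bdw]; rw [dif_cons, dif_cons (sd lt b c)]; ring
  rw [e1]
  simp only [triDirs, mem_insert_iff, mem_singleton_iff, Prod.mk.injEq] at h
  rcases h with ⟨rfl, rfl⟩ | ⟨rfl, rfl⟩ | ⟨rfl, rfl⟩
  · rw [hz _ _ (hp _ _ _ hac hbc).1, hz _ _ (hp _ _ _ hac hbc).2]; ring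
  · rw [hz _ _ (hp _ _ _ hab.symm hac.symm).1, hz _ _ (hp _ _ _ hab.symm hac.symm).2]; ring
  · rw [hz _ _ (hp _ _ _ hbc.symm hab).1, hz _ _ (hp _ _ _ hbc.symm hab).2]; ring

theorem orient_of_list {K : SimplicialComplex ℝ (Pt n)} {T : Finset (Finset (Pt n))}
    (hT : ∀ t, t ∈ T ↔ t ∈ K.faces ∧ t.card = 3)
    (two : ∀ e : Finset (Pt n), e.card = 2 → (T.filter (e ⊆ ·)).card = 0 ∨ (T.filter (e ⊆ ·)).card = 2)
    {lt : Pt n → Pt n → Bool} (hlt : IsLt lt) (l : List (Pt n × Pt n × Pt n)) (hnd : (l.map tri).Nodup)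
    (hl : ∀ t, t ∈ l.map tri ↔ t ∈ T) (hs : ∀ e, (l.map fun o => dif (bdw lt o) e).sum = 0) : Orientable K := by
  have hex : ∀ t : Finset (Pt n), ∃ o, t ∈ T → o ∈ l ∧ tri o = t := by
    intro t
    by_cases ht : t ∈ T
    · obtain ⟨o, h1, h2⟩ := List.mem_map.1 ((hl t).2 ht)
      exact ⟨o, fun _ => ⟨h1, h2⟩⟩
    · exact ⟨(0, 0, 0), fun h => absurd h ht⟩
  choose ori hori using hex
  have hinj : ∀ o ∈ l, ∀ o' ∈ l, tri o = tri o' → o = o' := fun o h o' h' => List.inj_on_of_nodup_map hnd h h'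
  refine ⟨ori, fun t ht hc => ?_, ?_⟩
  · have := (hori t ((hT t).2 ⟨ht, hc⟩)).2
    conv_lhs => rw [← this]
    simp [tri]
  · intro t1 h1 t2 h2 c1 c2 hne e he hce he1 he2 x y hx hy hxy hd
    have hT1 := (hT t1).2 ⟨h1, c1⟩
    have hT2 := (hT t2).2 ⟨h2, c2⟩
    obtain ⟨a1, b1⟩ := hori t1 hT1
    obtain ⟨a2, b2⟩ := hori t2 hT2
    have hexy : e = {x, y} := by
      symm; apply Finset.eq_of_subset_of_card_le
      · intro z hz; simp at hz; rcases hz with rfl | rfl <;> assumption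
      · rw [Finset.card_pair hxy, hce]
    subst hexy
    have hft : T.filter (({x, y} : Finset (Pt n)) ⊆ ·) = {t1, t2} := by
      symm
      apply Finset.eq_of_subset_of_card_le
      · intro z hz; simp only [Finset.mem_insert, Finset.mem_singleton] at hz; rcases hz with rfl | rfl <;> simp [Finset.mem_filter, *]
      · rw [Finset.card_pair hne]; have := two _ hce; omega
    have hsum := hs {x, y}
    rw [← List.sum_toFinset _ hnd.of_map] at hsum
    have hone : ori t1 ≠ ori t2 := fun h => hne (by rw [← b1, ← b2, h])
    rw [← Finset.sum_subset (s₁ := {ori t1, ori t2}), Finset.sum_pair hone] at hsum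
    · have hor : (x, y) ∈ triDirs (ori t2) ∨ (y, x) ∈ triDirs (ori t2) := by
        have hx2 := he2 hx
        have hy2 := he2 hy
        rw [← b2] at hx2 hy2
        simp only [tri, Finset.mem_insert, Finset.mem_singleton] at hx2 hy2
        simp only [triDirs, mem_insert_iff, mem_singleton_iff, Prod.mk.injEq]
        rcases hx2 with h | h | h <;> rcases hy2 with h' | h' | h' <;> first | exact absurd (h.trans h'.symm) hxy | tauto
      rcases hor with hor | hor
      · exfalso
        rw [dif_dir hlt (by rw [b1, c1]) hxy hd, dif_dir hlt (by rw [b2, c2]) hxy hor] at hsum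
        simp only [dif, sd, List.count_singleton] at hsum
        cases hb : lt x y <;> rw [hb] at hsum <;> simp at hsum
      · exact hor
    · intro o ho; simp at ho; rcases ho with rfl | rfl <;> simpa
    · intro o ho hno
      have ho : o ∈ l := by simpa using ho
      have hns : ¬ ({x, y} : Finset (Pt n)) ⊆ tri o := by
        intro hsub
        have hm : tri o ∈ T.filter (({x, y} : Finset (Pt n)) ⊆ ·) :=
          Finset.mem_filter.2 ⟨(hl _).1 (List.mem_map_of_mem ho), hsub⟩
        rw [hft] at hm
        simp only [Finset.mem_insert, Finset.mem_singleton, not_or] at hm hno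
        rcases hm with hm | hm
        · exact hno.1 (hinj _ ho _ a1 (hm.trans b1.symm))
        · exact hno.2 (hinj _ ho _ a2 (hm.trans b2.symm))
      have hcnt : ∀ d, (bdw lt o).count ({x, y}, d) = 0 := by
        intro d
        rw [List.count_eq_zero]
        intro hm
        apply hns
        simp only [bdw, sd, List.mem_cons, List.not_mem_nil, or_false, Prod.mk.injEq] at hm
        rcases hm with hm | hm | hm <;> rw [hm.1] <;> intro z hz <;> simp [tri] at hz ⊢ <;> tauto
      simp [dif, hcnt]

theorem K_main (K : SimplicialComplex ℝ (Pt n))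
    (hfin : K.faces.Finite) (hdim : TwoDimensional K)
    (hconn : IsConnected K.space)
    (hnobd : ∀ e ∈ K.faces, e.card = 2 → IsInteriorEdge K e)
    (hor : ¬ Orientable K) : ∃ T : Finset (Finset (Pt n)), (∀ t, t ∈ T ↔ t ∈ K.faces ∧ t.card = 3) ∧ T.Nonempty ∧ Tri K.space T ∧
      eulerChar K = (vs T).card - (ed T).card + T.card := by
  classical
  let T := hfin.toFinset.filter (·.card = 3)
  have hT : ∀ t, t ∈ T ↔ t ∈ K.faces ∧ t.card = 3 := fun t => by simp [T]
  have hne : T.Nonempty := by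
    by_contra h
    rw [Finset.not_nonempty_iff_eq_empty] at h
    have hno : ∀ t ∈ K.faces, t.card ≠ 3 := fun t h1 h2 => by
      have := (hT t).2 ⟨h1, h2⟩; rw [h] at this; simp at this
    exact hor ⟨fun _ => (0, 0, 0), fun t h1 h2 => absurd h2 (hno t h1), fun t h1 _ _ h2 => absurd h2 (hno t h1)⟩
  have hedge : ∀ e ∈ K.faces, e.card = 2 → (T.filter (e ⊆ ·)).card = 2 := by
    intro e he hc
    have := (hnobd e he hc).2.2
    rw [← this, ← Set.ncard_coe_finset]
    congr 1
    ext t; simp [trianglesContaining, hT, and_assoc]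
  have hcl : ∀ Q : Finset (Finset (Pt n)), IsClosed (⋃ t ∈ Q, convexHull ℝ (t : Set (Pt n))) := fun Q =>
    Q.finite_toSet.isClosed_biUnion fun t _ => hull_closed t
  have hcov : ∀ s ∈ K.faces, ∃ t ∈ T, s ⊆ t := by
    by_contra! hc
    obtain ⟨s0, hs0, hn0⟩ := hc
    obtain ⟨t0, ht0⟩ := hne
    let Q := hfin.toFinset.filter fun s => ∀ t ∈ T, ¬ s ⊆ t
    have hin : ∀ Q' : Finset (Finset (Pt n)), ∀ s ∈ K.faces, s ∈ Q' → (K.space ∩ ⋃ t ∈ Q', convexHull ℝ (t : Set (Pt n))).Nonempty := by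
      intro Q' s hs hQ
      obtain ⟨x, hx⟩ := K.nonempty_of_mem_faces hs
      have := subset_convexHull ℝ (s : Set (Pt n)) hx
      exact ⟨x, K.convexHull_subset_space hs this, mem_biUnion (Finset.mem_coe.2 hQ) this⟩
    have := isPreconnected_closed_iff.1 hconn.2 _ _ (hcl T) (hcl Q) ?_ (hin T t0 ((hT t0).1 ht0).1 ht0)
      (hin Q s0 hs0 (by simp [Q, hs0]; exact hn0))
    · obtain ⟨x, -, hx1, hx2⟩ := this
      simp only [mem_iUnion] at hx1 hx2
      obtain ⟨t, ht, hxt⟩ := hx1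
      obtain ⟨s, hs, hxs⟩ := hx2
      simp only [Q, Finset.mem_filter, Finite.mem_toFinset] at hs
      have hint : x ∈ convexHull ℝ ((s : Set (Pt n)) ∩ t) := by
        rw [← K.convexHull_inter_convexHull hs.1 ((hT t).1 ht).1]; exact ⟨hxs, hxt⟩
      have hcard := hdim s hs.1
      have h3 : s.card ≠ 3 := fun h => hs.2 s ((hT s).2 ⟨hs.1, h⟩) (Finset.Subset.refl _)
      have h2 : s.card ≠ 2 := fun h => by
        obtain ⟨t', ht'⟩ := Finset.card_pos.1 (show 0 < (T.filter (s ⊆ ·)).card by rw [hedge s hs.1 h]; norm_num)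
        exact hs.2 t' (Finset.mem_filter.1 ht').1 (Finset.mem_filter.1 ht').2
      have h0 := Finset.card_pos.2 (K.nonempty_of_mem_faces hs.1)
      obtain ⟨v, rfl⟩ := Finset.card_eq_one.1 (show s.card = 1 by omega)
      obtain ⟨y, hy⟩ := convexHull_nonempty_iff.1 ⟨x, hint⟩
      simp at hy
      exact hs.2 t ht (by simp; rw [← hy.1]; exact hy.2)
    · intro x hx
      obtain ⟨s, hs, hxs⟩ := K.mem_space_iff.1 hx
      by_cases h : ∃ t ∈ T, s ⊆ t
      · obtain ⟨t, ht, hst⟩ := h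
        exact Or.inl (mem_biUnion (Finset.mem_coe.2 ht) (convexHull_mono (by exact_mod_cast hst) hxs))
      · push Not at h
        exact Or.inr (mem_biUnion (Finset.mem_coe.2 (show s ∈ Q by simp [Q, hs]; exact h)) hxs)
  refine ⟨T, hT, hne, ⟨fun t ht => ((hT t).1 ht).2, ?_, ?_, ?_⟩, ?_⟩
  · have uni : ∀ s ∈ K.faces, ∀ r ⊆ s, ∀ x w w', Wt s w x → Wt r w' x → w = w' := by
      intro s hs r hr x w w' h1 h2
      have hw' : ∀ y ∉ s, w' y = 0 := fun y hy => h2.2.1 y fun h => hy (hr h)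
      have e1 : ∑ y ∈ s, w' y = 1 := by
        rw [← h2.2.2.1]; exact (Finset.sum_subset hr fun y _ hy => h2.2.1 y hy).symm
      have e2 : ∑ y ∈ s, w' y • y = x := by
        rw [← h2.2.2.2]; exact (Finset.sum_subset hr fun y _ hy => by simp [h2.2.1 y hy]).symm
      have hai := affineIndependent_iff.1 (K.indep hs) Finset.univ (fun y => w y - w' y)
        (by rw [Finset.sum_coe_sort s (fun y => w y - w' y), Finset.sum_sub_distrib, h1.2.2.1, e1, sub_self])
        (by rw [Finset.sum_coe_sort s (fun y => (w y - w' y) • y)]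
            simp only [sub_smul]
            rw [Finset.sum_sub_distrib, h1.2.2.2, e2, sub_self])
      ext y
      by_cases hy : y ∈ s
      · exact sub_eq_zero.1 (hai ⟨y, hy⟩ (Finset.mem_univ _))
      · rw [h1.2.1 y hy, hw' y hy]
    intro s hs t ht x w w' h1 h2
    have hs' := ((hT s).1 hs).1
    have ht' := ((hT t).1 ht).1
    have hint : x ∈ convexHull ℝ ((s ∩ t : Finset (Pt n)) : Set (Pt n)) := by
      rw [Finset.coe_inter, ← K.convexHull_inter_convexHull hs' ht']
      exact ⟨mem_hull.2 ⟨w, h1⟩, mem_hull.2 ⟨w', h2⟩⟩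
    obtain ⟨u, hu⟩ := mem_hull.1 hint
    rw [uni s hs' _ Finset.inter_subset_left x w u h1 hu, uni t ht' _ Finset.inter_subset_right x w' u h2 hu]
  · intro x
    rw [K.mem_space_iff]
    constructor
    · rintro ⟨s, hs, hx⟩
      obtain ⟨t, ht, hst⟩ := hcov s hs
      exact ⟨t, ht, convexHull_mono (by exact_mod_cast hst) hx⟩
    · rintro ⟨t, ht, hx⟩
      exact ⟨t, ((hT t).1 ht).1, hx⟩
  · intro e hc
    by_cases he : e ∈ K.faces
    · exact Or.inr (hedge e he hc)
    · left
      rw [Finset.card_eq_zero, Finset.filter_eq_empty_iff]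
      intro t ht hsub
      exact he (K.down_closed ((hT t).1 ht).1 hsub (Finset.card_pos.1 (by omega)))
  · rw [eulerChar]
    congr 2
    · rw [← Set.ncard_coe_finset]
      congr 2
      ext v
      rw [SimplicialComplex.mem_vertices, Finset.mem_coe]
      constructor
      · intro h
        obtain ⟨t, ht, hs⟩ := hcov _ h
        exact Finset.mem_biUnion.2 ⟨t, ht, by simpa using hs⟩
      · intro h
        obtain ⟨t, ht, hv⟩ := Finset.mem_biUnion.1 h
        exact K.down_closed ((hT t).1 ht).1 (by simpa using hv) (by simp)
    · rw [← Set.ncard_coe_finset]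
      congr 2
      ext e
      rw [mem_setOf_eq, Finset.mem_coe, mem_ed]
      constructor
      · rintro ⟨h, hc⟩
        obtain ⟨t, ht, hs⟩ := hcov _ h
        exact ⟨t, ht, hs, hc⟩
      · rintro ⟨t, ht, hs, hc⟩
        exact ⟨K.down_closed ((hT t).1 ht).1 hs (Finset.card_pos.1 (by omega)), hc⟩
    · rw [← Set.ncard_coe_finset]
      congr 1
      ext t
      simp [hT]
end KK
end PaperAlg

namespace PaperAlg
open Geometry Set
section Bis
variable {E : Type*} [NormedAddCommGroup E] [NormedSpace ℝ E] [DecidableEq E]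
variable {M : Set E} {T : Finset (Finset E)}

def IndT {P : Type*} [DecidableEq P] (T : Finset (Finset P)) (m : ℕ) : Prop :=
  ∃ Φ : (Fin m → ZMod 2) →ₗ[ZMod 2] (Finset P → ZMod 2), (∀ a, ∀ t ∈ T, IsCoc (Φ a) t) ∧ ∀ a, IsCob (Φ a) T → a = 0

theorem Wt3 {a b c : E} (hab : a ≠ b) (hac : a ≠ c) (hbc : b ≠ c) {w : E → ℝ} {x : E} :
    Wt {a, b, c} w x ↔ (∀ y, 0 ≤ w y) ∧ (∀ y, y ≠ a → y ≠ b → y ≠ c → w y = 0) ∧ w a + w b + w c = 1 ∧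
      w a • a + w b • b + w c • c = x := by
  unfold Wt
  rw [Finset.sum_insert (by simp [hab, hac]), Finset.sum_pair hbc, Finset.sum_insert (by simp [hab, hac]), Finset.sum_pair hbc]
  simp only [Finset.mem_insert, Finset.mem_singleton, not_or, and_imp, add_assoc]

def th (u v w : E) (l : E → ℝ) : E → ℝ := fun y =>
  if y = w then 2 * min (l u) (l v) else if y = u ∨ y = v then l y - min (l u) (l v) else l y

theorem th_old {u v w : E} {l : E → ℝ} (h0 : ∀ y, 0 ≤ l y) (hw : l w = 0) (h : l u = 0 ∨ l v = 0) : th u v w l = l := by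
  have hm : min (l u) (l v) = 0 := by
    rcases h with h | h <;> rw [h]
    exacts [min_eq_left (h0 v), min_eq_right (h0 u)]
  ext y; unfold th; rw [hm]
  split_ifs with h1
  · rw [h1, hw]; simp
  all_goals simp

theorem th_new {u v w a x : E} (huv : u ≠ v) (hua : u ≠ a) (hva : v ≠ a) (hwu : w ≠ u) (hwv : w ≠ v) (hwa : w ≠ a)
    (hw : w = (1 / 2 : ℝ) • u + (1 / 2 : ℝ) • v) {o : E → ℝ}
    (h : Wt {w, u, a} o x) : ∃ l, Wt {u, v, a} l x ∧ o = th u v w l := by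
  rw [Wt3 hwu hwa hua] at h
  obtain ⟨h0, h1, h2, h3⟩ := h
  have hov : o v = 0 := h1 v hwv.symm huv.symm hva
  let l : E → ℝ := fun y => if y = w then 0 else if y = u then o u + o w / 2 else if y = v then o w / 2 else o y
  have lu : l u = o u + o w / 2 := by simp [l, hwu.symm]
  have lv : l v = o w / 2 := by simp [l, hwv.symm, huv.symm]
  have la : l a = o a := by simp [l, hwa.symm, hua.symm, hva.symm]
  have lw : l w = 0 := by simp [l]
  have hm : min (l u) (l v) = o w / 2 := by rw [lu, lv]; exact min_eq_right (by linarith [h0 u])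
  refine ⟨l, ?_, ?_⟩
  · rw [Wt3 huv hua hva, lu, lv, la]
    refine ⟨fun y => ?_, fun y y1 y2 y3 => ?_, by linarith, ?_⟩
    · have := h0 u; have := h0 w; have := h0 y
      simp only [l]; split_ifs <;> linarith
    · simp only [l, y1, y2, if_false]; split_ifs with h
      · rfl
      · exact h1 y h y1 y3
    · rw [← h3]
      conv_rhs => rw [show o w • w = o w • ((1 / 2 : ℝ) • u + (1 / 2 : ℝ) • v) by rw [← hw]]
      module
  · ext y; unfold th; rw [hm]
    split_ifs with y1 y2
    · rw [y1]; ring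
    · rcases y2 with rfl | rfl
      · rw [lu]; ring
      · rw [lv, hov]; ring
    · rw [not_or] at y2; simp [l, y1, y2.1, y2.2]

theorem th_hull {u v w a x : E} (huv : u ≠ v) (hua : u ≠ a) (hva : v ≠ a) (hwu : w ≠ u) (hwv : w ≠ v) (hwa : w ≠ a)
    (hw : w = (1 / 2 : ℝ) • u + (1 / 2 : ℝ) • v) {l : E → ℝ}
    (h : Wt {u, v, a} l x) (hl : l v ≤ l u) : x ∈ convexHull ℝ (({w, u, a} : Finset E) : Set E) := by
  rw [Wt3 huv hua hva] at h
  obtain ⟨h0, h1, h2, h3⟩ := h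
  refine mem_hull.2 ⟨fun y => if y = w then 2 * l v else if y = u then l u - l v else if y = a then l a else 0, ?_⟩
  rw [Wt3 hwu hwa hua]
  simp only [if_true, if_neg hwu.symm, if_neg hwa.symm, if_neg hua.symm]
  refine ⟨fun y => ?_, fun y y1 y2 y3 => by simp [y1, y2, y3], by linarith, ?_⟩
  · have := h0 v; have := h0 a
    split_ifs <;> linarith
  · rw [← h3]
    conv_lhs => rw [hw]
    module

theorem Tri.edge (H : Tri M T) {u v : E} (huv : u ≠ v) {t : Finset E} (ht : t ∈ T) (hu : u ∈ t) (hv : v ∈ t) :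
    ∃ a b, a ≠ b ∧ u ≠ a ∧ v ≠ a ∧ u ≠ b ∧ v ≠ b ∧ {u, v, a} ∈ T ∧ {u, v, b} ∈ T ∧
      ∀ s ∈ T, u ∈ s → v ∈ s → s = {u, v, a} ∨ s = {u, v, b} := by
  have key : ∀ s ∈ T, u ∈ s → v ∈ s → ∃ a, u ≠ a ∧ v ≠ a ∧ s = {u, v, a} := by
    intro s hs h1 h2
    have h3 := H.c3 s hs
    obtain ⟨a, ha⟩ := Finset.card_eq_one.1 (show ((s.erase u).erase v).card = 1 by
      rw [Finset.card_erase_of_mem (by simp [huv.symm, h2]), Finset.card_erase_of_mem h1, h3])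
    have : a ∈ (s.erase u).erase v := by rw [ha]; simp
    simp at this
    refine ⟨a, Ne.symm this.2.1, Ne.symm this.1, ?_⟩
    rw [← ha, Finset.insert_erase (by simp [huv.symm, h2]), Finset.insert_erase h1]
  have hsub : ∀ s : Finset E, ({u, v} : Finset E) ⊆ s ↔ u ∈ s ∧ v ∈ s := fun s => by
    simp [Finset.insert_subset_iff]
  have h2 := (H.two {u, v} (Finset.card_pair huv)).resolve_left (by
    rw [Finset.card_eq_zero]
    intro h; have : t ∈ T.filter (({u, v} : Finset E) ⊆ ·) := Finset.mem_filter.2 ⟨ht, (hsub t).2 ⟨hu, hv⟩⟩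
    rw [h] at this; simp at this)
  obtain ⟨t1, t2, hne, h12⟩ := Finset.card_eq_two.1 h2
  have m1 : t1 ∈ T.filter (({u, v} : Finset E) ⊆ ·) := by rw [h12]; simp
  have m2 : t2 ∈ T.filter (({u, v} : Finset E) ⊆ ·) := by rw [h12]; simp
  simp only [Finset.mem_filter, hsub] at m1 m2
  obtain ⟨a, ha1, ha2, rfl⟩ := key t1 m1.1 m1.2.1 m1.2.2
  obtain ⟨b, hb1, hb2, rfl⟩ := key t2 m2.1 m2.2.1 m2.2.2
  refine ⟨a, b, fun h => hne (by rw [h]), ha1, ha2, hb1, hb2, m1.1, m2.1, fun s hs h1 h2 => ?_⟩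
  have : s ∈ T.filter (({u, v} : Finset E) ⊆ ·) := Finset.mem_filter.2 ⟨hs, (hsub s).2 ⟨h1, h2⟩⟩
  rw [h12] at this
  simpa using this

theorem ind_split {e : Finset E} (hc : e.card = 2) {u v w a : E} (huv : u ≠ v) (hua : u ≠ a) (hva : v ≠ a)
    (hwe : w ∉ e) (hne : e ≠ {u, v}) :
    (if e ⊆ {w, u, a} then 1 else 0) + (if e ⊆ {w, v, a} then 1 else 0) = if e ⊆ {u, v, a} then 1 else 0 := by
  obtain ⟨x, y, hxy, rfl⟩ := Finset.card_eq_two.1 hc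
  simp only [Finset.mem_insert, Finset.mem_singleton, not_or] at hwe
  have hx := Ne.symm hwe.1
  have hy := Ne.symm hwe.2
  have h1 : ¬ (x = u ∧ y = v) := by rintro ⟨rfl, rfl⟩; exact hne rfl
  have h2 : ¬ (x = v ∧ y = u) := by rintro ⟨rfl, rfl⟩; exact hne (Finset.pair_comm _ _)
  simp only [Finset.insert_subset_iff, Finset.singleton_subset_iff, Finset.mem_insert, Finset.mem_singleton, hx, hy, false_or]
  by_cases xu : x = u <;> by_cases xv : x = v <;> by_cases xa : x = a <;> by_cases yu : y = u <;> by_cases yv : y = v <;>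
    by_cases ya : y = a <;> simp_all

theorem Tri.bisect (H : Tri M T) {u v : E} (huv : u ≠ v) {t : Finset E} (ht : t ∈ T) (hu : u ∈ t) (hv : v ∈ t) :
    ∃ T' : Finset (Finset E), Tri M T' ∧ (∀ m, IndT T' m → IndT T m) ∧
      ∃ w a b, w = (1 / 2 : ℝ) • u + (1 / 2 : ℝ) • v ∧ {u, v, a} ∈ T ∧ {u, v, b} ∈ T ∧
      ∀ t, t ∈ T' ↔ (t ∈ T ∧ ¬ (u ∈ t ∧ v ∈ t)) ∨ t = {w, u, a} ∨ t = {w, v, a} ∨ t = {w, u, b} ∨ t = {w, v, b} := by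
  obtain ⟨a, b, hab, hua, hva, hub, hvb, ha, hb, hall⟩ := H.edge huv ht hu hv
  obtain ⟨w, hw⟩ : ∃ w : E, w = (1 / 2 : ℝ) • u + (1 / 2 : ℝ) • v := ⟨_, rfl⟩
  have hw' : w = (1 / 2 : ℝ) • v + (1 / 2 : ℝ) • u := by rw [hw, add_comm]
  have hww : Wt {u, v, a} (fun y => if y = u ∨ y = v then 1 / 2 else 0) w := by
    rw [Wt3 huv hua hva]
    refine ⟨fun y => ?_, fun y h1 h2 _ => by simp [h1, h2], by norm_num [hua.symm, hva.symm], ?_⟩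
    · split_ifs <;> norm_num
    · simp [hua.symm, hva.symm, hw]
  have hwV : ∀ s ∈ T, w ∉ s := by
    intro s hs hws
    have := congrFun (H.uw _ ha s hs w _ _ hww (Wt_single hws)) w
    simp only [Pi.single_eq_same] at this
    split_ifs at this <;> norm_num at this
  have hwu : w ≠ u := fun h => hwV _ ha (by simp [h])
  have hwv : w ≠ v := fun h => hwV _ ha (by simp [h])
  have hwa : w ≠ a := fun h => hwV _ ha (by simp [h])
  have hwb : w ≠ b := fun h => hwV _ hb (by simp [h])
  let N : Finset (Finset E) := {{w, u, a}, {w, v, a}, {w, u, b}, {w, v, b}}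
  let O : Finset (Finset E) := T.filter fun t => ¬ (u ∈ t ∧ v ∈ t)
  have hmem : ∀ t, t ∈ O ∪ N ↔ (t ∈ T ∧ ¬ (u ∈ t ∧ v ∈ t)) ∨ t = {w, u, a} ∨ t = {w, v, a} ∨ t = {w, u, b} ∨ t = {w, v, b} := by
    intro t; simp only [O, N, Finset.mem_union, Finset.mem_filter, Finset.mem_insert, Finset.mem_singleton]
  have hpc : ∀ x y z : E, ({x, y, z} : Finset E) = {y, x, z} := fun x y z => Finset.insert_comm _ _ _
  have lift : ∀ s ∈ O ∪ N, ∀ x o, Wt s o x → ∃ t ∈ T, ∃ l, Wt t l x ∧ o = th u v w l := by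
    intro s hs x o ho
    rcases (hmem s).1 hs with ⟨h1, h2⟩ | rfl | rfl | rfl | rfl
    · refine ⟨s, h1, o, ho, (th_old ho.1 (ho.2.1 _ (hwV _ h1)) ?_).symm⟩
      rw [not_and_or] at h2
      exact h2.imp (ho.2.1 _) (ho.2.1 _)
    · obtain ⟨l, h1, h2⟩ := th_new huv hua hva hwu hwv hwa hw ho
      exact ⟨_, ha, l, h1, h2⟩
    · obtain ⟨l, h1, h2⟩ := th_new huv.symm hva hua hwv hwu hwa hw' ho
      refine ⟨_, ha, l, hpc _ _ _ ▸ h1, ?_⟩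
      rw [h2]; ext y; simp only [th, min_comm (l u), or_comm]
    · obtain ⟨l, h1, h2⟩ := th_new huv hub hvb hwu hwv hwb hw ho
      exact ⟨_, hb, l, h1, h2⟩
    · obtain ⟨l, h1, h2⟩ := th_new huv.symm hvb hub hwv hwu hwb hw' ho
      refine ⟨_, hb, l, hpc _ _ _ ▸ h1, ?_⟩
      rw [h2]; ext y; simp only [th, min_comm (l u), or_comm]
  have hsplit : ∀ a x : E, u ≠ a → v ≠ a → w ≠ a → x ∈ convexHull ℝ (({u, v, a} : Finset E) : Set E) →
      x ∈ convexHull ℝ (({w, u, a} : Finset E) : Set E) ∨ x ∈ convexHull ℝ (({w, v, a} : Finset E) : Set E) := by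
    intro a x hua hva hwa hx
    obtain ⟨l, hl⟩ := mem_hull.1 hx
    rcases le_total (l v) (l u) with h | h
    · exact Or.inl (th_hull huv hua hva hwu hwv hwa hw hl h)
    · rw [hpc] at hl
      exact Or.inr (th_hull huv.symm hva hua hwv hwu hwa hw' hl h)
  have hNO : ∀ e : Finset E, (w ∈ e → e.card = 2 → ((O ∪ N).filter (e ⊆ ·)).card = 0 ∨ ((O ∪ N).filter (e ⊆ ·)).card = 2) := by
    intro e hwe hc
    obtain ⟨x, hx⟩ := Finset.card_eq_one.1 (show (e.erase w).card = 1 by rw [Finset.card_erase_of_mem hwe, hc])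
    have he : e = {w, x} := by rw [← hx, Finset.insert_erase hwe]
    have hxw : w ≠ x := by rintro rfl; simp [he] at hc
    have hfil : (O ∪ N).filter (e ⊆ ·) = N.filter (x ∈ ·) := by
      ext s
      rw [Finset.mem_filter, Finset.mem_filter, Finset.mem_union]
      constructor
      · rintro ⟨h1, h2⟩
        refine ⟨h1.resolve_left fun h => hwV s (Finset.mem_filter.1 h).1 (h2 hwe), h2 (by simp [he])⟩
      · rintro ⟨h1, h2⟩
        refine ⟨Or.inr h1, ?_⟩
        rw [he, Finset.insert_subset_iff, Finset.singleton_subset_iff]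
        refine ⟨?_, h2⟩
        simp only [N, Finset.mem_insert, Finset.mem_singleton] at h1
        rcases h1 with rfl | rfl | rfl | rfl <;> simp
    rw [hfil]
    have hpr : ∀ c d : E, c ≠ w → d ≠ w → c ≠ d → ∀ p : E, c ≠ p → ({w, p, c} : Finset E) ≠ {w, p, d} := by
      intro c d h1 h2 h3 p h4 h
      have : c ∈ ({w, p, d} : Finset E) := h ▸ (by simp)
      simp [h1, h3, h4] at this
    have n1 : ({w, u, a} : Finset E) ≠ {w, v, a} := fun h => by
      have : u ∈ ({w, v, a} : Finset E) := h ▸ (by simp)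
      simp [hwu.symm, huv, hua] at this
    have n2 : ({w, u, b} : Finset E) ≠ {w, v, b} := fun h => by
      have : u ∈ ({w, v, b} : Finset E) := h ▸ (by simp)
      simp [hwu.symm, huv, hub] at this
    have n3 := hpr a b hwa.symm hwb.symm hab u hua.symm
    have n4 := hpr a b hwa.symm hwb.symm hab v hva.symm
    simp only [N, Finset.filter_insert, Finset.filter_singleton, Finset.mem_insert, Finset.mem_singleton, hxw.symm, false_or]
    by_cases x1 : x = u
    · subst x1; simp [huv, hua, hub, Finset.card_pair n3]
    by_cases x2 : x = v
    · subst x2; simp [huv.symm, hva, hvb, Finset.card_pair n4]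
    by_cases x3 : x = a
    · subst x3; simp [x1, x2, hab, Finset.card_pair n1]
    by_cases x4 : x = b
    · subst x4; simp [x1, x2, hab.symm, Finset.card_pair n2]
    · simp [x1, x2, x3, x4]
  refine ⟨O ∪ N, ⟨?_, ?_, ?_, ?_⟩, ?_, w, a, b, hw, ha, hb, hmem⟩
  · intro s hs
    rcases (hmem s).1 hs with ⟨h1, h2⟩ | rfl | rfl | rfl | rfl
    · exact H.c3 s h1
    all_goals rw [Finset.card_eq_three]
    · exact ⟨_, _, _, hwu, hwa, hua, rfl⟩
    · exact ⟨_, _, _, hwv, hwa, hva, rfl⟩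
    · exact ⟨_, _, _, hwu, hwb, hub, rfl⟩
    · exact ⟨_, _, _, hwv, hwb, hvb, rfl⟩
  · intro s hs t ht x o o' h1 h2
    obtain ⟨s1, hs1, l1, k1, rfl⟩ := lift s hs x o h1
    obtain ⟨s2, hs2, l2, k2, rfl⟩ := lift t ht x o' h2
    rw [H.uw _ hs1 _ hs2 x _ _ k1 k2]
  · intro x
    rw [H.cov]
    constructor
    · rintro ⟨t, ht, hx⟩
      by_cases h : u ∈ t ∧ v ∈ t
      · rcases hall t ht h.1 h.2 with rfl | rfl
        · rcases hsplit a x hua hva hwa hx with h | h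
          exacts [⟨_, (hmem _).2 (by simp), h⟩, ⟨_, (hmem _).2 (by simp), h⟩]
        · rcases hsplit b x hub hvb hwb hx with h | h
          exacts [⟨_, (hmem _).2 (by simp), h⟩, ⟨_, (hmem _).2 (by simp), h⟩]
      · exact ⟨t, (hmem t).2 (Or.inl ⟨ht, h⟩), hx⟩
    · rintro ⟨t, ht, hx⟩
      obtain ⟨o, ho⟩ := mem_hull.1 hx
      obtain ⟨s, hs, l, hl, -⟩ := lift t ht x o ho
      exact ⟨s, hs, mem_hull.2 ⟨l, hl⟩⟩
  · intro e hc
    by_cases hwe : w ∈ e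
    · exact hNO e hwe hc
    by_cases huve : e = {u, v}
    · left
      rw [Finset.card_eq_zero, Finset.filter_eq_empty_iff]
      intro s hs hsub
      have h1 : u ∈ s := hsub (by simp [huve])
      have h2 : v ∈ s := hsub (by simp [huve])
      rcases (hmem s).1 hs with ⟨-, h⟩ | rfl | rfl | rfl | rfl
      · exact h ⟨h1, h2⟩
      · simp [hwv.symm, huv.symm, hva] at h2
      · simp [hwu.symm, huv, hua] at h1
      · simp [hwv.symm, huv.symm, hvb] at h2
      · simp [hwu.symm, huv, hub] at h1
    have hdis : Disjoint O N := by
      rw [Finset.disjoint_left]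
      intro s hs hs'
      apply hwV s (Finset.mem_filter.1 hs).1
      simp only [N, Finset.mem_insert, Finset.mem_singleton] at hs'
      rcases hs' with rfl | rfl | rfl | rfl <;> simp
    have hT : T = O ∪ {{u, v, a}, {u, v, b}} := by
      ext s
      simp only [O, Finset.mem_union, Finset.mem_filter, Finset.mem_insert, Finset.mem_singleton]
      constructor
      · intro hs
        by_cases h : u ∈ s ∧ v ∈ s
        · exact Or.inr (hall s hs h.1 h.2)
        · exact Or.inl ⟨hs, h⟩
      · rintro (h | rfl | rfl)
        exacts [h.1, ha, hb]
    have hdis2 : Disjoint O {{u, v, a}, {u, v, b}} := by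
      rw [Finset.disjoint_left]
      intro s hs hs'
      apply (Finset.mem_filter.1 hs).2
      simp only [Finset.mem_insert, Finset.mem_singleton] at hs'
      rcases hs' with rfl | rfl <;> simp
    have m1 : ∀ c d p q : E, c ∉ ({w, q, d} : Finset E) → ({w, p, c} : Finset E) ≠ {w, q, d} := by
      intro c d p q h h'
      exact h (h' ▸ by simp)
    have m2 : ∀ c p q : E, p ∉ ({w, q, c} : Finset E) → ∀ d, ({w, p, d} : Finset E) ≠ {w, q, c} := by
      intro c p q h d h'
      exact h (h' ▸ by simp)
    have hcard : ((O ∪ N).filter (e ⊆ ·)).card = (T.filter (e ⊆ ·)).card := by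
      rw [Finset.card_filter, Finset.card_filter, Finset.sum_union hdis, hT, Finset.sum_union hdis2]
      congr 1
      rw [Finset.sum_insert, Finset.sum_insert, Finset.sum_pair, Finset.sum_pair, ← add_assoc,
        ind_split hc huv hua hva hwe huve, ind_split hc huv hub hvb hwe huve]
      · intro h
        have : a ∈ ({u, v, b} : Finset E) := h ▸ (by simp)
        simp [hua.symm, hva.symm, hab] at this
      · exact m2 _ _ _ (by simp [hwu.symm, huv, hub]) _
      · simp only [Finset.mem_insert, Finset.mem_singleton, not_or]
        exact ⟨m1 _ _ _ _ (by simp [hwa.symm, hua.symm, hab]), m1 _ _ _ _ (by simp [hwa.symm, hva.symm, hab])⟩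
      · simp only [Finset.mem_insert, Finset.mem_singleton, not_or]
        exact ⟨m2 _ _ _ (by simp [hwu.symm, huv, hua]) _, m1 _ _ _ _ (by simp [hwa.symm, hua.symm, hab]), m1 _ _ _ _ (by simp [hwa.symm, hva.symm, hab])⟩
    rw [hcard]; exact H.two e hc
  · rintro m ⟨Φ, h1, h2⟩
    let Ψ : (Finset E → ZMod 2) →ₗ[ZMod 2] (Finset E → ZMod 2) :=
      { toFun := fun S e => if e = {u, v} then S {u, w} + S {w, v} else S e
        map_add' := fun S S' => by ext e; by_cases h : e = {u, v} <;> simp [h]; ring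
        map_smul' := fun c S => by ext e; by_cases h : e = {u, v} <;> simp [h]; ring }
    have hΨ1 : ∀ S, Ψ S {u, v} = S {u, w} + S {w, v} := fun S => by simp [Ψ]
    have hΨ2 : ∀ S e, e ≠ {u, v} → Ψ S e = S e := fun S e h => by simp [Ψ, h]
    have hcw : ∀ p q c : E, ({p, c} : Finset E) ≠ {u, v} ∨ c = u ∨ c = v := by
      intro p q c
      by_contra! h
      have : c ∈ ({u, v} : Finset E) := h.1 ▸ (by simp)
      simp [h.2.1, h.2.2] at this
    have hcoc : ∀ a, ∀ c, u ≠ c → v ≠ c → w ≠ c → IsCoc (Φ a) {w, u, c} → IsCoc (Φ a) {w, v, c} → IsCoc (Ψ (Φ a)) {u, v, c} := by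
      intro a c huc hvc hwc k1 k2
      have k1 := coc_rel hwu.symm huc hwc (by rwa [hpc] at k1)
      have k2 := coc_rel hwv hwc hvc k2
      rw [coc_iff (Finset.card_eq_three.2 ⟨_, _, _, huv, huc, hvc, rfl⟩), sum_pc huv huc hvc, hΨ1,
        hΨ2 _ _ ((hcw u u c).resolve_right (by tauto)), hΨ2 _ _ (by rw [Finset.pair_comm]; exact (hcw v u c).resolve_right (by tauto)), k1, k2]
      rw [Finset.pair_comm c w]
      linear_combination z2 (Φ a {u, c}) + z2 (Φ a {w, c}) + z2 (Φ a {c, v})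
    refine ⟨Ψ ∘ₗ Φ, fun d s hs => ?_, fun d hd => h2 d ?_⟩
    · by_cases h : u ∈ s ∧ v ∈ s
      · rcases hall s hs h.1 h.2 with rfl | rfl
        · exact hcoc d a hua hva hwa (h1 d _ ((hmem _).2 (by simp))) (h1 d _ ((hmem _).2 (by simp)))
        · exact hcoc d b hub hvb hwb (h1 d _ ((hmem _).2 (by simp))) (h1 d _ ((hmem _).2 (by simp)))
      · obtain ⟨g, hg⟩ := h1 d s ((hmem s).2 (Or.inl ⟨hs, h⟩))
        refine ⟨g, fun x hx y hy hxy => ?_⟩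
        rw [← hg x hx y hy hxy]
        refine hΨ2 _ _ fun he => h ?_
        have hs : ({u, v} : Finset E) ⊆ s := by
          rw [← he]; intro z hz; simp at hz; rcases hz with rfl | rfl <;> assumption
        exact ⟨hs (by simp), hs (by simp)⟩
    · obtain ⟨g, hg⟩ := hd
      simp only [LinearMap.comp_apply] at hg
      let g' : E → ZMod 2 := fun y => if y = w then g u + Φ d {u, w} else g y
      have gw : g' w = g u + Φ d {u, w} := by simp [g']
      have gn : ∀ y, w ≠ y → g' y = g y := fun y hy => by simp [g', hy.symm]
      have guv := hg _ ha u (by simp) v (by simp) huv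
      rw [hΨ1] at guv
      have e1 : Φ d {w, u} = g' w + g' u := by
        rw [gw, gn u hwu, Finset.pair_comm w u]; linear_combination -z2 (g u)
      have e2 : Φ d {w, v} = g' w + g' v := by
        rw [gw, gn v hwv]; linear_combination guv - z2 (Φ d {u, w})
      have old : ∀ s ∈ T, ∀ x ∈ s, ∀ y ∈ s, x ≠ y → ({x, y} : Finset E) ≠ {u, v} → Φ d {x, y} = g' x + g' y := by
        intro s hs x hx y hy hxy hne
        rw [gn x (fun h => hwV s hs (h ▸ hx)), gn y (fun h => hwV s hs (h ▸ hy)), ← hg s hs x hx y hy hxy, hΨ2 _ _ hne]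
      have tr : ∀ p c, (p = u ∨ p = v) → p ≠ c → u ≠ c → v ≠ c → w ≠ c → {u, v, c} ∈ T → {w, p, c} ∈ O ∪ N → ∀ x ∈ ({w, p, c} : Finset E),
          ∀ y ∈ ({w, p, c} : Finset E), x ≠ y → Φ d {x, y} = g' x + g' y := by
        intro p c hp hpc' huc hvc hwc hT hmm
        have ep : Φ d {w, p} = g' w + g' p := by rcases hp with rfl | rfl; exacts [e1, e2]
        have hwp : w ≠ p := by rcases hp with rfl | rfl; exacts [hwu, hwv]
        have epc : Φ d {p, c} = g' p + g' c := old _ hT p (by rcases hp with rfl | rfl <;> simp) c (by simp) hpc'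
          ((hcw p u c).resolve_right (by tauto))
        have ewc : Φ d {w, c} = g' w + g' c := by
          have := h1 d _ hmm
          have := coc_rel hwp hwc hpc' this
          rw [Finset.pair_comm c p, ep, epc] at this
          linear_combination -this - z2 (g' c)
        intro x hx y hy hxy
        simp only [Finset.mem_insert, Finset.mem_singleton] at hx hy
        rcases hx with rfl | rfl | rfl <;> rcases hy with rfl | rfl | rfl <;>
          first | exact absurd rfl hxy | assumption | (rw [Finset.pair_comm, add_comm]; assumption)
      refine ⟨g', fun s hs => ?_⟩
      rcases (hmem s).1 hs with ⟨k1, k2⟩ | rfl | rfl | rfl | rfl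
      · intro x hx y hy hxy
        refine old s k1 x hx y hy hxy fun he => k2 ?_
        have hs : ({u, v} : Finset E) ⊆ s := by
          rw [← he]; intro z hz; simp at hz; rcases hz with rfl | rfl <;> assumption
        exact ⟨hs (by simp), hs (by simp)⟩
      · exact tr u a (Or.inl rfl) hua hua hva hwa ha hs
      · exact tr v a (Or.inr rfl) hva hua hva hwa ha hs
      · exact tr u b (Or.inl rfl) hub hub hvb hwb hb hs
      · exact tr v b (Or.inr rfl) hvb hub hvb hwb hb hs

end Bis
end PaperAlg

namespace PaperAlg
open Geometry Set
section Mesh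
variable {E : Type*} [NormedAddCommGroup E] [InnerProductSpace ℝ E] [DecidableEq E]
variable {M : Set E}

theorem median {u v a w : E} (hw : w = (1 / 2 : ℝ) • u + (1 / 2 : ℝ) • v) {D : ℝ} (h1 : dist u a ≤ D)
    (h2 : dist v a ≤ D) (h3 : 9 / 10 * D < dist u v) : dist w a ≤ 9 / 10 * D := by
  have hp := parallelogram_law_with_norm ℝ (u - a) (v - a)
  have e1 : u - a + (v - a) = (2 : ℝ) • (w - a) := by rw [hw]; module
  have e2 : u - a - (v - a) = u - v := by abel
  rw [e1, e2, norm_smul, ← dist_eq_norm, ← dist_eq_norm, ← dist_eq_norm, ← dist_eq_norm] at hp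
  norm_num at hp
  have := dist_nonneg (x := u) (y := a)
  have := dist_nonneg (x := v) (y := a)
  have := dist_nonneg (x := u) (y := v)
  have hD : 0 ≤ D := by linarith
  apply le_of_sq_le_sq _ (by linarith) |> fun h => h
  nlinarith

def Msh (T : Finset (Finset E)) (D : ℝ) : Prop := ∀ t ∈ T, ∀ x ∈ t, ∀ y ∈ t, dist x y ≤ D

theorem mesh_step {D : ℝ} (hD : 0 < D) : ∀ (k : ℕ) (T : Finset (Finset E)), Tri M T → Msh T D →
    ((ed T).filter fun e => ∃ x ∈ e, ∃ y ∈ e, 9 / 10 * D < dist x y).card ≤ k →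
    ∃ T', Tri M T' ∧ Msh T' (9 / 10 * D) ∧ ∀ m, IndT T' m → IndT T m := by
  have fin : ∀ T : Finset (Finset E), (¬ ∃ t ∈ T, ∃ x ∈ t, ∃ y ∈ t, 9 / 10 * D < dist x y) → Msh T (9 / 10 * D) := by
    intro T h t ht x hx y hy
    push Not at h
    exact h t ht x hx y hy
  have pr : ∀ T : Finset (Finset E), ∀ t ∈ T, ∀ x ∈ t, ∀ y ∈ t, 9 / 10 * D < dist x y →
      ({x, y} : Finset E) ∈ (ed T).filter fun e => ∃ x ∈ e, ∃ y ∈ e, 9 / 10 * D < dist x y := by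
    intro T t ht x hx y hy h
    have hxy : x ≠ y := by rintro rfl; simp at h; linarith
    rw [Finset.mem_filter, mem_ed]
    refine ⟨⟨t, ht, ?_, Finset.card_pair hxy⟩, x, by simp, y, by simp, h⟩
    intro z hz; simp at hz; rcases hz with rfl | rfl <;> assumption
  intro k
  induction k with
  | zero =>
    intro T H hm hc
    refine ⟨T, H, fin T ?_, fun m h => h⟩
    rintro ⟨t, ht, x, hx, y, hy, h⟩
    have := pr T t ht x hx y hy h
    rw [Finset.card_eq_zero.1 (Nat.le_zero.1 hc)] at this
    simp at this
  | succ k ih =>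
    intro T H hm hc
    by_cases hex : ∃ t ∈ T, ∃ x ∈ t, ∃ y ∈ t, 9 / 10 * D < dist x y
    swap
    · exact ⟨T, H, fin T hex, fun m h => h⟩
    obtain ⟨t, ht, u, hu, v, hv, huv⟩ := hex
    have hne : u ≠ v := by rintro rfl; simp at huv; linarith
    obtain ⟨T', H', hind, w, a, b, hw, ha, hb, hmem⟩ := H.bisect hne ht hu hv
    have hDuv := hm t ht u hu v hv
    have dwu : dist w u ≤ 9 / 10 * D := by
      have : w - u = (1 / 2 : ℝ) • (v - u) := by rw [hw]; module
      rw [dist_eq_norm, this, norm_smul, ← dist_eq_norm, dist_comm v u]; norm_num; linarith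
    have dwv : dist w v ≤ 9 / 10 * D := by
      have : w - v = (1 / 2 : ℝ) • (u - v) := by rw [hw]; module
      rw [dist_eq_norm, this, norm_smul, ← dist_eq_norm]; norm_num; linarith
    have dw : ∀ c, {u, v, c} ∈ T → dist w c ≤ 9 / 10 * D := fun c hc =>
      median hw (hm _ hc u (by simp) c (by simp)) (hm _ hc v (by simp) c (by simp)) huv
    have key : ∀ s ∈ T', ∀ x ∈ s, ∀ y ∈ s, dist x y ≤ 9 / 10 * D ∨ ∃ r ∈ T, x ∈ r ∧ y ∈ r ∧ ({x, y} : Finset E) ≠ {u, v} := by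
      have new : ∀ p c, (p = u ∨ p = v) → {u, v, c} ∈ T → ∀ x ∈ ({w, p, c} : Finset E), ∀ y ∈ ({w, p, c} : Finset E),
          dist x y ≤ 9 / 10 * D ∨ ∃ r ∈ T, x ∈ r ∧ y ∈ r ∧ ({x, y} : Finset E) ≠ {u, v} := by
        intro p c hp hT x hx y hy
        have hwp : dist w p ≤ 9 / 10 * D := by rcases hp with rfl | rfl; exacts [dwu, dwv]
        have hwc := dw c hT
        have hpT : p ∈ ({u, v, c} : Finset E) := by rcases hp with rfl | rfl <;> simp
        have hnc : c ≠ u ∧ c ≠ v := by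
          have h3 := H.c3 _ hT
          constructor
          · rintro rfl
            rw [show ({c, v, c} : Finset E) = {c, v} by ext; simp; tauto] at h3
            have := Finset.card_le_two (a := c) (b := v); omega
          · rintro rfl
            rw [show ({u, c, c} : Finset E) = {u, c} by ext; simp] at h3
            have := Finset.card_le_two (a := u) (b := c); omega
        have hpc : ({p, c} : Finset E) ≠ {u, v} := by
          intro h
          have : c ∈ ({u, v} : Finset E) := h ▸ (by simp)
          simp [hnc.1, hnc.2] at this
        have h0 : (0 : ℝ) ≤ 9 / 10 * D := by linarith
        simp only [Finset.mem_insert, Finset.mem_singleton] at hx hy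
        rcases hx with rfl | rfl | rfl <;> rcases hy with rfl | rfl | rfl
        · left; rwa [dist_self]
        · exact Or.inl hwp
        · exact Or.inl hwc
        · left; rwa [dist_comm]
        · left; rwa [dist_self]
        · exact Or.inr ⟨_, hT, hpT, by simp, hpc⟩
        · left; rwa [dist_comm]
        · exact Or.inr ⟨_, hT, by simp, hpT, by rwa [Finset.pair_comm]⟩
        · left; rwa [dist_self]
      intro s hs x hx y hy
      rcases (hmem s).1 hs with ⟨h1, h2⟩ | rfl | rfl | rfl | rfl
      · refine Or.inr ⟨s, h1, hx, hy, fun he => h2 ?_⟩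
        have hs : ({u, v} : Finset E) ⊆ s := by
          rw [← he]; intro z hz; simp at hz; rcases hz with rfl | rfl <;> assumption
        exact ⟨hs (by simp), hs (by simp)⟩
      · exact new u a (Or.inl rfl) ha x hx y hy
      · exact new v a (Or.inr rfl) ha x hx y hy
      · exact new u b (Or.inl rfl) hb x hx y hy
      · exact new v b (Or.inr rfl) hb x hx y hy
    suffices hs : Msh T' D ∧ ((ed T').filter fun e => ∃ x ∈ e, ∃ y ∈ e, 9 / 10 * D < dist x y).card ≤ k by
      obtain ⟨T'', H'', hm'', hind''⟩ := ih T' H' hs.1 hs.2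
      exact ⟨T'', H'', hm'', fun m h => hind m (hind'' m h)⟩
    constructor
    · intro s hs x hx y hy
      rcases key s hs x hx y hy with h | ⟨r, hr, h1, h2, -⟩
      · linarith
      · exact hm r hr x h1 y h2
    · refine Nat.le_of_lt_succ (lt_of_lt_of_le (Finset.card_lt_card ?_) hc)
      rw [Finset.ssubset_iff]
      refine ⟨{u, v}, ?_, ?_⟩
      · rw [Finset.mem_filter, mem_ed]
        rintro ⟨⟨s, hs, hsub, -⟩, -⟩
        have h1 : u ∈ s := hsub (by simp)
        have h2 : v ∈ s := hsub (by simp)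
        rcases key s hs u h1 v h2 with h | ⟨_, _, _, _, h⟩
        · linarith
        · exact h rfl
      · intro e he
        rw [Finset.mem_insert] at he
        rcases he with rfl | he
        · exact pr T t ht u hu v hv huv
        · rw [Finset.mem_filter, mem_ed] at he
          obtain ⟨⟨s, hs, hsub, hc2⟩, x, hx, y, hy, hxy⟩ := he
          rcases key s hs x (hsub hx) y (hsub hy) with h | ⟨r, hr, h1, h2, -⟩
          · linarith
          · have : e = {x, y} := by
              have hne' : x ≠ y := by rintro rfl; simp at hxy; linarith
              symm; apply Finset.eq_of_subset_of_card_le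
              · intro z hz; simp at hz; rcases hz with rfl | rfl <;> assumption
              · rw [Finset.card_pair hne', hc2]
            rw [this]; exact pr T r hr x h1 y h2 hxy

theorem fine {T : Finset (Finset E)} (H : Tri M T) {ε : ℝ} (hε : 0 < ε) :
    ∃ T', Tri M T' ∧ Msh T' ε ∧ ∀ m, IndT T' m → IndT T m := by
  obtain ⟨D, hD, hT⟩ : ∃ D : ℝ, 0 < D ∧ Msh T D := by
    refine ⟨1 + ∑ x ∈ vs T, ∑ y ∈ vs T, dist x y, by positivity, fun t ht x hx y hy => ?_⟩
    have h1 : x ∈ vs T := Finset.mem_biUnion.2 ⟨t, ht, hx⟩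
    have h2 : y ∈ vs T := Finset.mem_biUnion.2 ⟨t, ht, hy⟩
    have := Finset.single_le_sum (f := fun x => ∑ y ∈ vs T, dist x y) (fun _ _ => by positivity) h1
    have := Finset.single_le_sum (f := fun y => dist x y) (fun _ _ => by positivity) h2
    linarith
  have it : ∀ k : ℕ, ∃ T', Tri M T' ∧ Msh T' ((9 / 10) ^ k * D) ∧ ∀ m, IndT T' m → IndT T m := by
    intro k
    induction k with
    | zero => exact ⟨T, H, by simpa using hT, fun m h => h⟩
    | succ k ih =>
      obtain ⟨T1, H1, h1, i1⟩ := ih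
      obtain ⟨T2, H2, h2, i2⟩ := mesh_step (D := (9 / 10) ^ k * D) (by positivity) _ T1 H1 h1 le_rfl
      exact ⟨T2, H2, by rw [pow_succ]; convert h2 using 1; ring, fun m h => i1 m (i2 m h)⟩
  obtain ⟨k, hk⟩ := exists_pow_lt_of_lt_one (div_pos hε hD) (show (9 / 10 : ℝ) < 1 by norm_num)
  obtain ⟨T', H', h, i⟩ := it k
  refine ⟨T', H', fun t ht x hx y hy => (h t ht x hx y hy).trans ?_, i⟩
  rw [lt_div_iff₀ hD] at hk
  exact hk.le
end Mesh
end PaperAlg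

namespace PaperAlg
open Geometry Set
section Cx

theorem sq_near {a b : ℂ} (h : ‖a ^ 2 - b ^ 2‖ < 1 / 16) : ‖a - b‖ < 1 / 4 ∨ ‖a + b‖ < 1 / 4 := by
  by_contra! hc
  rw [sq_sub_sq, norm_mul] at h
  nlinarith [norm_nonneg (a + b), norm_nonneg (a - b)]

theorem exists_root : ∃ ρ : ℂ → ℂ, ∀ z, ρ z ^ 2 = z ∧ (‖z - 1‖ < 1 / 16 → ‖ρ z - 1‖ < 1 / 16) := by
  have : ∀ z : ℂ, ∃ w : ℂ, w ^ 2 = z ∧ (‖z - 1‖ < 1 / 16 → ‖w - 1‖ < 1 / 16) := by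
    intro z
    have key : ∀ w : ℂ, w ^ 2 = z → ‖w - 1‖ ≤ ‖w + 1‖ → ‖z - 1‖ < 1 / 16 → ‖w - 1‖ < 1 / 16 := by
      intro w hw h hz
      have e : ‖z - 1‖ = ‖w + 1‖ * ‖w - 1‖ := by rw [← norm_mul, ← hw]; congr 1; ring
      have h2 : ‖(2 : ℂ)‖ ≤ ‖w + 1‖ + ‖w - 1‖ := by
        have := norm_sub_le (w + 1) (w - 1)
        rwa [show w + 1 - (w - 1) = 2 by ring] at this
      rw [Complex.norm_ofNat] at h2
      nlinarith [norm_nonneg (w - 1)]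
    obtain ⟨w, hw⟩ := IsAlgClosed.exists_pow_nat_eq z (n := 2) (by norm_num)
    rcases le_total ‖w - 1‖ ‖w + 1‖ with h | h
    · exact ⟨w, hw, key w hw h⟩
    · refine ⟨-w, by rw [neg_sq, hw], key (-w) (by rw [neg_sq, hw]) ?_⟩
      rw [show -w - 1 = -(w + 1) by ring, show -w + 1 = -(w - 1) by ring, norm_neg, norm_neg]; exact h
  choose ρ h using this
  exact ⟨ρ, h⟩

open Classical in
noncomputable def kk (a b : ℂ) : ZMod 2 := if ‖a - b‖ < 1 / 4 then 0 else 1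

theorem kk_cases {a b : ℂ} (h : ‖a ^ 2 - b ^ 2‖ < 1 / 16) : kk a b = 0 ∧ ‖a - b‖ < 1 / 4 ∨ kk a b = 1 ∧ ‖a + b‖ < 1 / 4 := by
  by_cases h1 : ‖a - b‖ < 1 / 4
  · exact Or.inl ⟨if_pos h1, h1⟩
  · exact Or.inr ⟨if_neg h1, (sq_near h).resolve_left h1⟩

theorem kk_coc {a b c : ℂ} (hb : 1 / 2 ≤ ‖b ^ 2‖) (h1 : ‖a ^ 2 - b ^ 2‖ < 1 / 16)
    (h2 : ‖a ^ 2 - c ^ 2‖ < 1 / 16) (h3 : ‖c ^ 2 - b ^ 2‖ < 1 / 16) : kk a b + kk a c + kk c b = 0 := by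
  have bad : ∀ p q r : ℂ, ‖p‖ < 1 / 4 → ‖q‖ < 1 / 4 → ‖r‖ < 1 / 4 → b + b = p + q + r → False := by
    intro p q r hp hq hr h
    have := norm_add₃_le (a := p) (b := q) (c := r)
    rw [← h, ← two_mul, norm_mul, Complex.norm_ofNat] at this
    rw [norm_pow] at hb
    nlinarith [norm_nonneg b]
  rcases kk_cases h1 with ⟨e1, n1⟩ | ⟨e1, n1⟩ <;> rcases kk_cases h2 with ⟨e2, n2⟩ | ⟨e2, n2⟩ <;>
    rcases kk_cases h3 with ⟨e3, n3⟩ | ⟨e3, n3⟩ <;> rw [e1, e2, e3]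
  · rfl
  · exact (bad (c + b) (a - c) (-(a - b)) n3 n2 (by rwa [norm_neg]) (by ring)).elim
  · exact (bad (a + c) (-(a - b)) (-(c - b)) n2 (by rwa [norm_neg]) (by rwa [norm_neg]) (by ring)).elim
  · decide
  · exact (bad (a + b) (-(a - c)) (-(c - b)) n1 (by rwa [norm_neg]) (by rwa [norm_neg]) (by ring)).elim
  · decide
  · decide
  · exact (bad (a + b) (-(a + c)) (c + b) n1 (by rwa [norm_neg]) n3 (by ring)).elim

theorem no_sqrt (s : Circle → ℂ) (hs : Continuous s) (h : ∀ z : Circle, s z ^ 2 = z) : False := by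
  let g : ℝ → ℂ := fun θ => s (Circle.exp θ) * Complex.exp (-(θ / 2 : ℝ) * Complex.I)
  have hg : Continuous g := by
    have : Continuous fun θ : ℝ => s (Circle.exp θ) := hs.comp Circle.exp.continuous
    fun_prop
  have hg2 : ∀ θ, g θ ^ 2 = 1 := by
    intro θ
    simp only [g]
    rw [mul_pow, h, Circle.coe_exp, ← Complex.exp_nat_mul, ← Complex.exp_add]
    rw [show (θ : ℂ) * Complex.I + ((2 : ℕ) : ℂ) * (-(((θ / 2 : ℝ)) : ℂ) * Complex.I) = 0 by push_cast; ring, Complex.exp_zero]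
  have hpm : ∀ θ, g θ = 1 ∨ g θ = -1 := fun θ => sq_eq_sq_iff_eq_or_eq_neg.1 (by rw [hg2, one_pow])
  have hre : Continuous fun θ => (g θ).re := Complex.continuous_re.comp hg
  have h2 : g (2 * Real.pi) = - g 0 := by
    simp only [g]
    rw [Circle.exp_two_pi, Circle.exp_zero]
    rw [show (-((2 * Real.pi / 2 : ℝ) : ℂ) * Complex.I) = -(Real.pi * Complex.I) by push_cast; ring, Complex.exp_neg, Complex.exp_pi_mul_I]
    simp
  have hz : ∃ θ, (g θ).re = 0 := by
    have h0 := hpm 0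
    rcases h0 with h0 | h0
    · exact mem_range_of_exists_le_of_exists_ge hre ⟨2 * Real.pi, by rw [h2, h0]; simp⟩ ⟨0, by rw [h0]; simp⟩
    · exact mem_range_of_exists_le_of_exists_ge hre ⟨0, by rw [h0]; simp⟩ ⟨2 * Real.pi, by rw [h2, h0]; simp⟩
  obtain ⟨θ, hθ⟩ := hz
  rcases hpm θ with h | h <;> rw [h] at hθ <;> simp at hθ
end Cx

section Top
variable {E : Type*} [NormedAddCommGroup E]

theorem exists_O {M C Z : Set E} (hM : LC M) (hC : IsCompact C) (hZ : IsCompact Z) (hZM : Z ⊆ M \ C) (hc : IsConnected (M \ C)) :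
    ∃ O : Set E, IsOpen O ∧ Z ⊆ O ∧ IsPreconnected (M ∩ O) ∧ Disjoint (closure O) C := by
  obtain ⟨x0, hx0⟩ := hc.1
  let G : Set E → Prop := fun O => IsOpen O ∧ x0 ∈ O ∧ IsPreconnected (M ∩ O) ∧ Disjoint (closure O) C
  have loc : ∀ x ∈ M \ C, ∃ W, IsOpen W ∧ x ∈ W ∧ IsPreconnected (M ∩ W) ∧ Disjoint (closure W) C := by
    rintro x ⟨hx, hxC⟩
    obtain ⟨U, hU1, hU2⟩ : ∃ U : Set E, U ∈ nhds x ∧ Disjoint (closure U) C := by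
      have := hC.isClosed.isOpen_compl.mem_nhds hxC
      obtain ⟨U, hU, hUc, hs⟩ := exists_mem_nhds_isClosed_subset this
      exact ⟨U, hU, by rw [hUc.closure_eq]; exact disjoint_left.2 fun y hy => hs hy⟩
    obtain ⟨W, h1, h2, h3, h4, -⟩ := hM x hx (interior U) isOpen_interior (mem_interior_iff_mem_nhds.2 hU1)
    refine ⟨W ∩ interior U, h1.inter isOpen_interior, ⟨h2, mem_interior_iff_mem_nhds.2 hU1⟩, ?_, ?_⟩
    · rwa [← inter_assoc, inter_eq_left.2 h3]
    · exact hU2.mono_left (closure_mono (inter_subset_right.trans interior_subset))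
  have un : ∀ O W, G O → IsOpen W → IsPreconnected (M ∩ W) → Disjoint (closure W) C → (∃ z ∈ M, z ∈ O ∧ z ∈ W) → G (O ∪ W) := by
    rintro O W ⟨a1, a2, a3, a4⟩ b1 b3 b4 ⟨z, hz, hzO, hzW⟩
    refine ⟨a1.union b1, Or.inl a2, ?_, ?_⟩
    · rw [inter_union_distrib_left]
      exact IsPreconnected.union z ⟨hz, hzO⟩ ⟨hz, hzW⟩ a3 b3
    · rw [closure_union]; exact Disjoint.union_left a4 b4
  have all : ∀ y ∈ M \ C, ∃ O, G O ∧ y ∈ O := by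
    let A : Set E := ⋃₀ {O | G O}
    let B : Set E := ⋃₀ {W | IsOpen W ∧ IsPreconnected (M ∩ W) ∧ Disjoint (closure W) C ∧ ¬ (M ∩ W ∩ A).Nonempty}
    have hA : IsOpen A := isOpen_sUnion fun O h => h.1
    have hB : IsOpen B := isOpen_sUnion fun O h => h.1
    intro y hy
    by_contra hn
    have hyA : y ∉ A := fun ⟨O, h1, h2⟩ => hn ⟨O, h1, h2⟩
    have ext : ∀ z ∈ M \ C, z ∈ A ∨ z ∈ B := by
      intro z hz
      obtain ⟨W, h1, h2, h3, h4⟩ := loc z hz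
      by_cases h : (M ∩ W ∩ A).Nonempty
      · obtain ⟨q, ⟨hqM, hqW⟩, O, hO, hqO⟩ := h
        exact Or.inl ⟨O ∪ W, un O W hO h1 h3 h4 ⟨q, hqM, hqO, hqW⟩, Or.inr h2⟩
      · exact Or.inr ⟨W, ⟨h1, h3, h4, h⟩, h2⟩
    have hx0A : x0 ∈ A := by
      obtain ⟨W, h1, h2, h3, h4⟩ := loc x0 hx0
      exact ⟨W, ⟨h1, h2, h3, h4⟩, h2⟩
    obtain ⟨q, hq, hqA, W, ⟨-, -, -, hW⟩, hqW⟩ := hc.2 A B hA hB (fun z hz => ext z hz) ⟨x0, hx0, hx0A⟩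
      ⟨y, hy, (ext y hy).resolve_left hyA⟩
    exact hW ⟨q, ⟨hq.1, hqW⟩, hqA⟩
  obtain ⟨O0, hO0, -⟩ := all x0 hx0
  suffices ∃ O, G O ∧ Z ⊆ O by
    obtain ⟨O, h, hZ⟩ := this
    exact ⟨O, h.1, hZ, h.2.2⟩
  refine hZ.induction_on (p := fun Z => ∃ O, G O ∧ Z ⊆ O) ⟨O0, hO0, empty_subset _⟩ ?_ ?_ ?_
  · rintro s t hst ⟨O, h1, h2⟩; exact ⟨O, h1, hst.trans h2⟩
  · rintro s t ⟨O, h1, h2⟩ ⟨O', h1', h2'⟩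
    exact ⟨O ∪ O', un O O' h1 h1'.1 h1'.2.2.1 h1'.2.2.2 ⟨x0, hx0.1, h1.2.1, h1'.2.1⟩, union_subset_union h2 h2'⟩
  · intro x hx
    obtain ⟨O, h1, h2⟩ := all x (hZM hx)
    exact ⟨O, mem_nhdsWithin_of_mem_nhds (h1.1.mem_nhds h2), O, h1, Subset.rfl⟩

theorem exists_f {C D : Set E} (hC : IsCompact C) (hD : IsCompact D) (hCD : Disjoint C D) (φ : C ≃ₜ Circle) :
    ∃ f : E → ℂ, Continuous f ∧ (∀ x : C, f x = φ x) ∧ ∀ x ∈ D, f x = 1 := by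
  let f0 : C(C, ℂ) := ⟨fun x => φ x, by fun_prop⟩
  obtain ⟨g, hg⟩ := ContinuousMap.exists_restrict_eq hC.isClosed f0
  obtain ⟨h, h0, h1, -⟩ := exists_continuous_zero_one_of_isClosed hD.isClosed hC.isClosed hCD.symm
  refine ⟨fun x => h x * g x + (1 - h x), ?_, fun x => ?_, fun x hx => ?_⟩
  · have := h.continuous; have := g.continuous
    have h' : Continuous fun x => ((h x : ℝ) : ℂ) := Complex.continuous_ofReal.comp h.continuous
    fun_prop
  · have e1 : h x = 1 := h1 x.2
    have e2 : g x = φ x := DFunLike.congr_fun hg x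
    simp [e1, e2]
  · have e1 : h x = 0 := h0 hx
    simp [e1]
end Top
end PaperAlg

namespace PaperAlg
open Geometry Set
section Up
variable {E : Type*} [NormedAddCommGroup E] [InnerProductSpace ℝ E] [DecidableEq E]
variable {M : Set E}

theorem hull_dist {T : Finset (Finset E)} {ε : ℝ} (h : Msh T ε) {t : Finset E} (ht : t ∈ T) {x y : E}
    (hx : x ∈ convexHull ℝ (t : Set E)) (hy : y ∈ convexHull ℝ (t : Set E)) : dist x y ≤ ε := by
  obtain ⟨a, ha, b, hb, hab⟩ := convexHull_exists_dist_ge2 hx hy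
  exact hab.trans (h t ht a ha b hb)

theorem Tri.compact {T : Finset (Finset E)} (H : Tri M T) : IsCompact M := by
  have : M = ⋃ t ∈ T, convexHull ℝ (t : Set E) := by
    ext x; rw [H.cov]; simp
  rw [this]
  exact T.finite_toSet.isCompact_biUnion fun t _ => t.finite_toSet.isCompact_convexHull ℝ

theorem upper {T0 : Finset (Finset E)} (H0 : Tri M T0) (hM : LC M) {m : ℕ} (C : Fin m → Set E) (hC : ∀ i, C i ⊆ M)
    (hd : ∀ i j, i ≠ j → Disjoint (C i) (C j)) (φ : ∀ i, C i ≃ₜ Circle) (hconn : IsConnected (M \ ⋃ i, C i)) :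
    IndT T0 m := by
  classical
  have hMc := H0.compact
  have hCc : ∀ i, IsCompact (C i) := fun i => by
    have := (φ i).symm.compactSpace
    exact isCompact_iff_compactSpace.2 this
  have hCU : IsCompact (⋃ i, C i) := isCompact_iUnion hCc
  have hf : ∀ i, ∃ f : E → ℂ, Continuous f ∧ (∀ x : C i, f x = φ i x) ∧ ∀ j, j ≠ i → ∀ x ∈ C j, f x = 1 := by
    intro i
    obtain ⟨f, h1, h2, h3⟩ := exists_f (hCc i) (D := ⋃ j : {j // j ≠ i}, C j) (isCompact_iUnion fun j => hCc j)
      (disjoint_iUnion_right.2 fun j => hd i j j.2.symm) (φ i)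
    exact ⟨f, h1, h2, fun j hj x hx => h3 x (mem_iUnion.2 ⟨⟨j, hj⟩, hx⟩)⟩
  choose f fc f1 f2 using hf
  have fn : ∀ i, ∀ x ∈ ⋃ j, C j, ‖f i x‖ = 1 := by
    intro i x hx
    obtain ⟨j, hj⟩ := mem_iUnion.1 hx
    by_cases h : j = i
    · subst h; rw [f1 j ⟨x, hj⟩]; exact Circle.norm_coe _
    · rw [f2 i j h x hj]; simp
  let F : E → Fin m → ℂ := fun x i => f i x
  have hF : Continuous F := continuous_pi fc
  obtain ⟨δ1, hδ1, hF1⟩ := Metric.uniformContinuousOn_iff.1 (hMc.uniformContinuousOn_of_continuous hF.continuousOn) (1 / 16) (by norm_num)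
  have hF1 : ∀ i, ∀ x ∈ M, ∀ y ∈ M, dist x y < δ1 → ‖f i x - f i y‖ < 1 / 16 := by
    intro i x hx y hy h
    rw [← dist_eq_norm]
    exact (dist_le_pi_dist (F x) (F y) i).trans_lt (hF1 x hx y hy h)
  let Z : Set E := M ∩ ⋃ i, {x | ‖f i x‖ ≤ 1 / 2}
  have hZ : IsCompact Z := hMc.inter_right (isClosed_iUnion_of_finite fun i => isClosed_le (fc i).norm continuous_const)
  obtain ⟨O, hO, hZO, hOc, hOC⟩ := exists_O hM hCU hZ (fun x hx => ⟨hx.1, fun h => by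
    obtain ⟨i, hi⟩ := mem_iUnion.1 hx.2
    have := fn i x h
    simp only [mem_setOf_eq] at hi
    linarith⟩) hconn
  obtain ⟨δ0, hδ0, hthick⟩ := hOC.symm.exists_thickenings hCU isClosed_closure
  have hfar : ∀ p ∈ ⋃ i, C i, ∀ q ∈ O, δ0 ≤ dist p q := by
    intro p hp q hq
    by_contra! h
    exact disjoint_left.1 hthick (Metric.mem_thickening_iff.2 ⟨p, hp, by rwa [dist_comm]⟩)
      (Metric.self_subset_thickening hδ0 _ (subset_closure hq))
  obtain ⟨T, H, hmesh, hind⟩ := fine H0 (ε := min δ0 δ1 / 2) (by positivity)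
  refine hind m ?_
  clear hind
  have hε0 : min δ0 δ1 / 2 < δ0 := by have := min_le_left δ0 δ1; linarith
  have hε1 : min δ0 δ1 / 2 < δ1 := by have := min_le_right δ0 δ1; linarith
  obtain ⟨ρ, hρ⟩ := exists_root
  let r : Fin m → E → ℂ := fun i x => ρ (f i x)
  have hr : ∀ i x, r i x ^ 2 = f i x := fun i x => (hρ _).1
  have hTM : ∀ t ∈ T, convexHull ℝ (t : Set E) ⊆ M := fun t ht x hx => (H.cov x).2 ⟨t, ht, hx⟩
  have hclose : ∀ i, ∀ t ∈ T, ∀ x ∈ convexHull ℝ (t : Set E), ∀ y ∈ convexHull ℝ (t : Set E), ‖f i x - f i y‖ < 1 / 16 :=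
    fun i t ht x hx y hy => hF1 i x (hTM t ht hx) y (hTM t ht hy) ((hull_dist hmesh ht hx hy).trans_lt hε1)
  have hv : ∀ t : Finset E, ∀ x ∈ t, x ∈ convexHull ℝ (t : Set E) := fun t x hx => subset_convexHull ℝ _ hx
  let c : Fin m → Finset E → ZMod 2 := fun i e => if ∀ x ∈ e, ∀ y ∈ e, ‖r i x - r i y‖ < 1 / 4 then 0 else 1
  have hc : ∀ i x y, c i {x, y} = kk (r i x) (r i y) := by
    intro i x y
    simp only [c, kk]
    congr 1
    simp only [Finset.mem_insert, Finset.mem_singleton, forall_eq_or_imp, forall_eq, sub_self, norm_zero, norm_sub_rev (r i y)]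
    simp
  let Q : Finset (Finset E) := T.filter fun t : Finset E => (convexHull ℝ (t : Set E) ∩ O).Nonempty
  have hcoc : ∀ i, ∀ t ∈ T, t ∉ Q → IsCoc (c i) t := by
    intro i t ht hQ
    have hnO : ∀ x ∈ t, x ∉ O := fun x hx hxO => hQ (Finset.mem_filter.2 ⟨ht, x, hv t x hx, hxO⟩)
    have h3 := H.c3 t ht
    rw [coc_iff h3]
    obtain ⟨u, v, w, huv, huw, hvw, rfl⟩ := Finset.card_eq_three.1 h3
    rw [sum_pc huv huw hvw, hc, hc, hc]
    have hu := hv {u, v, w} u (by simp)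
    have hv' := hv {u, v, w} v (by simp)
    have hw := hv {u, v, w} w (by simp)
    refine kk_coc ?_ ?_ ?_ ?_ <;> simp only [hr]
    · by_contra! h
      exact hnO v (by simp) (hZO ⟨hTM _ ht hv', mem_iUnion.2 ⟨i, h.le⟩⟩)
    · exact hclose i _ ht _ hu _ hv'
    · exact hclose i _ ht _ hu _ hw
    · exact hclose i _ ht _ hw _ hv'
  let D : Submodule (ZMod 2) (Finset E → ZMod 2) :=
    { carrier := {d | ∀ t ∈ T, t ∉ Q → ∀ e ⊆ t, d e = 0}
      add_mem' := fun h h' t ht hQ e he => by simp [h t ht hQ e he, h' t ht hQ e he]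
      zero_mem' := fun t ht hQ e he => rfl
      smul_mem' := fun a d h t ht hQ e he => by simp [h t ht hQ e he] }
  have hD : ∀ i, ∃ d ∈ D, del T d = del T (c i) := by
    intro i
    have := LA Q (D.map (del T)) ?_ (del T (c i)) ?_ ?_
    · obtain ⟨d, h1, h2⟩ := this
      exact ⟨d, h1, h2⟩
    · rintro R hR ⟨t0, ht0⟩ hne
      obtain ⟨t1, ht1⟩ : ∃ t1 ∈ Q, t1 ∉ R := by
        by_contra! h
        exact hne (Finset.Subset.antisymm hR h)
      have hR' : R ⊆ T := hR.trans (Finset.filter_subset _ _)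
      obtain ⟨t, ht, t', ht', x, hxO, hx, hx', hcard⟩ := H.dualO hM hO hOc R hR'
        ⟨t0, ht0, (Finset.mem_filter.1 (hR ht0)).2⟩
        ⟨t1, Finset.mem_sdiff.2 ⟨(Finset.mem_filter.1 ht1.1).1, ht1.2⟩, (Finset.mem_filter.1 ht1.1).2⟩
      rw [Finset.mem_sdiff] at ht'
      refine ⟨t, ht, t', Finset.mem_sdiff.2 ⟨Finset.mem_filter.2 ⟨ht'.1, x, hx', hxO⟩, ht'.2⟩,
        Pi.single (t ∩ t') 1, ?_, del_single H.two (hR' ht) ht'.1 (by rintro rfl; exact ht'.2 ht) Finset.inter_subset_left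
          Finset.inter_subset_right hcard⟩
      intro s hs hsQ e he
      refine Pi.single_eq_of_ne ?_ _
      rintro rfl
      obtain ⟨w, hw⟩ := mem_hull.1 hx
      have hxe := mem_hull.2 ⟨w, H.wt_inter (hR' ht) ht'.1 hw hx'⟩
      exact hsQ (Finset.mem_filter.2 ⟨hs, x, convexHull_mono (by exact_mod_cast he) hxe, hxO⟩)
    · intro t ht
      by_cases hT : t ∈ T
      · have := (coc_iff (H.c3 t hT)).1 (hcoc i t hT ht)
        simp [del, hT, this]
      · simp [del, hT]
    · rw [← sum_del H.two (c i)]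
      refine Finset.sum_subset (Finset.filter_subset _ _) fun t hT ht => ?_
      have := (coc_iff (H.c3 t hT)).1 (hcoc i t hT ht)
      simp [del, hT, this]
  choose d hdD hdel using hD
  let Φ : (Fin m → ZMod 2) →ₗ[ZMod 2] (Finset E → ZMod 2) :=
    { toFun := fun a => ∑ i, a i • (c i + d i)
      map_add' := fun a b => by
        rw [← Finset.sum_add_distrib]
        exact Finset.sum_congr rfl fun i _ => by rw [Pi.add_apply, add_smul]
      map_smul' := fun k a => by
        rw [RingHom.id_apply, Finset.smul_sum]
        exact Finset.sum_congr rfl fun i _ => by rw [Pi.smul_apply, smul_assoc] }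
  have hΦ : ∀ a, Φ a = ∑ i, a i • (c i + d i) := fun a => rfl
  refine ⟨Φ, fun a t ht => ?_, fun a ⟨g, hg⟩ => ?_⟩
  · rw [coc_iff (H.c3 t ht)]
    have : del T (Φ a) = 0 := by
      rw [hΦ, map_sum]
      refine Finset.sum_eq_zero fun i _ => ?_
      rw [map_smul, map_add, hdel]
      ext s
      simp [z2]
    have := congrFun this t
    simpa [del, ht] using this
  by_contra hne
  obtain ⟨j, hj⟩ : ∃ j, a j ≠ 0 := by
    by_contra! h
    exact hne (funext h)
  have hj1 : a j = 1 := by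
    revert hj; generalize a j = q; revert q; decide
  have hrel : ∀ t ∈ T, (convexHull ℝ (t : Set E) ∩ C j).Nonempty → ∀ x ∈ t, ∀ y ∈ t, x ≠ y →
      kk (r j x) (r j y) = g x + g y := by
    rintro t ht ⟨p, hpt, hpC⟩ x hx y hy hxy
    have hpU : p ∈ ⋃ i, C i := mem_iUnion.2 ⟨j, hpC⟩
    have hQ : t ∉ Q := by
      intro h
      obtain ⟨q, hq, hqO⟩ := (Finset.mem_filter.1 h).2
      have := hfar p hpU q hqO
      have := hull_dist hmesh ht hpt hq
      linarith
    have hsub : ({x, y} : Finset E) ⊆ t := by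
      intro z hz; simp at hz; rcases hz with rfl | rfl <;> assumption
    rw [← hg t ht x hx y hy hxy, hΦ, Finset.sum_apply, Finset.sum_eq_single j, hj1]
    · simp [hdD j t ht hQ _ hsub, hc]
    · intro i _ hij
      have hz : c i {x, y} = 0 := by
        rw [hc]
        have near : ∀ z ∈ t, ‖r i z - 1‖ < 1 / 16 := by
          intro z hz
          apply (hρ _).2
          have := hclose i t ht z (hv t z hz) p hpt
          rwa [f2 i j hij.symm p hpC] at this
        refine if_pos ?_
        have h1 := near x hx
        have h2 := near y hy
        have := norm_sub_le (r i x - 1) (r i y - 1)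
        rw [sub_sub_sub_cancel_right] at this
        linarith
      simp [hdD i t ht hQ _ hsub, hz]
    · simp
  let σ : E → ℂ := fun x => if g x = 0 then r j x else - r j x
  have hσ2 : ∀ x, σ x ^ 2 = f j x := by
    intro x; simp only [σ]; split_ifs
    · exact hr j x
    · rw [neg_sq]; exact hr j x
  have hσ : ∀ t ∈ T, (convexHull ℝ (t : Set E) ∩ C j).Nonempty → ∀ x ∈ t, ∀ y ∈ t, ‖σ x - σ y‖ < 1 / 4 := by
    intro t ht hp x hx y hy
    by_cases hxy : x = y
    · subst hxy; simp
    have h1 := hrel t ht hp x hx y hy hxy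
    have h2 := kk_cases (a := r j x) (b := r j y) (by rw [hr, hr]; exact hclose j t ht _ (hv t x hx) _ (hv t y hy))
    have hz : ∀ q : ZMod 2, q = 0 ∨ q = 1 := by decide
    simp only [σ]
    rcases hz (g x) with gx | gx <;> rcases hz (g y) with gy | gy <;> rw [gx, gy] at h1 ⊢ <;> rw [h1] at h2
    · have := (h2.resolve_right fun h => by simpa using h.1).2
      simpa using this
    · have := (h2.resolve_left fun h => by simpa using h.1).2
      simpa using this
    · have := (h2.resolve_left fun h => by simpa using h.1).2
      simp only [one_ne_zero, if_true, if_false]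
      rwa [← norm_neg, show -(-r j x - r j y) = r j x + r j y by ring]
    · have := (h2.resolve_right fun h => by revert h; rw [show (1 + 1 : ZMod 2) = 0 from rfl]; simp).2
      simp only [one_ne_zero, if_false]
      rwa [← norm_neg, show -(-r j x - -r j y) = r j x - r j y by ring]
  have hs : ∀ p : C j, ∃ z : ℂ, z ^ 2 = f j p ∧ ∃ t ∈ T, (p : E) ∈ convexHull ℝ (t : Set E) ∧ ∃ x ∈ t, ‖z - σ x‖ < 1 / 4 := by
    intro p
    obtain ⟨t, ht, hpt⟩ := (H.cov p).1 (hC j p.2)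
    obtain ⟨x, hx⟩ := H.ne ht
    have h1 := hclose j t ht p hpt x (hv t x hx)
    rw [← hr j p, ← hσ2] at h1
    rcases sq_near h1 with h | h
    · exact ⟨_, hr j p, t, ht, hpt, x, hx, h⟩
    · exact ⟨-r j p, by rw [neg_sq, hr], t, ht, hpt, x, hx, by rwa [← norm_neg, show -(-r j p - σ x) = r j p + σ x by ring]⟩
  choose s s2 ts hts hpt xs hxs hnear using hs
  have hlip : ∀ t ∈ T, ∀ p q : C j, (p : E) ∈ convexHull ℝ (t : Set E) → (q : E) ∈ convexHull ℝ (t : Set E) →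
      ‖s p - s q‖ ≤ ‖f j p - f j q‖ := by
    intro t ht p q hp hq
    have sh : ∀ p : C j, (p : E) ∈ convexHull ℝ (t : Set E) → ∃ y ∈ t, ‖s p - σ y‖ < 1 / 2 := by
      intro p hp
      obtain ⟨w, hw⟩ := mem_hull.1 (hpt p)
      have hw := H.wt_inter (hts p) ht hw hp
      obtain ⟨y, hy⟩ : (ts p ∩ t).Nonempty := by
        rw [Finset.nonempty_iff_ne_empty]; intro h
        have := hw.2.2.1; rw [h] at this; simp at this
      rw [Finset.mem_inter] at hy
      refine ⟨y, hy.2, ?_⟩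
      have h1 := hσ (ts p) (hts p) ⟨p, hpt p, p.2⟩ (xs p) (hxs p) y hy.1
      have h2 := hnear p
      have := norm_add_le (s p - σ (xs p)) (σ (xs p) - σ y)
      rw [sub_add_sub_cancel] at this
      linarith
    obtain ⟨y, hy, h1⟩ := sh p hp
    obtain ⟨y', hy', h2⟩ := sh q hq
    have h3 := hσ t ht ⟨p, hp, p.2⟩ y hy y' hy'
    have h4 : ‖s p - s q‖ < 5 / 4 := by
      have := norm_add₃_le (a := s p - σ y) (b := σ y - σ y') (c := -(s q - σ y'))
      rw [show s p - σ y + (σ y - σ y') + -(s q - σ y') = s p - s q by ring, norm_neg] at this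
      linarith
    have hn : ∀ p, ‖s p‖ = 1 := by
      intro p
      have := congrArg norm (s2 p)
      rw [fn j p (mem_iUnion.2 ⟨j, p.2⟩), norm_pow] at this
      nlinarith [norm_nonneg (s p)]
    have h5 := hclose j t ht p hp q hq
    have h6 : ‖s p + s q‖ * ‖s p - s q‖ = ‖f j p - f j q‖ := by rw [← norm_mul, ← sq_sub_sq, s2, s2]
    have h7 : 2 ≤ ‖s p + s q‖ + ‖s p - s q‖ := by
      have := norm_add_le (s p + s q) (s p - s q)
      rw [show s p + s q + (s p - s q) = 2 * s p by ring, norm_mul, hn, Complex.norm_ofNat] at this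
      linarith
    have h8 : ‖s p - s q‖ < 1 / 4 := by
      by_contra! h
      nlinarith [norm_nonneg (s p + s q)]
    nlinarith [norm_nonneg (s p - s q)]
  have scont : Continuous s := by
    refine LocallyFinite.continuous (f := fun t : T => {p : C j | (p : E) ∈ convexHull ℝ ((t : Finset E) : Set E)})
      (locallyFinite_of_finite _) ?_ (fun t => (hull_closed _).preimage continuous_subtype_val) ?_
    · rw [eq_univ_iff_forall]
      intro p
      exact mem_iUnion.2 ⟨⟨ts p, hts p⟩, hpt p⟩
    · intro t p hp
      rw [Metric.continuousWithinAt_iff]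
      intro ε hε
      obtain ⟨δ, hδ, h⟩ := Metric.continuous_iff.1 ((fc j).comp (continuous_subtype_val (p := (· ∈ C j)))) p ε hε
      refine ⟨δ, hδ, fun q hq hqp => ?_⟩
      have := h q hqp
      rw [dist_eq_norm] at this ⊢
      exact (hlip t t.2 q p hq hp).trans_lt this
  refine no_sqrt (s ∘ (φ j).symm) (scont.comp (φ j).symm.continuous) fun z => ?_
  rw [Function.comp_apply, s2, f1 j, Homeomorph.apply_symm_apply]
end Up
end PaperAlg

namespace PaperAlg
open Geometry Set
section Cir
variable {X : Type*} [TopologicalSpace X] [T2Space X]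

def Arc (A : Set X) (a b : X) : Prop :=
  ∃ (p q : ℝ) (f : ℝ → X), p < q ∧ ContinuousOn f (Icc p q) ∧ InjOn f (Icc p q) ∧ f p = a ∧ f q = b ∧ f '' Icc p q = A

theorem circle_of {p q : ℝ} (hpq : p < q) {h : ℝ → X} (hc : ContinuousOn h (Icc p q)) (hi : InjOn h (Ico p q))
    (he : h p = h q) : Nonempty (↥(h '' Icc p q) ≃ₜ Circle) := by
  haveI : Fact (0 < q - p) := ⟨sub_pos.2 hpq⟩
  have hq : p + (q - p) = q := by ring
  have h1 : Continuous (AddCircle.liftIco (q - p) p h) :=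
    AddCircle.liftIco_continuous (by rw [hq]; exact he) (by rw [hq]; exact hc)
  have hs : ∀ z : AddCircle (q - p), ∃ t ∈ Ico p q, (t : AddCircle (q - p)) = z := fun z => by
    have : z ∈ (univ : Set (AddCircle (q - p))) := trivial
    rw [← AddCircle.coe_image_Ico_eq (q - p) p, hq] at this
    exact this
  have hv : ∀ t ∈ Ico p q, AddCircle.liftIco (q - p) p h (t : AddCircle (q - p)) = h t := fun t ht =>
    AddCircle.liftIco_coe_apply (by rw [hq]; exact ht)
  have h2 : Function.Injective (AddCircle.liftIco (q - p) p h) := by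
    intro x y hxy
    obtain ⟨t, ht, rfl⟩ := hs x
    obtain ⟨s, hs', rfl⟩ := hs y
    rw [hv t ht, hv s hs'] at hxy
    rw [hi ht hs' hxy]
  have h3 : range (AddCircle.liftIco (q - p) p h) = h '' Icc p q := by
    ext y
    constructor
    · rintro ⟨z, rfl⟩
      obtain ⟨t, ht, rfl⟩ := hs z
      rw [hv t ht]
      exact ⟨t, ⟨ht.1, ht.2.le⟩, rfl⟩
    · rintro ⟨t, ht, rfl⟩
      rcases ht.2.lt_or_eq with h | h
      · exact ⟨t, hv t ⟨ht.1, h⟩⟩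
      · rw [h, ← he]
        exact ⟨p, hv p ⟨le_rfl, hpq⟩⟩
  rw [← h3]
  exact ⟨(h1.isClosedEmbedding h2).isEmbedding.toHomeomorph.symm.trans (AddCircle.homeomorphCircle (sub_pos.2 hpq).ne')⟩

theorem Arc.symm {A : Set X} {a b : X} (h : Arc A a b) : Arc A b a := by
  obtain ⟨p, q, f, h1, h2, h3, h4, h5, h6⟩ := h
  have hm : MapsTo (fun t : ℝ => -t) (Icc (-q) (-p)) (Icc p q) := fun t ht => ⟨by linarith [ht.2], by linarith [ht.1]⟩
  refine ⟨-q, -p, fun t => f (-t), by linarith, h2.comp continuous_neg.continuousOn hm,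
    fun t ht s hs h => neg_injective (h3 (hm ht) (hm hs) h), by simpa, by simpa, ?_⟩
  rw [← h6, ← image_image f (fun t => -t)]
  simp

theorem Arc.shift {A : Set X} {a b : X} (h : Arc A a b) (r : ℝ) :
    ∃ (q : ℝ) (f : ℝ → X), r < q ∧ ContinuousOn f (Icc r q) ∧ InjOn f (Icc r q) ∧ f r = a ∧ f q = b ∧ f '' Icc r q = A := by
  obtain ⟨p, q, f, h1, h2, h3, h4, h5, h6⟩ := h
  have hm : MapsTo (fun t : ℝ => t + (p - r)) (Icc r (r + (q - p))) (Icc p q) :=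
    fun t ht => ⟨by linarith [ht.1], by linarith [ht.2]⟩
  refine ⟨r + (q - p), fun t => f (t + (p - r)), by linarith, h2.comp (by fun_prop) hm,
    fun t ht s hs h => by linarith [h3 (hm ht) (hm hs) h], by simpa, by ring_nf; exact h5, ?_⟩
  rw [← h6, ← image_image f (fun t => t + (p - r))]
  simp

theorem glue {p q s : ℝ} (hpq : p < q) (hqs : q < s) {f g : ℝ → X} (hf : ContinuousOn f (Icc p q))
    (hg : ContinuousOn g (Icc q s)) (he : f q = g q) :
    ∃ h : ℝ → X, ContinuousOn h (Icc p s) ∧ (∀ t ∈ Icc p q, h t = f t) ∧ (∀ t ∈ Icc q s, h t = g t) ∧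
      h '' Icc p s = f '' Icc p q ∪ g '' Icc q s := by
  have h1 : ∀ t ∈ Icc p q, (fun t => if t ≤ q then f t else g t) t = f t := fun t ht => if_pos ht.2
  have h2 : ∀ t ∈ Icc q s, (fun t => if t ≤ q then f t else g t) t = g t := fun t ht => by
    dsimp only; split_ifs with h
    · rw [le_antisymm h ht.1, he]
    · rfl
  refine ⟨fun t => if t ≤ q then f t else g t, ?_, h1, h2, ?_⟩
  · rw [← Icc_union_Icc_eq_Icc hpq.le hqs.le]
    exact (hf.congr h1).union_of_isClosed (hg.congr h2) isClosed_Icc isClosed_Icc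
  · rw [← Icc_union_Icc_eq_Icc hpq.le hqs.le, image_union, image_congr h1, image_congr h2]

theorem Arc.trans {A B : Set X} {a b c : X} (h : Arc A a b) (h' : Arc B b c) (hAB : ∀ x ∈ A, x ∈ B → x = b) :
    Arc (A ∪ B) a c := by
  obtain ⟨p, q, f, h1, h2, h3, h4, h5, h6⟩ := h
  obtain ⟨s, g, k1, k2, k3, k4, k5, k6⟩ := h'.shift q
  obtain ⟨H, H1, H2, H3, H4⟩ := glue h1 k1 h2 k2 (h5.trans k4.symm)
  have key : ∀ t ∈ Icc p q, ∀ t' ∈ Icc q s, H t = H t' → t = t' := fun t ht t' ht' h => by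
    rw [H2 t ht, H3 t' ht'] at h
    have e : f t = b := hAB _ (h6 ▸ ⟨t, ht, rfl⟩) (h ▸ k6 ▸ ⟨t', ht', rfl⟩)
    rw [h3 ht ⟨h1.le, le_rfl⟩ (e.trans h5.symm), k3 ht' ⟨le_rfl, k1.le⟩ (h.symm.trans (e.trans k4.symm))]
  refine ⟨p, s, H, h1.trans k1, H1, ?_, ?_, ?_, by rw [H4, h6, k6]⟩
  · intro t ht t' ht' h
    rcases le_total t q with a1 | a1 <;> rcases le_total t' q with a2 | a2
    · rw [H2 t ⟨ht.1, a1⟩, H2 t' ⟨ht'.1, a2⟩] at h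
      exact h3 ⟨ht.1, a1⟩ ⟨ht'.1, a2⟩ h
    · exact key t ⟨ht.1, a1⟩ t' ⟨a2, ht'.2⟩ h
    · exact (key t' ⟨ht'.1, a2⟩ t ⟨a1, ht.2⟩ h.symm).symm
    · rw [H3 t ⟨a1, ht.2⟩, H3 t' ⟨a2, ht'.2⟩] at h
      exact k3 ⟨a1, ht.2⟩ ⟨a2, ht'.2⟩ h
  · rw [H2 p ⟨le_rfl, h1.le⟩, h4]
  · rw [H3 s ⟨k1.le, le_rfl⟩, k5]

theorem Arc.close {A B : Set X} {a b : X} (h : Arc A a b) (h' : Arc B b a) (hAB : ∀ x ∈ A, x ∈ B → x = a ∨ x = b) :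
    Nonempty (↥(A ∪ B) ≃ₜ Circle) := by
  obtain ⟨p, q, f, h1, h2, h3, h4, h5, h6⟩ := h
  obtain ⟨s, g, k1, k2, k3, k4, k5, k6⟩ := h'.shift q
  obtain ⟨H, H1, H2, H3, H4⟩ := glue h1 k1 h2 k2 (h5.trans k4.symm)
  rw [← h6, ← k6, ← H4]
  have key : ∀ t ∈ Icc p q, ∀ t' ∈ Ico q s, H t = H t' → t = t' := fun t ht t' ht' h => by
    have ht'' : t' ∈ Icc q s := ⟨ht'.1, ht'.2.le⟩
    rw [H2 t ht, H3 t' ht''] at h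
    rcases hAB (f t) (h6 ▸ ⟨t, ht, rfl⟩) (h ▸ k6 ▸ ⟨t', ht'', rfl⟩) with e | e
    · exact absurd (k3 ht'' ⟨k1.le, le_rfl⟩ (h.symm.trans (e.trans k5.symm))) ht'.2.ne
    · rw [h3 ht ⟨h1.le, le_rfl⟩ (e.trans h5.symm), k3 ht'' ⟨le_rfl, k1.le⟩ (h.symm.trans (e.trans k4.symm))]
  refine circle_of (h1.trans k1) H1 ?_ ?_
  · intro t ht t' ht' h
    rcases le_total t q with a1 | a1 <;> rcases le_total t' q with a2 | a2
    · rw [H2 t ⟨ht.1, a1⟩, H2 t' ⟨ht'.1, a2⟩] at h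
      exact h3 ⟨ht.1, a1⟩ ⟨ht'.1, a2⟩ h
    · exact key t ⟨ht.1, a1⟩ t' ⟨a2, ht'.2⟩ h
    · exact (key t' ⟨ht'.1, a2⟩ t ⟨a1, ht.2⟩ h.symm).symm
    · rw [H3 t ⟨a1, ht.2.le⟩, H3 t' ⟨a2, ht'.2.le⟩] at h
      exact k3 ⟨a1, ht.2.le⟩ ⟨a2, ht'.2.le⟩ h
  · rw [H2 p ⟨le_rfl, h1.le⟩, h4, H3 s ⟨k1.le, le_rfl⟩, k5]

variable {V : Type*} [DecidableEq V]

def ends (L : List (Set X × V × V)) : List V := L.flatMap fun x => [x.2.1, x.2.2]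

theorem circles (loc : V → X) (κ : V → ℕ) (N : ℕ) : ∀ L : List (Set X × V × V), L.length ≤ N →
    (∀ x ∈ L, Arc x.1 (loc x.2.1) (loc x.2.2)) → (∀ x ∈ L, κ x.2.1 = κ x.2.2) →
    L.Pairwise (fun x y => ∀ P ∈ x.1, P ∈ y.1 → ∃ v, loc v = P ∧ (v = x.2.1 ∨ v = x.2.2) ∧ (v = y.2.1 ∨ v = y.2.2)) →
    (∀ v ∈ ends L, (ends L).count v = 2) →
    ∃ Cs : List (Set X × ℕ), Cs.Pairwise (fun c d => Disjoint c.1 d.1) ∧ (∀ c ∈ Cs, Nonempty (↥c.1 ≃ₜ Circle)) ∧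
      (∀ P, (∃ c ∈ Cs, P ∈ c.1) ↔ ∃ x ∈ L, P ∈ x.1) ∧ ∀ x ∈ L, ∃ c ∈ Cs, c.2 = κ x.2.1 := by
  induction N with
  | zero =>
    intro L hL _ _ _ _
    obtain rfl := List.length_eq_zero_iff.1 (Nat.le_zero.1 hL)
    exact ⟨[], by simp, by simp, by simp, by simp⟩
  | succ N ih =>
    intro L hL hA hκ hp hc
    rcases L with _ | ⟨⟨A, a, b⟩, L1⟩
    · exact ⟨[], by simp, by simp, by simp, by simp⟩
    have hab : ∀ x ∈ ((A, a, b) :: L1 : List (Set X × V × V)), x.2.1 ≠ x.2.2 := fun x hx h => by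
      obtain ⟨p, q, f, h1, _, h3, h4, h5, _⟩ := hA x hx
      exact h1.ne (h3 ⟨le_rfl, h1.le⟩ ⟨h1.le, le_rfl⟩ (by rw [h4, h5, h]))
    have hne : a ≠ b := hab _ List.mem_cons_self
    have e1 : (ends ((A, a, b) :: L1)).count a = (ends L1).count a + 1 := by
      simp [ends, hne.symm]
    obtain ⟨y, hy, hya⟩ : ∃ y ∈ L1, a = y.2.1 ∨ a = y.2.2 := by
      have h1 := hc a (by simp [ends])
      have : a ∈ ends L1 := List.count_pos_iff.1 (by omega)
      simpa [ends] using this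
    obtain ⟨B, c, hyB, hyc⟩ : ∃ B c, B = y.1 ∧ (y.2 = (a, c) ∨ y.2 = (c, a)) := by
      rcases y with ⟨B, y1, y2⟩
      rcases hya with rfl | rfl
      · exact ⟨B, y2, rfl, Or.inl rfl⟩
      · exact ⟨B, y1, rfl, Or.inr rfl⟩
    subst hyB
    classical
    obtain ⟨L', hL'⟩ : ∃ L', L1.Perm (y :: L') := ⟨_, List.perm_cons_erase hy⟩
    have hperm : ((A, a, b) :: L1).Perm ((A, a, b) :: y :: L') := hL'.cons _
    have hm : ∀ x, x ∈ ((A, a, b) :: L1 : List (Set X × V × V)) ↔ x = (A, a, b) ∨ x = y ∨ x ∈ L' := fun x => by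
      rw [hperm.mem_iff]; simp
    rw [List.Perm.pairwise_iff (fun h P h1 h2 => by
      obtain ⟨v, h3, h4, h5⟩ := h P h2 h1
      exact ⟨v, h3, h5, h4⟩) hperm, List.pairwise_cons, List.pairwise_cons] at hp
    obtain ⟨hp1, hp2, hp3⟩ := hp
    have hac : a ≠ c := fun h => by
      have := hab y ((hm y).2 (by simp))
      rcases hyc with e | e <;> rw [e] at this <;> exact this (by simp [h])
    have hAy : Arc y.1 (loc a) (loc c) := by
      have := hA y ((hm y).2 (by simp))
      rcases hyc with e | e <;> rw [e] at this
      exacts [this, this.symm]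
    have hκy : κ a = κ c ∧ κ y.2.1 = κ a := by
      have := hκ y ((hm y).2 (by simp))
      rcases hyc with e | e <;> rw [e] at this ⊢
      exacts [⟨this, rfl⟩, ⟨this.symm, this⟩]
    have hyv : ∀ v, (v = y.2.1 ∨ v = y.2.2) ↔ (v = a ∨ v = c) := fun v => by
      rcases hyc with e | e <;> rw [e]
      exact or_comm
    have hκb : κ a = κ b := hκ _ List.mem_cons_self
    have hAx : Arc A (loc a) (loc b) := hA _ List.mem_cons_self
    have hcnt : ∀ v, (ends ((A, a, b) :: L1)).count v = [a, b, a, c].count v + (ends L').count v := fun v => by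
      have : (ends ((A, a, b) :: L1)).Perm ([a, b, a, c] ++ ends L') := by
        refine (hperm.flatMap_right _).trans ?_
        simp only [List.flatMap_cons]
        rcases hyc with e | e <;> rw [e]
        · exact List.Perm.of_eq (by simp [ends])
        · refine List.Perm.trans (List.Perm.of_eq (by simp [ends])) (((List.Perm.swap a c (ends L')).cons b).cons a)
      rw [this.count_eq, List.count_append]
    have hmem : ∀ v, v ∈ ends ((A, a, b) :: L1) ↔ 0 < [a, b, a, c].count v + (ends L').count v := fun v => by
      rw [← hcnt, List.count_pos_iff]
    have ha0 : (ends L').count a = 0 := by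
      have := hc a (by simp [ends])
      rw [hcnt] at this
      simp [hne.symm, hac.symm] at this
      exact this
    have ha1 : ∀ x ∈ L', ∀ v, (v = x.2.1 ∨ v = x.2.2) → v ≠ a := fun x hx v hv h => by
      refine List.count_eq_zero.1 ha0 (List.mem_flatMap.2 ⟨x, hx, ?_⟩)
      rw [← h]; simpa using hv
    have hlen := hperm.length_eq
    simp only [List.length_cons] at hL hlen
    by_cases hbc : b = c
    · subst hbc
      have hb0 : (ends L').count b = 0 := by
        have := hc b (by simp [ends])
        rw [hcnt] at this
        simp [hne] at this
        exact this
      obtain ⟨Cs, c1, c2, c3, c4⟩ := ih L' (by omega) (fun x hx => hA x ((hm x).2 (by simp [hx])))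
        (fun x hx => hκ x ((hm x).2 (by simp [hx]))) hp3 (fun v hv => by
          have h1 := List.count_pos_iff.2 hv
          have h2 := hc v ((hmem v).2 (by omega))
          have h3 : a ≠ v := by rintro rfl; omega
          have h4 : b ≠ v := by rintro rfl; omega
          rw [hcnt] at h2
          simpa [h3, h4] using h2)
      refine ⟨(A ∪ y.1, κ a) :: Cs, List.pairwise_cons.2 ⟨fun d hd => ?_, c1⟩, ?_, ?_, ?_⟩
      · rw [Set.disjoint_left]
        intro P hP hPd
        obtain ⟨x, hx, hPx⟩ := (c3 P).1 ⟨d, hd, hPd⟩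
        have hb1 : ∀ v, (v = x.2.1 ∨ v = x.2.2) → v ≠ b := fun v hv h => by
          refine List.count_eq_zero.1 hb0 (List.mem_flatMap.2 ⟨x, hx, ?_⟩)
          rw [← h]; simpa using hv
        rcases hP with hP | hP
        · obtain ⟨v, _, h1, h2⟩ := hp1 x (List.mem_cons_of_mem _ hx) P hP hPx
          exact h1.elim (ha1 x hx v h2) (hb1 v h2)
        · obtain ⟨v, _, h1, h2⟩ := hp2 x hx P hP hPx
          exact ((hyv v).1 h1).elim (ha1 x hx v h2) (hb1 v h2)
      · intro d hd
        rcases List.mem_cons.1 hd with rfl | hd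
        · refine hAx.close hAy.symm fun P h1 h2 => ?_
          obtain ⟨v, rfl, h3, _⟩ := hp1 y List.mem_cons_self P h1 h2
          exact h3.imp (fun h => by rw [h]) (fun h => by rw [h])
        · exact c2 d hd
      · intro P
        have := c3 P
        simp only [List.mem_cons, exists_eq_or_imp] at this ⊢
        rw [this]
        constructor
        · rintro ((h | h) | ⟨x, hx, h⟩)
          exacts [Or.inl h, Or.inr ⟨y, hy, h⟩, Or.inr ⟨x, hL'.mem_iff.2 (by simp [hx]), h⟩]
        · rintro (h | ⟨x, hx, h⟩)
          · exact Or.inl (Or.inl h)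
          · rcases List.mem_cons.1 (hL'.mem_iff.1 hx) with rfl | hx
            exacts [Or.inl (Or.inr h), Or.inr ⟨x, hx, h⟩]
      · intro x hx
        rcases (hm x).1 hx with rfl | rfl | hx
        · exact ⟨_, List.mem_cons_self, rfl⟩
        · exact ⟨_, List.mem_cons_self, hκy.2.symm⟩
        · obtain ⟨d, hd, h⟩ := c4 x hx
          exact ⟨d, List.mem_cons_of_mem _ hd, h⟩
    · obtain ⟨Cs, c1, c2, c3, c4⟩ := ih ((A ∪ y.1, b, c) :: L') (by simp only [List.length_cons]; omega) (fun x hx => by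
          rcases List.mem_cons.1 hx with rfl | hx
          · refine hAx.symm.trans hAy fun P h1 h2 => ?_
            obtain ⟨v, rfl, h3, h4⟩ := hp1 y List.mem_cons_self P h1 h2
            rw [hyv] at h4
            rcases h3 with rfl | rfl
            · rfl
            · rcases h4 with h | h
              exacts [by rw [h], absurd h hbc]
          · exact hA x ((hm x).2 (by simp [hx])))
        (fun x hx => by
          rcases List.mem_cons.1 hx with rfl | hx
          · exact hκb.symm.trans hκy.1
          · exact hκ x ((hm x).2 (by simp [hx])))
        (List.pairwise_cons.2 ⟨fun x hx P h1 h2 => by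
          rcases h1 with h1 | h1
          · obtain ⟨v, h3, h4, h5⟩ := hp1 x (List.mem_cons_of_mem _ hx) P h1 h2
            exact ⟨v, h3, Or.inl (h4.resolve_left (ha1 x hx v h5)), h5⟩
          · obtain ⟨v, h3, h4, h5⟩ := hp2 x hx P h1 h2
            exact ⟨v, h3, Or.inr (((hyv v).1 h4).resolve_left (ha1 x hx v h5)), h5⟩, hp3⟩)
        (fun v hv => by
          have h0 : ∀ v, (ends ((A ∪ y.1, b, c) :: L')).count v = [b, c].count v + (ends L').count v := fun v => by
            rw [← List.count_append]; simp [ends]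
          have h1 := List.count_pos_iff.2 hv
          have h3 : a ≠ v := by rintro rfl; rw [h0] at h1; simp [hne.symm, hac.symm] at h1; exact List.count_eq_zero.1 ha0 h1
          have h4 : [a, b, a, c].count v = [b, c].count v := by simp [h3, List.count_cons]
          rw [h0] at h1 ⊢
          have h2 := hc v ((hmem v).2 (by omega))
          rw [hcnt] at h2
          omega)
      refine ⟨Cs, c1, c2, fun P => ?_, fun x hx => ?_⟩
      · rw [c3]
        simp only [List.mem_cons, exists_eq_or_imp]
        constructor
        · rintro ((h | h) | ⟨x, hx, h⟩)
          exacts [Or.inl h, Or.inr ⟨y, hy, h⟩, Or.inr ⟨x, hL'.mem_iff.2 (by simp [hx]), h⟩]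
        · rintro (h | ⟨x, hx, h⟩)
          · exact Or.inl (Or.inl h)
          · rcases List.mem_cons.1 (hL'.mem_iff.1 hx) with rfl | hx
            exacts [Or.inl (Or.inr h), Or.inr ⟨x, hx, h⟩]
      · obtain ⟨d, hd, h⟩ := c4 _ List.mem_cons_self
        rcases (hm x).1 hx with rfl | rfl | hx
        · exact ⟨d, hd, h.trans hκb.symm⟩
        · exact ⟨d, hd, h.trans (hκb.symm.trans hκy.2.symm)⟩
        · exact c4 x (List.mem_cons_of_mem _ hx)
end Cir
end PaperAlg

namespace PaperAlg
open Geometry Set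
section NCx
variable {α : Type*}

def Nst (p q p' q' : ℕ) : Prop := q < p' ∨ q' < p ∨ (p < p' ∧ q' < q) ∨ (p' < p ∧ q < q')

theorem NC.arcs {w : List α} {M} (h : NC w M) (pos : α → ℕ) (hw : w.Pairwise fun a b => pos a < pos b) :
    ∃ L : List (α × α), (L.flatMap fun x => [x.1, x.2]).Perm w ∧ (∀ x ∈ L, pos x.1 < pos x.2 ∧ s(x.1, x.2) ∈ M) ∧
      L.Pairwise (fun x y => Nst (pos x.1) (pos x.2) (pos y.1) (pos y.2)) ∧
      ∀ a b, s(a, b) ∈ M → (a, b) ∈ L ∨ (b, a) ∈ L := by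
  induction h with
  | nil => exact ⟨[], by simp, by simp, by simp, by simp⟩
  | ins u v a b M hM ih =>
    have hsub : (u ++ v).Sublist (u ++ a :: b :: v) :=
      (List.Sublist.refl u).append ((List.sublist_cons_self b v).trans (List.sublist_cons_self a _))
    obtain ⟨L, h1, h2, h3, h4⟩ := ih (hw.sublist hsub)
    rw [List.pairwise_append, List.pairwise_cons, List.pairwise_cons] at hw
    obtain ⟨-, ⟨k1, k2, -⟩, k4⟩ := hw
    have hab : pos a < pos b := k1 b (by simp)
    have out : ∀ x ∈ u ++ v, pos x < pos a ∨ pos b < pos x := fun x hx => by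
      rcases List.mem_append.1 hx with h | h
      · exact Or.inl (k4 x h a (by simp))
      · exact Or.inr (k2 x h)
    refine ⟨(a, b) :: L, ?_, ?_, ?_, ?_⟩
    · refine List.Perm.trans (l₂ := a :: b :: (u ++ v)) ?_ ?_
      · simpa using h1
      · exact ((List.perm_middle.trans (List.perm_middle.cons a |>.trans (List.Perm.refl _)))).symm
    · intro x hx
      rcases List.mem_cons.1 hx with rfl | hx
      · exact ⟨hab, Set.mem_insert _ _⟩
      · exact ⟨(h2 x hx).1, Set.mem_insert_of_mem _ (h2 x hx).2⟩
    · refine List.pairwise_cons.2 ⟨fun y hy => ?_, h3⟩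
      have e1 := out y.1 (h1.mem_iff.1 (List.mem_flatMap.2 ⟨y, hy, by simp⟩))
      have e2 := out y.2 (h1.mem_iff.1 (List.mem_flatMap.2 ⟨y, hy, by simp⟩))
      have e3 := (h2 y hy).1
      unfold Nst
      dsimp only
      omega
    · intro c d hcd
      rcases hcd with h | h
      · rcases Sym2.eq_iff.1 h with ⟨rfl, rfl⟩ | ⟨rfl, rfl⟩ <;> simp
      · exact (h4 c d h).imp (List.mem_cons_of_mem _) (List.mem_cons_of_mem _)

theorem NCs.split {β : Type*} {f : β → List α} : ∀ {l : List β} {M}, NCs (l.map f) M → l.Nodup →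
    ∃ Mo : β → Set (Sym2 α), (∀ o ∈ l, NC (f o) (Mo o)) ∧ ∀ s, s ∈ M ↔ ∃ o ∈ l, s ∈ Mo o := by
  classical
  intro l
  induction l with
  | nil => intro M h _; cases h; exact ⟨fun _ => ∅, by simp, by simp⟩
  | cons o l ih =>
    intro M h hn
    rw [List.nodup_cons] at hn
    rw [List.map_cons] at h
    cases h with
    | cons _ _ M N h1 h2 =>
      obtain ⟨Mo, e1, e2⟩ := ih h2 hn.2
      have hne : ∀ o' ∈ l, Function.update Mo o M o' = Mo o' := fun o' ho' =>
        Function.update_of_ne (fun h : o' = o => hn.1 (h ▸ ho')) _ _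
      refine ⟨Function.update Mo o M, fun o' ho' => ?_, fun s => ?_⟩
      · rcases List.mem_cons.1 ho' with rfl | ho'
        · simpa using h1
        · rw [hne o' ho']; exact e1 o' ho'
      · simp only [List.mem_cons, exists_eq_or_imp, Function.update_self, Set.mem_union, e2]
        refine or_congr Iff.rfl (exists_congr fun o' => and_congr_right fun ho' => ?_)
        rw [hne o' ho']
end NCx

section Psi
variable {E : Type*} [NormedAddCommGroup E] [NormedSpace ℝ E] [DecidableEq E]

def c0 (t : ℝ) : ℝ := max 0 (1 - t) + max 0 (t - 2)
def c1 (t : ℝ) : ℝ := max 0 (1 - |t - 1|)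
def c2 (t : ℝ) : ℝ := max 0 (1 - |t - 2|)

theorem cA {t : ℝ} (h0 : 0 ≤ t) (h : t ≤ 1) : c0 t = 1 - t ∧ c1 t = t ∧ c2 t = 0 := by
  unfold c0 c1 c2
  rw [abs_of_nonpos (by linarith), abs_of_nonpos (by linarith), max_eq_right (by linarith), max_eq_left (by linarith),
    max_eq_right (by linarith), max_eq_left (by linarith)]
  exact ⟨by ring, by ring, rfl⟩

theorem cB {t : ℝ} (h0 : 1 ≤ t) (h : t ≤ 2) : c0 t = 0 ∧ c1 t = 2 - t ∧ c2 t = t - 1 := by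
  unfold c0 c1 c2
  rw [abs_of_nonneg (by linarith), abs_of_nonpos (by linarith), max_eq_left (by linarith), max_eq_left (by linarith),
    max_eq_right (by linarith), max_eq_right (by linarith)]
  exact ⟨by ring, by ring, by ring⟩

theorem cC {t : ℝ} (h0 : 2 ≤ t) (h : t ≤ 3) : c0 t = t - 2 ∧ c1 t = 0 ∧ c2 t = 3 - t := by
  unfold c0 c1 c2
  rw [abs_of_nonneg (by linarith), abs_of_nonneg (by linarith), max_eq_left (by linarith), max_eq_right (by linarith),
    max_eq_left (by linarith), max_eq_right (by linarith)]
  exact ⟨by ring, rfl, by ring⟩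

theorem c_eq {t : ℝ} (h0 : 0 ≤ t) (h3 : t ≤ 3) :
    (t ≤ 1 ∧ c0 t = 1 - t ∧ c1 t = t ∧ c2 t = 0) ∨ (1 ≤ t ∧ t ≤ 2 ∧ c0 t = 0 ∧ c1 t = 2 - t ∧ c2 t = t - 1) ∨
      (2 ≤ t ∧ c0 t = t - 2 ∧ c1 t = 0 ∧ c2 t = 3 - t) := by
  rcases le_total t 1 with h | h
  · exact Or.inl ⟨h, cA h0 h⟩
  · rcases le_total t 2 with h' | h'
    · exact Or.inr (Or.inl ⟨h, h', cB h h'⟩)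
    · exact Or.inr (Or.inr ⟨h', cC h' h3⟩)

noncomputable def Ps (o : E × E × E) (t s : ℝ) : E :=
  ((1 - s) * c0 t + s / 3) • o.1 + ((1 - s) * c1 t + s / 3) • o.2.1 + ((1 - s) * c2 t + s / 3) • o.2.2

theorem Ps_cont (o : E × E × E) {f g : ℝ → ℝ} (hf : Continuous f) (hg : Continuous g) : Continuous fun r => Ps o (f r) (g r) := by
  unfold Ps c0 c1 c2
  fun_prop

theorem Ps_wt {a b c : E} (hab : a ≠ b) (hac : a ≠ c) (hbc : b ≠ c) {t s : ℝ} (h0 : 0 ≤ t) (h3 : t ≤ 3) (s0 : 0 ≤ s) (s1 : s ≤ 1) :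
    ∃ w, Wt {a, b, c} w (Ps (a, b, c) t s) ∧ w a = (1 - s) * c0 t + s / 3 ∧ w b = (1 - s) * c1 t + s / 3 ∧
      w c = (1 - s) * c2 t + s / 3 := by
  have h := c_eq h0 h3
  have n0 : 0 ≤ c0 t := by rcases h with h | h | h <;> linarith
  have n1 : 0 ≤ c1 t := by rcases h with h | h | h <;> linarith
  have n2 : 0 ≤ c2 t := by rcases h with h | h | h <;> linarith
  have n3 : c0 t + c1 t + c2 t = 1 := by rcases h with h | h | h <;> linarith
  have s1' : 0 ≤ 1 - s := by linarith
  refine ⟨fun y => if y = a then (1 - s) * c0 t + s / 3 else if y = b then (1 - s) * c1 t + s / 3 else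
    if y = c then (1 - s) * c2 t + s / 3 else 0, ?_, by simp, by simp [hab.symm], by simp [hac.symm, hbc.symm]⟩
  rw [Wt3 hab hac hbc]
  refine ⟨fun y => ?_, fun y h1 h2 h3 => by simp [h1, h2, h3], ?_, ?_⟩
  · split_ifs <;> positivity
  · simp only [if_true, hab.symm, hac.symm, hbc.symm, if_false]; linear_combination (1 - s) * n3
  · simp only [if_true, hab.symm, hac.symm, hbc.symm, if_false]; rfl

theorem Ps_surj {a b c : E} (hab : a ≠ b) (hac : a ≠ c) (hbc : b ≠ c) {w x} (h : Wt {a, b, c} w x) :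
    ∃ t s : ℝ, 0 ≤ t ∧ t ≤ 3 ∧ 0 ≤ s ∧ s ≤ 1 ∧ Ps (a, b, c) t s = x := by
  rw [Wt3 hab hac hbc] at h
  obtain ⟨h0, -, h1, h2⟩ := h
  have ha := h0 a; have hb := h0 b; have hc := h0 c
  have fin : ∀ t s : ℝ, (1 - s) * c0 t + s / 3 = w a → (1 - s) * c1 t + s / 3 = w b → (1 - s) * c2 t + s / 3 = w c →
      Ps (a, b, c) t s = x := fun t s e1 e2 e3 => by
    unfold Ps; rw [e1, e2, e3, h2]
  obtain ⟨m, hm0, hma, hmb, hmc, hm⟩ : ∃ m, 0 ≤ m ∧ m ≤ w a ∧ m ≤ w b ∧ m ≤ w c ∧ (m = w a ∨ m = w b ∨ m = w c) := by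
    rcases le_total (w a) (w b) with h | h <;> rcases le_total (w a) (w c) with h' | h' <;>
      rcases le_total (w b) (w c) with h'' | h''
    all_goals first
      | exact ⟨w a, ha, le_rfl, by linarith, by linarith, Or.inl rfl⟩
      | exact ⟨w b, hb, by linarith, le_rfl, by linarith, Or.inr (Or.inl rfl)⟩
      | exact ⟨w c, hc, by linarith, by linarith, le_rfl, Or.inr (Or.inr rfl)⟩
  rcases (show 3 * m ≤ 1 by linarith).lt_or_eq with hlt | heq
  · have hd : (0 : ℝ) < 1 - 3 * m := by linarith
    have go : ∀ t, 0 ≤ t → t ≤ 3 → (1 - 3 * m) * c0 t = w a - m → (1 - 3 * m) * c1 t = w b - m →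
        (1 - 3 * m) * c2 t = w c - m → ∃ t s : ℝ, 0 ≤ t ∧ t ≤ 3 ∧ 0 ≤ s ∧ s ≤ 1 ∧ Ps (a, b, c) t s = x :=
      fun t t0 t3 e1 e2 e3 => ⟨t, 3 * m, t0, t3, by linarith, hlt.le, fin _ _ (by linarith) (by linarith) (by linarith)⟩
    have le1 : ∀ y, y ≤ 1 - 3 * m → y / (1 - 3 * m) ≤ 1 := fun y hy => (div_le_one hd).2 hy
    have ge0 : ∀ y, 0 ≤ y → 0 ≤ y / (1 - 3 * m) := fun y hy => div_nonneg hy hd.le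
    have mc : ∀ y, (1 - 3 * m) * (y / (1 - 3 * m)) = y := fun y => mul_div_cancel₀ y hd.ne'
    rcases hm with hm | hm | hm
    · have b0 := ge0 (w c - m) (by linarith)
      have b1 := le1 (w c - m) (by linarith)
      have b2 := mc (w c - m)
      obtain ⟨k1, k2, k3⟩ := cB (t := 1 + (w c - m) / (1 - 3 * m)) (by linarith) (by linarith)
      exact go (1 + (w c - m) / (1 - 3 * m)) (by linarith) (by linarith) (by rw [k1]; linarith) (by rw [k2]; linarith) (by rw [k3]; linarith)
    · have b0 := ge0 (w a - m) (by linarith)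
      have b1 := le1 (w a - m) (by linarith)
      have b2 := mc (w a - m)
      obtain ⟨k1, k2, k3⟩ := cC (t := 2 + (w a - m) / (1 - 3 * m)) (by linarith) (by linarith)
      exact go (2 + (w a - m) / (1 - 3 * m)) (by linarith) (by linarith) (by rw [k1]; linarith) (by rw [k2]; linarith) (by rw [k3]; linarith)
    · have b0 := ge0 (w b - m) (by linarith)
      have b1 := le1 (w b - m) (by linarith)
      have b2 := mc (w b - m)
      obtain ⟨k1, k2, k3⟩ := cA (t := 0 + (w b - m) / (1 - 3 * m)) (by linarith) (by linarith)
      exact go (0 + (w b - m) / (1 - 3 * m)) (by linarith) (by linarith) (by rw [k1]; linarith) (by rw [k2]; linarith) (by rw [k3]; linarith)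
  · refine ⟨0, 1, le_rfl, by norm_num, by norm_num, le_rfl, fin _ _ ?_ ?_ ?_⟩ <;> linarith

theorem Ps_inj {t s t' s' : ℝ} (h0 : 0 ≤ t) (h3 : t ≤ 3) (s0 : 0 ≤ s) (s1 : s ≤ 1) (h0' : 0 < t') (h3' : t' < 3) (s0' : 0 ≤ s') (s1' : s' < 1)
    (ea : (1 - s) * c0 t + s / 3 = (1 - s') * c0 t' + s' / 3) (eb : (1 - s) * c1 t + s / 3 = (1 - s') * c1 t' + s' / 3)
    (ec : (1 - s) * c2 t + s / 3 = (1 - s') * c2 t' + s' / 3) : t = t' ∧ s = s' := by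
  have h := c_eq h0 h3
  have h' := c_eq h0'.le h3'.le
  have pos : ∀ {t : ℝ}, 0 ≤ t → t ≤ 3 → 0 ≤ c0 t ∧ 0 ≤ c1 t ∧ 0 ≤ c2 t ∧ (c0 t = 0 ∨ c1 t = 0 ∨ c2 t = 0) := fun h0 h3 => by
    rcases c_eq h0 h3 with ⟨k, k1, k2, k3⟩ | ⟨k, k', k1, k2, k3⟩ | ⟨k, k1, k2, k3⟩
    · exact ⟨by linarith, by linarith, by linarith, Or.inr (Or.inr k3)⟩
    · exact ⟨by linarith, by linarith, by linarith, Or.inl k1⟩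
    · exact ⟨by linarith, by linarith, by linarith, Or.inr (Or.inl k2)⟩
  have key : ∀ {t s t' s' : ℝ}, 0 ≤ t → t ≤ 3 → s ≤ 1 → 0 ≤ t' → t' ≤ 3 → (1 - s) * c0 t + s / 3 = (1 - s') * c0 t' + s' / 3 →
      (1 - s) * c1 t + s / 3 = (1 - s') * c1 t' + s' / 3 → (1 - s) * c2 t + s / 3 = (1 - s') * c2 t' + s' / 3 → s ≤ s' := by
    intro t s t' s' h0 h3 s1 h0' h3' ea eb ec
    obtain ⟨p0, p1, p2, -⟩ := pos h0 h3
    have q0 := mul_nonneg (sub_nonneg.2 s1) p0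
    have q1 := mul_nonneg (sub_nonneg.2 s1) p1
    have q2 := mul_nonneg (sub_nonneg.2 s1) p2
    rcases (pos h0' h3').2.2.2 with e | e | e
    · rw [e] at ea; linarith
    · rw [e] at eb; linarith
    · rw [e] at ec; linarith
  have hs : s = s' := le_antisymm (key h0 h3 s1 h0'.le h3'.le ea eb ec) (key h0'.le h3'.le s1'.le h0 h3 ea.symm eb.symm ec.symm)
  subst hs
  have hn : (1 - s) ≠ 0 := by linarith
  have ea := mul_left_cancel₀ hn (add_right_cancel ea)
  have eb := mul_left_cancel₀ hn (add_right_cancel eb)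
  have ec := mul_left_cancel₀ hn (add_right_cancel ec)
  refine ⟨?_, rfl⟩
  rcases h with h | h | h <;> rcases h' with h' | h' | h' <;> linarith
end Psi
end PaperAlg

namespace PaperAlg
open Geometry Set
section Plc
variable {F : Type*} [NormedAddCommGroup F] [NormedSpace ℝ F] [DecidableEq F] {Lab : Type} [DecidableEq Lab]

theorem tri3 {P : Type*} [DecidableEq P] {u v w : P} (h : (tri (u, v, w)).card = 3) : u ≠ v ∧ u ≠ w ∧ v ≠ w := by
  have h2 : ∀ a b : P, ¬ 3 ≤ ({a, b} : Finset P).card := fun a b h => by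
    have := Finset.card_le_two (a := a) (b := b); omega
  simp only [tri] at h
  refine ⟨?_, ?_, ?_⟩ <;> rintro rfl
  · exact h2 u w (by rw [← h]; simp)
  · exact h2 u v (by rw [← h, Finset.pair_comm v u]; simp)
  · exact h2 u v (by rw [← h]; simp)

def qq (N : ℕ) (pts : Finset F → List Lab) (x : Finset F) (a : Lab × Bool) : ℕ :=
  if a.2 then (pts x).idxOf a.1 + 1 else N - ((pts x).idxOf a.1 + 1)

theorem qq_bd {N : ℕ} {pts : Finset F → List Lab} {x : Finset F} (hN : (pts x).length < N) {a : Lab × Bool} (ha : a.1 ∈ pts x) :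
    0 < qq N pts x a ∧ qq N pts x a < N := by
  have := List.idxOf_lt_length_of_mem ha
  unfold qq
  split_ifs <;> omega

theorem mem_EE {pts : Finset F → List Lab} {x : Finset F} {d : Bool} {a : Lab × Bool} : a ∈ E pts (x, d) ↔ a.1 ∈ pts x ∧ a.2 = d := by
  rcases a with ⟨a, b⟩
  unfold E
  cases d <;> cases b <;> simp

theorem E_sorted {N : ℕ} {pts : Finset F → List Lab} {x : Finset F} (hN : (pts x).length < N) (hn : (pts x).Nodup) (d : Bool) :
    (E pts (x, d)).Pairwise fun a b => qq N pts x a < qq N pts x b := by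
  have h : (pts x).Pairwise fun a b => (pts x).idxOf a < (pts x).idxOf b := by
    rw [List.pairwise_iff_getElem]
    intro i j hi hj hij
    rwa [hn.idxOf_getElem, hn.idxOf_getElem]
  unfold E
  cases d
  · simp only [Bool.false_eq_true, if_false, List.pairwise_map, List.pairwise_reverse]
    refine h.imp_of_mem fun {a b} ha hb hab => ?_
    have := List.idxOf_lt_length_of_mem hb
    simp only [qq, Bool.false_eq_true, if_false]; omega
  · simp only [if_true, List.pairwise_map]
    refine h.imp fun {a b} hab => ?_
    simp only [qq, if_true]; omega

theorem Ps_edge (o : F × F × F) {r : ℝ} (h0 : 0 ≤ r) (h1 : r ≤ 1) :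
    Ps o r 0 = (1 - r) • o.1 + r • o.2.1 ∧ Ps o (1 + r) 0 = (1 - r) • o.2.1 + r • o.2.2 ∧
      Ps o (2 + r) 0 = (1 - r) • o.2.2 + r • o.1 := by
  unfold Ps
  obtain ⟨a1, a2, a3⟩ := cA h0 h1
  obtain ⟨b1, b2, b3⟩ := cB (t := 1 + r) (by linarith) (by linarith)
  obtain ⟨d1, d2, d3⟩ := cC (t := 2 + r) (by linarith) (by linarith)
  rw [a1, a2, a3, b1, b2, b3, d1, d2, d3]
  refine ⟨?_, ?_, ?_⟩ <;> module

theorem place {lt : F → F → Bool} (hlt : IsLt lt) (l : List (F × F × F)) (h3 : ∀ o ∈ l, (tri o).card = 3)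
    {pts : Finset F → List Lab} (hn : ∀ x, (pts x).Nodup) (hu : ∀ x y a, a ∈ pts x → a ∈ pts y → x = y) :
    ∃ (N : ℕ) (pos : (F × F × F) → Lab × Bool → ℕ) (loc : Lab → ℝ → F), 0 < N ∧ ∀ o ∈ l,
      (Ew pts (bdw lt o)).Pairwise (fun a b => pos o a < pos o b) ∧
      ∀ a ∈ Ew pts (bdw lt o), 0 < pos o a ∧ pos o a < 3 * N ∧ pos o a ≠ N ∧ pos o a ≠ 2 * N ∧
        (∃ u ∈ tri o, ∃ v ∈ tri o, ∃ r : ℝ, u ≠ v ∧ a.1 ∈ pts {u, v} ∧ 0 < r ∧ r < 1 ∧ loc a.1 0 = (1 - r) • u + r • v) ∧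
        ∀ ε : ℝ, |ε| ≤ 1 → Ps o ((pos o a + ε) / N) 0 = loc a.1 (if a.2 then ε else -ε) := by
  classical
  let N := l.toFinset.sup (fun o => (Ew pts (bdw lt o)).length) + 1
  let loc : Lab → ℝ → F := fun a ε => if h : ∃ p : F × F, p.1 ≠ p.2 ∧ lt p.1 p.2 = true ∧ a ∈ pts {p.1, p.2} then
    (1 - ((pts {h.choose.1, h.choose.2}).idxOf a + 1 + ε) / N) • h.choose.1 +
      (((pts {h.choose.1, h.choose.2}).idxOf a + 1 + ε) / N) • h.choose.2 else 0
  have hloc : ∀ u v, u ≠ v → lt u v = true → ∀ a ∈ pts {u, v}, ∀ ε, loc a ε =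
      (1 - ((pts {u, v}).idxOf a + 1 + ε) / N) • u + (((pts {u, v}).idxOf a + 1 + ε) / N) • v := by
    intro u v huv hl a ha ε
    have h : ∃ p : F × F, p.1 ≠ p.2 ∧ lt p.1 p.2 = true ∧ a ∈ pts {p.1, p.2} := ⟨(u, v), huv, hl, ha⟩
    obtain ⟨e1, e2, e3⟩ := h.choose_spec
    have e4 : ({h.choose.1, h.choose.2} : Finset F) = {u, v} := hu _ _ a e3 ha
    have e5 : h.choose.1 = u ∧ h.choose.2 = v := by
      have k1 : h.choose.1 ∈ ({u, v} : Finset F) := e4 ▸ by simp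
      have k2 : h.choose.2 ∈ ({u, v} : Finset F) := e4 ▸ by simp
      simp only [Finset.mem_insert, Finset.mem_singleton] at k1 k2
      rcases k1 with k1 | k1 <;> rcases k2 with k2 | k2
      · exact absurd (k1.trans k2.symm) e1
      · exact ⟨k1, k2⟩
      · rw [k1, k2, hlt u v huv, hl] at e2; simp at e2
      · exact absurd (k1.trans k2.symm) e1
    simp only [loc, dif_pos h, e5.1, e5.2]
  have hN0 : (0 : ℝ) < N := by positivity
  have edge : ∀ u v, u ≠ v → (pts {u, v}).length < N → ∀ a ∈ E pts (sd lt u v), ∀ ε : ℝ, |ε| ≤ 1 →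
      0 ≤ (qq N pts {u, v} a + ε) / N ∧ (qq N pts {u, v} a + ε) / N ≤ 1 ∧
      (1 - (qq N pts {u, v} a + ε) / N) • u + ((qq N pts {u, v} a + ε) / N) • v = loc a.1 (if a.2 then ε else -ε) := by
    intro u v huv hlen a ha ε hε
    obtain ⟨m1, m2⟩ := mem_EE.1 ha
    have hb := qq_bd (N := N) hlen m1
    have b1 : (1 : ℝ) ≤ qq N pts {u, v} a := by exact_mod_cast hb.1
    have b2 : (qq N pts {u, v} a : ℝ) + 1 ≤ N := by exact_mod_cast hb.2
    rw [abs_le] at hε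
    refine ⟨div_nonneg (by linarith) hN0.le, (div_le_one hN0).2 (by linarith), ?_⟩
    cases hd : a.2
    · have hvu : lt v u = true := by rw [hlt u v huv, ← m2, hd]; rfl
      rw [if_neg (by simp), hloc v u huv.symm hvu a.1 (by rwa [Finset.pair_comm])]
      have : (qq N pts {u, v} a : ℝ) = N - ((pts {v, u}).idxOf a.1 + 1) := by
        have := List.idxOf_lt_length_of_mem m1
        rw [qq, hd, Finset.pair_comm]
        simp only [Bool.false_eq_true, if_false]
        rw [Finset.pair_comm] at this hlen
        rw [Nat.cast_sub (by omega)]; push_cast; rfl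
      rw [this]
      rw [add_comm]
      congr 1 <;> congr 1 <;> field_simp <;> ring
    · have huv' : lt u v = true := by rw [hd] at m2; exact m2.symm
      rw [if_pos rfl, hloc u v huv huv' a.1 m1]
      have : (qq N pts {u, v} a : ℝ) = (pts {u, v}).idxOf a.1 + 1 := by rw [qq, hd]; simp
      rw [this]
  let pos : (F × F × F) → Lab × Bool → ℕ := fun o a => if a.1 ∈ pts {o.1, o.2.1} then qq N pts {o.1, o.2.1} a else
    if a.1 ∈ pts {o.2.1, o.2.2} then N + qq N pts {o.2.1, o.2.2} a else 2 * N + qq N pts {o.2.2, o.1} a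
  refine ⟨N, pos, loc, Nat.succ_pos _, fun o ho => ?_⟩
  obtain ⟨u, v, w⟩ := o
  obtain ⟨huv, huw, hvw⟩ : u ≠ v ∧ u ≠ w ∧ v ≠ w := tri3 (h3 _ ho)
  have hlen : (Ew pts (bdw lt (u, v, w))).length < N :=
    Nat.lt_succ_of_le (Finset.le_sup (f := fun o => (Ew pts (bdw lt o)).length) (List.mem_toFinset.2 ho))
  have hE : Ew pts (bdw lt (u, v, w)) = E pts (sd lt u v) ++ (E pts (sd lt v w) ++ E pts (sd lt w u)) := by
    simp [Ew, bdw]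
  have hEl : ∀ x d, (E pts (x, d)).length = (pts x).length := fun x d => by unfold E; split_ifs <;> simp
  rw [hE] at hlen ⊢
  simp only [sd, List.length_append, hEl] at hlen
  have d1 : ∀ a, a ∈ pts {u, v} → a ∉ pts {v, w} := fun a h h' => by
    have := hu _ _ a h h'
    have : u ∈ ({v, w} : Finset F) := this ▸ by simp
    simp [huv, huw] at this
  have d2 : ∀ a, a ∈ pts {u, v} → a ∉ pts {w, u} := fun a h h' => by
    have := hu _ _ a h h'
    have : v ∈ ({w, u} : Finset F) := this ▸ by simp
    simp [huv.symm, hvw] at this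
  have d3 : ∀ a, a ∈ pts {v, w} → a ∉ pts {w, u} := fun a h h' => by
    have := hu _ _ a h h'
    have : v ∈ ({w, u} : Finset F) := this ▸ by simp
    simp [huv.symm, hvw] at this
  have p1 : ∀ a ∈ E pts (sd lt u v), pos (u, v, w) a = qq N pts {u, v} a ∧ 0 < qq N pts {u, v} a ∧ qq N pts {u, v} a < N := fun a ha => by
    have h := (mem_EE.1 ha).1
    exact ⟨by simp [pos, h], qq_bd (by omega) h⟩
  have p2 : ∀ a ∈ E pts (sd lt v w), pos (u, v, w) a = N + qq N pts {v, w} a ∧ 0 < qq N pts {v, w} a ∧ qq N pts {v, w} a < N := fun a ha => by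
    have h := (mem_EE.1 ha).1
    have h' : a.1 ∉ pts {u, v} := fun h' => d1 _ h' h
    exact ⟨by simp [pos, h, h'], qq_bd (by omega) h⟩
  have p3 : ∀ a ∈ E pts (sd lt w u), pos (u, v, w) a = 2 * N + qq N pts {w, u} a ∧ 0 < qq N pts {w, u} a ∧ qq N pts {w, u} a < N := fun a ha => by
    have h := (mem_EE.1 ha).1
    have h' : a.1 ∉ pts {u, v} := fun h' => d2 _ h' h
    have h'' : a.1 ∉ pts {v, w} := fun h' => d3 _ h' h
    exact ⟨by simp [pos, h'', h'], qq_bd (by omega) h⟩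
  have fr : ∀ u' v', u' ∈ tri (u, v, w) → v' ∈ tri (u, v, w) → u' ≠ v' → (pts {u', v'}).length < N → ∀ a ∈ E pts (sd lt u' v'),
      ∃ x ∈ tri (u, v, w), ∃ y ∈ tri (u, v, w), ∃ r : ℝ, x ≠ y ∧ a.1 ∈ pts {x, y} ∧ 0 < r ∧ r < 1 ∧ loc a.1 0 = (1 - r) • x + r • y := by
    intro u' v' h1 h2 hne hlen a ha
    have h := (edge u' v' hne hlen a ha 0 (by simp)).2.2
    have m := (mem_EE.1 ha).1
    have hb := qq_bd (N := N) hlen m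
    refine ⟨u', h1, v', h2, _, hne, m, ?_, ?_, by simpa using h.symm⟩
    · exact div_pos (by exact_mod_cast hb.1) hN0
    · rw [div_lt_one hN0]; exact_mod_cast hb.2
  constructor
  · rw [List.pairwise_append, List.pairwise_append]
    refine ⟨(E_sorted (N := N) (by omega) (hn _) _).imp_of_mem fun ha hb h => ?_,
      ⟨(E_sorted (N := N) (by omega) (hn _) _).imp_of_mem fun ha hb h => ?_,
        (E_sorted (N := N) (by omega) (hn _) _).imp_of_mem fun ha hb h => ?_, fun a ha b hb => ?_⟩, fun a ha b hb => ?_⟩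
    · rw [(p1 _ ha).1, (p1 _ hb).1]; exact h
    · rw [(p2 _ ha).1, (p2 _ hb).1]; omega
    · rw [(p3 _ ha).1, (p3 _ hb).1]; omega
    · have := p2 a ha; have := p3 b hb; omega
    · have := p1 a ha
      rcases List.mem_append.1 hb with hb | hb
      · have := p2 b hb; omega
      · have := p3 b hb; omega
  · intro a ha
    simp only [List.mem_append] at ha
    have hN1 : (N : ℝ) ≠ 0 := hN0.ne'
    rcases ha with ha | ha | ha
    · obtain ⟨e, e1, e2⟩ := p1 a ha
      refine ⟨by omega, by omega, by omega, by omega, ?_, fun ε hε => ?_⟩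
      · exact fr u v (by simp [tri]) (by simp [tri]) huv (by omega) a ha
      obtain ⟨k1, k2, k3⟩ := edge u v huv (by omega) a ha ε hε
      rw [e, ← k3, (Ps_edge (u, v, w) k1 k2).1]
    · obtain ⟨e, e1, e2⟩ := p2 a ha
      refine ⟨by omega, by omega, by omega, by omega, ?_, fun ε hε => ?_⟩
      · exact fr v w (by simp [tri]) (by simp [tri]) hvw (by omega) a ha
      obtain ⟨k1, k2, k3⟩ := edge v w hvw (by omega) a ha ε hε
      rw [e, ← k3, ← (Ps_edge (u, v, w) k1 k2).2.1]
      congr 1; push_cast; field_simp; ring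
    · obtain ⟨e, e1, e2⟩ := p3 a ha
      refine ⟨by omega, by omega, by omega, by omega, ?_, fun ε hε => ?_⟩
      · exact fr w u (by simp [tri]) (by simp [tri]) huw.symm (by omega) a ha
      obtain ⟨k1, k2, k3⟩ := edge w u huw.symm (by omega) a ha ε hε
      rw [e, ← k3, ← (Ps_edge (u, v, w) k1 k2).2.2]
      congr 1; push_cast; field_simp; ring

theorem bdw_cnt {lt : F → F → Bool} {T : Finset (Finset F)} {l : List (F × F × F)} (hnd : (l.map tri).Nodup)
    (hl : ∀ t, t ∈ l.map tri ↔ t ∈ T) (h3 : ∀ o ∈ l, (tri o).card = 3)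
    {pts : Finset F → List Lab} (hn : ∀ x, (pts x).Nodup) (hu : ∀ x y a, a ∈ pts x → a ∈ pts y → x = y)
    {e : Finset F} (he : e.card = 2) {a : Lab} (ha : a ∈ pts e) :
    ((l.flatMap fun o => Ew pts (bdw lt o)).map Prod.fst).count a = (T.filter (e ⊆ ·)).card := by
  have hE : ∀ x d, ((E pts (x, d)).map Prod.fst).count a = if x = e then 1 else 0 := fun x d => by
    have : (E pts (x, d)).map Prod.fst = if d then pts x else (pts x).reverse := by
      unfold E; cases d <;> simp [Function.comp_def]
    have h2 : ((E pts (x, d)).map Prod.fst).count a = (pts x).count a := by rw [this]; split_ifs <;> simp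
    rw [h2]
    split_ifs with h
    · subst h; exact List.count_eq_one_of_mem (hn x) ha
    · exact List.count_eq_zero.2 fun h' => h (hu _ _ a h' ha)
  have ho : ∀ o ∈ l, ((Ew pts (bdw lt o)).map Prod.fst).count a = if e ⊆ tri o then 1 else 0 := by
    rintro ⟨u, v, w⟩ ho
    obtain ⟨huv, huw, hvw⟩ : u ≠ v ∧ u ≠ w ∧ v ≠ w := tri3 (h3 _ ho)
    have := pair_ite huv huw hvw he (1 : ℕ)
    rw [tri, this]
    simp only [Ew, bdw, sd, List.flatMap_cons, List.flatMap_nil, List.append_nil, List.map_append, List.count_append, hE,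
      Finset.pair_comm w u, Finset.pair_comm w v]
    ring
  have : T = (l.map tri).toFinset := by ext t; rw [List.mem_toFinset, hl]
  rw [Finset.card_filter, this, List.sum_toFinset _ hnd, List.map_flatMap, List.count_flatMap, List.map_map]
  exact congrArg List.sum (List.map_congr_left ho)

theorem mem_W {lt : F → F → Bool} {o : F × F × F} (h3 : (tri o).card = 3) {pts : Finset F → List Lab} {e : Finset F} (he : e.card = 2)
    (heo : e ⊆ tri o) {a : Lab} (ha : a ∈ pts e) : ∃ d, (a, d) ∈ Ew pts (bdw lt o) := by
  obtain ⟨u, v, w⟩ := o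
  obtain ⟨huv, huw, hvw⟩ := tri3 h3
  have key : ∀ u' v', e = {u', v'} → sd lt u' v' ∈ bdw lt (u, v, w) → ∃ d, (a, d) ∈ Ew pts (bdw lt (u, v, w)) := fun u' v' h1 h2 =>
    ⟨lt u' v', List.mem_flatMap.2 ⟨_, h2, mem_EE.2 ⟨h1 ▸ ha, rfl⟩⟩⟩
  rcases (pair_sub huv huw hvw he).1 heo with h1 | h1 | h1
  · exact key u v h1.symm (by simp [bdw])
  · exact key w u (by rw [← h1, Finset.pair_comm]) (by simp [bdw])
  · exact key v w (by rw [← h1, Finset.pair_comm]) (by simp [bdw])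
end Plc
end PaperAlg

namespace PaperAlg
open Geometry Set
section Arrs
variable {F : Type*} [NormedAddCommGroup F] [NormedSpace ℝ F] [DecidableEq F] {Lab : Type}

def tent (p q t : ℝ) : ℝ := min (t - p) (q - t)

theorem tent_ne {p q p' q' : ℕ} {δ t : ℝ} (hδ : |δ| < 1) (h : Nst p q p' q' ∨ (δ ≠ 0 ∧ p = p' ∧ q = q'))
    (h1 : p - δ ≤ t) (h2 : t ≤ q + δ) (h3 : p' ≤ t) (h4 : t ≤ q') : tent (p - δ) (q + δ) t ≠ tent p' q' t := by
  rw [abs_lt] at hδ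
  have c : ∀ {a b : ℕ}, a < b → (a : ℝ) + 1 ≤ b := fun h => by exact_mod_cast h
  unfold tent
  rcases h with (h | h | ⟨h, h'⟩ | ⟨h, h'⟩) | ⟨h, rfl, rfl⟩
  · have := c h; linarith
  · have := c h; linarith
  · have := c h; have := c h'
    apply ne_of_gt
    rw [lt_min_iff, min_lt_iff, min_lt_iff]
    rcases le_total (t - p') (q' - t) with k | k
    · exact ⟨Or.inl (by linarith), Or.inl (by linarith)⟩
    · exact ⟨Or.inr (by linarith), Or.inr (by linarith)⟩
  · have := c h; have := c h'
    apply ne_of_lt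
    rw [lt_min_iff, min_lt_iff, min_lt_iff]
    rcases le_total (t - (p - δ)) (q + δ - t) with k | k
    · exact ⟨Or.inl (by linarith), Or.inl (by linarith)⟩
    · exact ⟨Or.inr (by linarith), Or.inr (by linarith)⟩
  · have : min (t - (p - δ)) (q + δ - t) = min (t - p) (q - t) + δ := by
      rw [← min_add_add_right]; congr 1 <;> ring
    rw [this]; intro h'; exact h (by linarith)

noncomputable def Q (N : ℕ) (o : F × F × F) (t s : ℝ) : F := Ps o (t / N) (s / (3 * N))

def arc (N : ℕ) (pos : (F × F × F) → Lab × Bool → ℕ) (o : F × F × F) (x : (Lab × Bool) × (Lab × Bool)) : Set F :=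
  (fun t => Q N o t (tent (pos o x.1) (pos o x.2) t)) '' Icc (pos o x.1 : ℝ) (pos o x.2)

structure Arr (T : Finset (Finset F)) (l : List (F × F × F)) (N : ℕ) (W : (F × F × F) → List (Lab × Bool))
    (pos : (F × F × F) → Lab × Bool → ℕ) (loc : Lab → ℝ → F) (L : (F × F × F) → List ((Lab × Bool) × (Lab × Bool))) : Prop where
  N0 : 0 < N
  tm : ∀ o ∈ l, tri o ∈ T
  ti : ∀ o ∈ l, ∀ o' ∈ l, tri o = tri o' → o = o'
  ts : ∀ t ∈ T, ∃ o ∈ l, tri o = t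
  bd : ∀ o ∈ l, ∀ a ∈ W o, 0 < pos o a ∧ pos o a < 3 * N ∧ pos o a ≠ N ∧ pos o a ≠ 2 * N
  hloc : ∀ o ∈ l, ∀ a ∈ W o, ∀ ε : ℝ, |ε| ≤ 1 → Ps o ((pos o a + ε) / N) 0 = loc a.1 (if a.2 then ε else -ε)
  inj : ∀ o ∈ l, ∀ a ∈ W o, ∀ b ∈ W o, pos o a = pos o b → a = b
  cr : ∀ o ∈ l, ∀ o' ∈ l, ∀ a ∈ W o', loc a.1 0 ∈ convexHull ℝ (tri o : Set F) → ∃ d, (a.1, d) ∈ W o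
  LW : ∀ o ∈ l, ∀ x ∈ L o, x.1 ∈ W o ∧ x.2 ∈ W o ∧ pos o x.1 < pos o x.2
  WL : ∀ o ∈ l, ∀ a ∈ W o, ∃ x ∈ L o, a = x.1 ∨ a = x.2
  ns : ∀ o ∈ l, ∀ x ∈ L o, ∀ y ∈ L o, x = y ∨ Nst (pos o x.1) (pos o x.2) (pos o y.1) (pos o y.2)
  os : ∀ v : Lab → Bool → Bool, (∀ o ∈ l, ∀ x ∈ L o, v x.1.1 x.1.2 = v x.2.1 (!x.2.2) ∧ v x.1.1 (!x.1.2) = v x.2.1 x.2.2) →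
    ∀ o ∈ l, ∀ a ∈ W o, v a.1 true = v a.1 false

variable {M : Set F} {T : Finset (Finset F)} {l : List (F × F × F)} {N : ℕ} {W : (F × F × F) → List (Lab × Bool)}
  {pos : (F × F × F) → Lab × Bool → ℕ} {loc : Lab → ℝ → F} {L : (F × F × F) → List ((Lab × Bool) × (Lab × Bool))}

def CC (l : List (F × F × F)) (N : ℕ) (pos : (F × F × F) → Lab × Bool → ℕ) (L : (F × F × F) → List ((Lab × Bool) × (Lab × Bool))) : Set F :=
  {P | ∃ o ∈ l, ∃ x ∈ L o, P ∈ arc N pos o x}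

def Box (N : ℕ) (t s : ℝ) : Prop := 0 ≤ t ∧ t ≤ 3 * N ∧ 0 ≤ s ∧ s ≤ 3 * N

theorem Box.div {t s : ℝ} (hN : 0 < N) (h : Box N t s) : 0 ≤ t / N ∧ t / N ≤ 3 ∧ 0 ≤ s / (3 * N) ∧ s / (3 * N) ≤ 1 := by
  obtain ⟨h1, h2, h3, h4⟩ := h
  have : (0 : ℝ) < N := by exact_mod_cast hN
  exact ⟨by positivity, (div_le_iff₀ this).2 h2, by positivity, (div_le_one (by positivity)).2 h4⟩

theorem Q_wt (hN : 0 < N) {o : F × F × F} (h3 : (tri o).card = 3) {t s : ℝ} (h : Box N t s) :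
    ∃ w, Wt (tri o) w (Q N o t s) ∧ ∀ y ∈ tri o, s / (3 * N) / 3 ≤ w y := by
  obtain ⟨u, v, w⟩ := o
  obtain ⟨huv, huw, hvw⟩ := tri3 h3
  obtain ⟨b1, b2, b3, b4⟩ := h.div hN
  obtain ⟨f, h1, e1, e2, e3⟩ := Ps_wt huv huw hvw b1 b2 b3 b4
  refine ⟨f, h1, fun y hy => ?_⟩
  have h := c_eq b1 b2
  have n0 : 0 ≤ c0 (t / N) := by rcases h with h | h | h <;> linarith
  have n1 : 0 ≤ c1 (t / N) := by rcases h with h | h | h <;> linarith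
  have n2 : 0 ≤ c2 (t / N) := by rcases h with h | h | h <;> linarith
  have p : 0 ≤ 1 - s / (3 * N) := by linarith
  have := mul_nonneg p n0; have := mul_nonneg p n1; have := mul_nonneg p n2
  simp only [tri, Finset.mem_insert, Finset.mem_singleton] at hy
  rcases hy with rfl | rfl | rfl <;> linarith

theorem Q_hull (hN : 0 < N) {o : F × F × F} (h3 : (tri o).card = 3) {t s : ℝ} (h : Box N t s) :
    Q N o t s ∈ convexHull ℝ (tri o : Set F) := by
  obtain ⟨w, h, -⟩ := Q_wt hN h3 h
  exact mem_hull.2 ⟨w, h⟩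

theorem Q_eq (H : Tri M T) (hN : 0 < N) {o : F × F × F} (ho : tri o ∈ T) {t s t' s' : ℝ} (h : Box N t s) (h' : Box N t' s')
    (h1 : 0 < t') (h2 : t' < 3 * N) (h4 : s' < 3 * N) (e : Q N o t s = Q N o t' s') : t = t' ∧ s = s' := by
  obtain ⟨u, v, w⟩ := o
  obtain ⟨huv, huw, hvw⟩ := tri3 (H.c3 _ ho)
  have hN0 : (0 : ℝ) < N := by exact_mod_cast hN
  obtain ⟨b1, b2, b3, b4⟩ := h.div hN
  obtain ⟨b1', b2', b3', b4'⟩ := h'.div hN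
  obtain ⟨f, hf, e1, e2, e3⟩ := Ps_wt huv huw hvw b1 b2 b3 b4
  obtain ⟨f', hf', e1', e2', e3'⟩ := Ps_wt huv huw hvw b1' b2' b3' b4'
  unfold Q at e
  rw [e] at hf
  obtain rfl := H.uw _ ho _ ho _ _ _ hf hf'
  obtain ⟨k1, k2⟩ := Ps_inj b1 b2 b3 b4 (div_pos h1 hN0) ((div_lt_iff₀ hN0).2 h2) b3' ((div_lt_one (by positivity)).2 h4)
    (e1.symm.trans e1') (e2.symm.trans e2') (e3.symm.trans e3')
  constructor
  · field_simp at k1; exact k1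
  · field_simp at k2; exact k2

theorem Q_cross (H : Tri M T) (hN : 0 < N) {o o' : F × F × F} (ho : tri o ∈ T) (ho' : tri o' ∈ T) (hne : tri o ≠ tri o')
    {t s : ℝ} (h : Box N t s) (e : Q N o t s ∈ convexHull ℝ (tri o' : Set F)) : s = 0 := by
  obtain ⟨w, h1, h2⟩ := Q_wt hN (H.c3 _ ho) h
  obtain ⟨y, hy, hy'⟩ : ∃ y ∈ tri o, y ∉ tri o' := by
    by_contra! hc
    exact hne (Finset.eq_of_subset_of_card_le hc (by rw [H.c3 _ ho, H.c3 _ ho']))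
  have h3 := (H.wt_inter ho ho' h1 e).2.1 y (by simp [hy'])
  have h4 := h2 y hy
  have hN0 : (0 : ℝ) < N := by exact_mod_cast hN
  rw [h3] at h4
  by_contra hs
  have : 0 < s := lt_of_le_of_ne h.2.2.1 (Ne.symm hs)
  have : 0 < s / (3 * N) / 3 := by positivity
  linarith

theorem tent_box (A : Arr T l N W pos loc L) {o} (ho : o ∈ l) {x} (hx : x ∈ L o) {t : ℝ} (h1 : pos o x.1 ≤ t) (h2 : t ≤ pos o x.2) :
    Box N t (tent (pos o x.1) (pos o x.2) t) ∧ 0 < t ∧ t < 3 * N ∧ tent (pos o x.1) (pos o x.2) t < 3 * N := by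
  obtain ⟨a1, a2, a3⟩ := A.LW o ho x hx
  have k1 : (0 : ℝ) < pos o x.1 := by exact_mod_cast (A.bd o ho _ a1).1
  have k2 : (pos o x.2 : ℝ) < 3 * N := by exact_mod_cast (A.bd o ho _ a2).2.1
  have k3 : tent (pos o x.1) (pos o x.2) t < 3 * N := lt_of_le_of_lt (min_le_left _ _) (by linarith)
  exact ⟨⟨by linarith, by linarith, le_min (by linarith) (by linarith), k3.le⟩, by linarith, by linarith, k3⟩

theorem Q_loc (A : Arr T l N W pos loc L) {o} (ho : o ∈ l) {a} (ha : a ∈ W o) {ε : ℝ} (hε : |ε| ≤ 1) :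
    Q N o (pos o a + ε) 0 = loc a.1 (if a.2 then ε else -ε) := by
  rw [Q, zero_div]; exact A.hloc o ho a ha ε hε

theorem Q_loc0 (A : Arr T l N W pos loc L) {o} (ho : o ∈ l) {a} (ha : a ∈ W o) : Q N o (pos o a) 0 = loc a.1 0 := by
  have := Q_loc A ho ha (ε := 0) (by simp)
  simpa using this

theorem tent_zero (A : Arr T l N W pos loc L) {o} (ho : o ∈ l) {x} (hx : x ∈ L o) {t : ℝ}
    (h0 : tent (pos o x.1) (pos o x.2) t = 0) : ∃ a ∈ W o, (a = x.1 ∨ a = x.2) ∧ t = pos o a := by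
  obtain ⟨a1, a2, a3⟩ := A.LW o ho x hx
  unfold tent at h0
  rcases min_choice (t - pos o x.1) (pos o x.2 - t) with h | h
  · exact ⟨_, a1, Or.inl rfl, by linarith⟩
  · exact ⟨_, a2, Or.inr rfl, by linarith⟩

theorem pos_box (A : Arr T l N W pos loc L) {o} (ho : o ∈ l) {a} (ha : a ∈ W o) :
    Box N (pos o a) 0 ∧ (0 : ℝ) < pos o a ∧ (pos o a : ℝ) < 3 * N ∧ (0 : ℝ) < 3 * N := by
  have k1 : (0 : ℝ) < pos o a := by exact_mod_cast (A.bd o ho _ ha).1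
  have k2 : (pos o a : ℝ) < 3 * N := by exact_mod_cast (A.bd o ho _ ha).2.1
  exact ⟨⟨k1.le, k2.le, le_rfl, by linarith⟩, k1, k2, by linarith⟩

theorem end_tent (A : Arr T l N W pos loc L) {o} (ho : o ∈ l) {a} (ha : a ∈ W o) :
    ∃ x ∈ L o, pos o x.1 ≤ (pos o a : ℝ) ∧ (pos o a : ℝ) ≤ pos o x.2 ∧ 0 = tent (pos o x.1) (pos o x.2) (pos o a) := by
  obtain ⟨x, hx, h⟩ := A.WL o ho a ha
  have : (pos o x.1 : ℝ) ≤ pos o x.2 := by exact_mod_cast (A.LW o ho x hx).2.2.le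
  refine ⟨x, hx, ?_⟩
  unfold tent
  rcases h with rfl | rfl
  · exact ⟨le_rfl, this, by rw [sub_self, min_eq_left (by linarith)]⟩
  · exact ⟨this, le_rfl, by rw [sub_self, min_eq_right (by linarith)]⟩

theorem memC (H : Tri M T) (A : Arr T l N W pos loc L) {o} (ho : o ∈ l) {t s : ℝ} (hb : Box N t s) (h : Q N o t s ∈ CC l N pos L) :
    ∃ x ∈ L o, pos o x.1 ≤ t ∧ t ≤ pos o x.2 ∧ s = tent (pos o x.1) (pos o x.2) t := by
  obtain ⟨o', ho', x, hx, t', ⟨h1, h2⟩, e⟩ := h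
  obtain ⟨b, b1, b2, b3⟩ := tent_box A ho' hx h1 h2
  by_cases hoo : o = o'
  · subst hoo
    obtain ⟨rfl, rfl⟩ := Q_eq H A.N0 (A.tm o ho) hb b b1 b2 b3 e.symm
    exact ⟨x, hx, h1, h2, rfl⟩
  · have hne : tri o ≠ tri o' := fun h => hoo (A.ti o ho o' ho' h)
    dsimp only at e
    have s0 : s = 0 := Q_cross H A.N0 (A.tm o ho) (A.tm o' ho') hne hb (e ▸ Q_hull A.N0 (H.c3 _ (A.tm o' ho')) b)
    have s0' := Q_cross H A.N0 (A.tm o' ho') (A.tm o ho) hne.symm b (e ▸ Q_hull A.N0 (H.c3 _ (A.tm o ho)) hb)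
    obtain ⟨a, ha, -, rfl⟩ := tent_zero A ho' hx s0'
    rw [s0', Q_loc0 A ho' ha] at e
    obtain ⟨d, hd⟩ := A.cr o ho o' ho' a ha (e ▸ Q_hull A.N0 (H.c3 _ (A.tm o ho)) hb)
    have e' := Q_loc0 A ho hd
    obtain ⟨p0, p1, p2, p3⟩ := pos_box A ho hd
    obtain ⟨rfl, -⟩ := Q_eq H A.N0 (A.tm o ho) hb p0 p1 p2 p3 (e.symm.trans e'.symm)
    rw [s0]
    exact end_tent A ho hd

theorem arc_pair (H : Tri M T) (A : Arr T l N W pos loc L) {o o'} (ho : o ∈ l) (ho' : o' ∈ l) {x y} (hx : x ∈ L o) (hy : y ∈ L o')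
    (hne : o ≠ o' ∨ (o = o' ∧ Nst (pos o x.1) (pos o x.2) (pos o y.1) (pos o y.2))) {P : F} (hP : P ∈ arc N pos o x)
    (hP' : P ∈ arc N pos o' y) : ∃ v, loc v 0 = P ∧ (v = x.1.1 ∨ v = x.2.1) ∧ (v = y.1.1 ∨ v = y.2.1) := by
  obtain ⟨t, ⟨h1, h2⟩, e⟩ := hP
  obtain ⟨t', ⟨h1', h2'⟩, e'⟩ := hP'
  obtain ⟨b, b1, b2, b3⟩ := tent_box A ho hx h1 h2
  obtain ⟨b', b1', b2', b3'⟩ := tent_box A ho' hy h1' h2'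
  dsimp only at e e'
  rcases hne with hne | ⟨rfl, hN⟩
  · have hne : tri o ≠ tri o' := fun h => hne (A.ti o ho o' ho' h)
    have m := Q_hull A.N0 (H.c3 _ (A.tm o ho)) b
    have m' := Q_hull A.N0 (H.c3 _ (A.tm o' ho')) b'
    have s0 := Q_cross H A.N0 (A.tm o ho) (A.tm o' ho') hne b (by rw [e, ← e']; exact m')
    have s0' := Q_cross H A.N0 (A.tm o' ho') (A.tm o ho) hne.symm b' (by rw [e', ← e]; exact m)
    obtain ⟨a, ha, hax, rfl⟩ := tent_zero A ho hx s0
    obtain ⟨a', ha', hay, rfl⟩ := tent_zero A ho' hy s0'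
    rw [s0', Q_loc0 A ho' ha'] at e'
    rw [s0, Q_loc0 A ho ha] at e
    obtain ⟨p0, p1, p2, p3⟩ := pos_box A ho' ha'
    obtain ⟨d, hd⟩ := A.cr o' ho' o ho a ha (by rw [e, ← e', ← Q_loc0 A ho' ha']; exact Q_hull A.N0 (H.c3 _ (A.tm o' ho')) p0)
    obtain ⟨k, -⟩ := Q_eq H A.N0 (A.tm o' ho') (pos_box A ho' hd).1 p0 p1 p2 p3
      ((Q_loc0 A ho' hd).trans ((e.trans e'.symm).trans (Q_loc0 A ho' ha').symm))
    have k' := A.inj o' ho' _ hd _ ha' (by exact_mod_cast k)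
    refine ⟨a.1, e, hax.imp (congrArg Prod.fst) (congrArg Prod.fst), ?_⟩
    have k2 : a.1 = a'.1 := by rw [← k']
    rw [k2]
    exact hay.imp (congrArg Prod.fst) (congrArg Prod.fst)
  · obtain ⟨rfl, hs⟩ := Q_eq H A.N0 (A.tm o ho) b b' b1' b2' b3' (e.trans e'.symm)
    have := tent_ne (δ := 0) (t := t) (by simp) (Or.inl hN) (by simpa using h1) (by simpa using h2) h1' h2'
    simp only [sub_zero, add_zero] at this
    exact absurd hs this

theorem arc_arc (H : Tri M T) (A : Arr T l N W pos loc L) {o} (ho : o ∈ l) {x} (hx : x ∈ L o) :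
    Arc (arc N pos o x) (loc x.1.1 0) (loc x.2.1 0) := by
  obtain ⟨a1, a2, a3⟩ := A.LW o ho x hx
  have a3' : (pos o x.1 : ℝ) < pos o x.2 := by exact_mod_cast a3
  refine ⟨_, _, _, a3', Continuous.continuousOn ?_, fun t ht t' ht' e => ?_, ?_, ?_, rfl⟩
  · exact Ps_cont o (by fun_prop) (by unfold tent; fun_prop)
  · obtain ⟨b, -⟩ := tent_box A ho hx ht.1 ht.2
    obtain ⟨b', b1', b2', b3'⟩ := tent_box A ho hx ht'.1 ht'.2
    exact (Q_eq H A.N0 (A.tm o ho) b b' b1' b2' b3' e).1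
  · rw [← Q_loc0 A ho a1, tent, sub_self, min_eq_left (by linarith)]
  · rw [← Q_loc0 A ho a2, tent, sub_self, min_eq_right (by linarith)]
end Arrs
end PaperAlg

namespace PaperAlg
open Geometry Set
section Arrs
variable {F : Type*} [NormedAddCommGroup F] [NormedSpace ℝ F] [DecidableEq F] {Lab : Type}
variable {M : Set F} {T : Finset (Finset F)} {l : List (F × F × F)} {N : ℕ} {W : (F × F × F) → List (Lab × Bool)}
  {pos : (F × F × F) → Lab × Bool → ℕ} {loc : Lab → ℝ → F} {L : (F × F × F) → List ((Lab × Bool) × (Lab × Bool))}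

def Off (pos : (F × F × F) → Lab × Bool → ℕ) (L : (F × F × F) → List ((Lab × Bool) × (Lab × Bool))) (o : F × F × F) (t s : ℝ) : Prop :=
  ∀ x ∈ L o, pos o x.1 ≤ t → t ≤ pos o x.2 → s ≠ tent (pos o x.1) (pos o x.2) t

theorem along (H : Tri M T) (A : Arr T l N W pos loc L) {f : F → Bool} (hf : ContinuousOn f (M \ CC l N pos L)) {o} (ho : o ∈ l)
    {g h : ℝ → ℝ} (hg : Continuous g) (hh : Continuous h) {a b : ℝ} (hab : a ≤ b)
    (hr : ∀ r, a ≤ r → r ≤ b → Box N (g r) (h r) ∧ Off pos L o (g r) (h r)) : f (Q N o (g a) (h a)) = f (Q N o (g b) (h b)) := by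
  have hc : Continuous fun r => Q N o (g r) (h r) := Ps_cont o (by fun_prop) (by fun_prop)
  have hm : MapsTo (fun r => Q N o (g r) (h r)) (Icc a b) (M \ CC l N pos L) := fun r hr' => by
    obtain ⟨h1, h2⟩ := hr r hr'.1 hr'.2
    refine ⟨(H.cov _).2 ⟨_, A.tm o ho, Q_hull A.N0 (H.c3 _ (A.tm o ho)) h1⟩, fun hC => ?_⟩
    obtain ⟨x, hx, k1, k2, k3⟩ := memC H A ho h1 hC
    exact h2 x hx k1 k2 k3
  exact isPreconnected_Icc.constant (hf.comp hc.continuousOn hm) (left_mem_Icc.2 hab) (right_mem_Icc.2 hab)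

theorem virt (A : Arr T l N W pos loc L) {o} (ho : o ∈ l) {x} (hx : x ∈ L o) {δ : ℝ} (hδ : |δ| ≤ 1 / 2) (h0 : δ ≠ 0) {t : ℝ}
    (h1 : pos o x.1 - δ ≤ t) (h2 : t ≤ pos o x.2 + δ) :
    Box N t (tent (pos o x.1 - δ) (pos o x.2 + δ) t) ∧ Off pos L o t (tent (pos o x.1 - δ) (pos o x.2 + δ) t) := by
  obtain ⟨a1, a2, a3⟩ := A.LW o ho x hx
  have c : ∀ {a b : ℕ}, a < b → (a : ℝ) + 1 ≤ b := fun h => by exact_mod_cast h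
  have k1 := c (A.bd o ho _ a1).1
  have k2 := c (A.bd o ho _ a2).2.1
  have hδ' := abs_le.1 hδ
  push_cast at k1 k2
  refine ⟨⟨by linarith, by linarith, le_min (by linarith) (by linarith), (min_le_left _ _).trans (by linarith)⟩, fun y hy h3 h4 => ?_⟩
  refine tent_ne (by linarith) ?_ h1 h2 h3 h4
  rcases A.ns o ho x hx y hy with rfl | h
  · exact Or.inr ⟨h0, rfl, rfl⟩
  · exact Or.inl h

theorem virt_along (H : Tri M T) (A : Arr T l N W pos loc L) {f : F → Bool} (hf : ContinuousOn f (M \ CC l N pos L)) {o} (ho : o ∈ l)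
    {x} (hx : x ∈ L o) {δ : ℝ} (hδ : |δ| ≤ 1 / 2) (h0 : δ ≠ 0) {t : ℝ} (h1 : pos o x.1 - δ ≤ t) (h2 : t ≤ pos o x.2 + δ) :
    f (Q N o (pos o x.1 - δ) 0) = f (Q N o t (tent (pos o x.1 - δ) (pos o x.2 + δ) t)) := by
  have h := along H A hf ho (g := fun t => t) (h := tent (pos o x.1 - δ) (pos o x.2 + δ)) (by fun_prop) (by unfold tent; fun_prop) h1
    fun r r1 r2 => virt A ho hx hδ h0 r1 (r2.trans h2)
  rw [← h]
  simp only [tent, sub_self]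
  rw [min_eq_left (by linarith)]

theorem base_step (H : Tri M T) (A : Arr T l N W pos loc L) {f : F → Bool} (hf : ContinuousOn f (M \ CC l N pos L)) {o} (ho : o ∈ l)
    {a} (ha : a ∈ W o) : f (Q N o (pos o a - 1 / 2) 0) = f (Q N o (pos o a + 1 / 2) 0) := by
  have k := fun {o} (ho : o ∈ l) {a} (ha : a ∈ W o) =>
    And.intro (Q_loc A ho ha (ε := 1 / 2) (by norm_num [abs_of_pos])) (Q_loc A ho ha (ε := -(1 / 2)) (by norm_num [abs_of_pos]))
  simp only [← sub_eq_add_neg] at k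
  have := A.os (fun a d => f (loc a (if d then 1 / 2 else -(1 / 2)))) (fun o ho x hx => ?_) o ho a ha
  · rw [(k ho ha).1, (k ho ha).2]
    rw [if_pos rfl, if_neg (by simp)] at this
    cases a.2
    · simpa using this
    · simpa using this.symm
  · obtain ⟨a1, a2, a3⟩ := A.LW o ho x hx
    have a3' : (pos o x.1 : ℝ) + 1 ≤ pos o x.2 := by exact_mod_cast a3
    have e1 := virt_along H A hf ho hx (δ := 1 / 2) (t := pos o x.2 + 1 / 2) (by norm_num [abs_of_pos]) (by norm_num) (by linarith) le_rfl
    have e2 := virt_along H A hf ho hx (δ := -(1 / 2)) (t := pos o x.2 - 1 / 2) (by norm_num [abs_of_pos]) (by norm_num) (by linarith)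
      (by linarith)
    have t1 : tent (pos o x.1 - 1 / 2) (pos o x.2 + 1 / 2) (pos o x.2 + 1 / 2) = 0 := by
      rw [tent, sub_self, min_eq_right (by linarith)]
    have t2 : tent (pos o x.1 - -(1 / 2)) (pos o x.2 + -(1 / 2)) (pos o x.2 - 1 / 2) = 0 := by
      rw [tent, min_eq_right (by linarith)]; ring
    rw [t1, (k ho a1).2, (k ho a2).1] at e1
    rw [t2, sub_neg_eq_add, (k ho a1).1, (k ho a2).2] at e2
    rcases hx1 : x.1 with ⟨p, d⟩
    rcases hx2 : x.2 with ⟨q, d'⟩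
    rw [hx1, hx2] at e1 e2
    cases d <;> cases d' <;> simp at e1 e2 ⊢ <;> exact ⟨e2, e1⟩

theorem off_base (A : Arr T l N W pos loc L) {o} (ho : o ∈ l) {t : ℝ} (h : ∀ a ∈ W o, t ≠ pos o a) : Off pos L o t 0 :=
  fun x hx _ _ h0 => by
    obtain ⟨a, ha, -, e⟩ := tent_zero A ho hx h0.symm
    exact h a ha e

theorem base_all (H : Tri M T) (A : Arr T l N W pos loc L) {f : F → Bool} (hf : ContinuousOn f (M \ CC l N pos L)) {o} (ho : o ∈ l)
    {t : ℝ} (h0 : 0 ≤ t) (h3 : t ≤ 3 * N) (ht : ∀ a ∈ W o, t ≠ pos o a) : f (Q N o t 0) = f (Q N o (1 / 2) 0) := by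
  have hN : (0 : ℝ) < N := by exact_mod_cast A.N0
  have seg : ∀ a b : ℝ, a ≤ b → 0 ≤ a → b ≤ 3 * N → (∀ r, a ≤ r → r ≤ b → ∀ c ∈ W o, r ≠ pos o c) → f (Q N o a 0) = f (Q N o b 0) :=
    fun a b hab ha hb h => along H A hf ho (g := fun t => t) (h := fun _ => 0) (by fun_prop) (by fun_prop) hab fun r r1 r2 =>
      ⟨⟨by linarith, by linarith, le_rfl, by linarith⟩, off_base A ho (h r r1 r2)⟩
  have key : ∀ k : ℕ, k < 3 * N → f (Q N o (k + 1 / 2) 0) = f (Q N o (1 / 2) 0) := by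
    intro k
    induction k with
    | zero => intro _; simp
    | succ k ih =>
      intro hk
      rw [← ih (by omega)]
      have hk' : ((k + 1 : ℕ) : ℝ) + 1 ≤ 3 * N := by exact_mod_cast hk
      by_cases hp : ∃ a ∈ W o, pos o a = k + 1
      · obtain ⟨a, ha, e⟩ := hp
        have := base_step H A hf ho ha
        rw [e] at this
        rw [← this]; push_cast
        congr 2; ring
      · push Not at hp
        symm
        push_cast at hk' ⊢
        refine seg _ _ (by linarith) (by positivity) (by linarith) fun r r1 r2 c hc e => hp c hc ?_
        have e1 : k < pos o c := by
          have : (k : ℝ) < pos o c := by linarith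
          exact_mod_cast this
        have e2 : pos o c < k + 2 := by
          have : (pos o c : ℝ) < k + 2 := by linarith
          exact_mod_cast this
        omega
  obtain ⟨k, hk, k1, k2⟩ : ∃ k : ℕ, k < 3 * N ∧ (k : ℝ) ≤ t ∧ t ≤ k + 1 := by
    by_cases e : t = 3 * N
    · have := A.N0
      refine ⟨3 * N - 1, by omega, ?_⟩
      rw [Nat.cast_sub (by omega)]; push_cast
      constructor <;> linarith
    · refine ⟨⌊t⌋₊, ?_, Nat.floor_le h0, (Nat.lt_floor_add_one t).le⟩
      have : (⌊t⌋₊ : ℝ) < 3 * N := lt_of_le_of_lt (Nat.floor_le h0) (lt_of_le_of_ne h3 e)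
      exact_mod_cast this
  rw [← key k hk]
  have hk' : (k : ℝ) + 1 ≤ 3 * N := by exact_mod_cast hk
  have np : ∀ r : ℝ, k ≤ r → r ≤ k + 1 → (r = k → t = r) → (r = k + 1 → t = r) → ∀ c ∈ W o, r ≠ pos o c := by
    intro r r1 r2 r3 r4 c hc e
    rw [e] at r1 r2
    have r1' : k ≤ pos o c := by exact_mod_cast r1
    have r2' : pos o c ≤ k + 1 := by exact_mod_cast r2
    obtain e' | e' : pos o c = k ∨ pos o c = k + 1 := by omega
    · exact ht c hc ((r3 (by rw [e, e'])).trans e)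
    · exact ht c hc ((r4 (by rw [e, e']; push_cast; rfl)).trans e)
  rcases le_total t (k + 1 / 2) with h | h
  · exact seg _ _ h h0 (by linarith) fun r r1 r2 => np r (by linarith) (by linarith) (fun e => by linarith) (fun e => by linarith)
  · exact (seg _ _ h (by positivity) h3 fun r r1 r2 => np r (by linarith) (by linarith) (fun e => by linarith) (fun e => by linarith)).symm

theorem tri_all (H : Tri M T) (A : Arr T l N W pos loc L) {f : F → Bool} (hf : ContinuousOn f (M \ CC l N pos L)) {o} (ho : o ∈ l)
    {t s : ℝ} (hb : Box N t s) (hoff : Off pos L o t s) : f (Q N o t s) = f (Q N o (1 / 2) 0) := by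
  classical
  obtain ⟨b1, b2, b3, b4⟩ := hb
  let S := (L o).toFinset.filter fun x => pos o x.1 ≤ t ∧ t ≤ pos o x.2 ∧ tent (pos o x.1) (pos o x.2) t < s
  have hS : ∀ x, x ∈ S ↔ x ∈ L o ∧ pos o x.1 ≤ t ∧ t ≤ pos o x.2 ∧ tent (pos o x.1) (pos o x.2) t < s := fun x => by simp [S]
  have vert : ∀ r0, 0 ≤ r0 → r0 ≤ s → (∀ x ∈ S, tent (pos o x.1) (pos o x.2) t < r0) → f (Q N o t r0) = f (Q N o t s) := by
    intro r0 h0 h1 h2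
    refine along H A hf ho (g := fun _ => t) (h := fun r => r) (by fun_prop) (by fun_prop) h1 fun r r1 r2 =>
      ⟨⟨b1, b2, by linarith, by linarith⟩, fun x hx x1 x2 e => ?_⟩
    rcases r2.lt_or_eq with h | rfl
    · have := h2 x ((hS x).2 ⟨hx, x1, x2, by rw [← e]; exact h⟩)
      linarith
    · exact hoff x hx x1 x2 e
  rcases S.eq_empty_or_nonempty with he | hne
  · rw [← vert 0 le_rfl b3 (by simp [he])]
    refine base_all H A hf ho b1 b2 fun a ha e => ?_
    obtain ⟨x, hx, x1, x2, x3⟩ := end_tent A ho ha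
    rw [← e] at x1 x2 x3
    rcases b3.lt_or_eq with h | rfl
    · have : x ∈ S := (hS x).2 ⟨hx, x1, x2, by rw [← x3]; exact h⟩
      simp [he] at this
    · exact hoff x hx x1 x2 x3
  · obtain ⟨x, hx, hmax⟩ := S.exists_max_image (fun x => tent (pos o x.1) (pos o x.2) t) hne
    obtain ⟨hxL, x1, x2, x3⟩ := (hS x).1 hx
    obtain ⟨δ, d0, d1, d2⟩ : ∃ δ : ℝ, 0 < δ ∧ δ ≤ 1 / 2 ∧ tent (pos o x.1) (pos o x.2) t + δ ≤ s :=
      ⟨min (1 / 2) (s - tent (pos o x.1) (pos o x.2) t), lt_min (by norm_num) (by linarith), min_le_left _ _,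
        by have := min_le_right (1 / 2) (s - tent (pos o x.1) (pos o x.2) t); linarith⟩
    have t0 : 0 ≤ tent (pos o x.1) (pos o x.2) t := le_min (by linarith) (by linarith)
    rw [← vert (tent (pos o x.1) (pos o x.2) t + δ) (by linarith) d2 fun y hy => by have := hmax y hy; linarith]
    have e : tent (pos o x.1) (pos o x.2) t + δ = tent (pos o x.1 - δ) (pos o x.2 + δ) t := by
      unfold tent; rw [← min_add_add_right]; congr 1 <;> ring
    rw [e, ← virt_along H A hf ho hxL (by rw [abs_of_pos d0]; exact d1) d0.ne' (by linarith) (by linarith)]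
    have c : ∀ {a b : ℕ}, a < b → (a : ℝ) + 1 ≤ b := fun h => by exact_mod_cast h
    have k1 := c (A.bd o ho _ (A.LW o ho x hxL).1).1
    push_cast at k1
    refine base_all H A hf ho (by linarith) (by linarith) fun a ha e => ?_
    have g1 : (pos o a : ℝ) < pos o x.1 := by linarith
    have g2 : (pos o x.1 : ℝ) < pos o a + 1 := by linarith
    have g1' : pos o a < pos o x.1 := by exact_mod_cast g1
    have g2' : pos o x.1 < pos o a + 1 := by exact_mod_cast g2
    omega

theorem vert_Q (A : Arr T l N W pos loc L) {o} (ho : o ∈ l) {u : F} (hu : u ∈ tri o) :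
    ∃ t : ℝ, Box N t 0 ∧ Off pos L o t 0 ∧ Q N o t 0 = u := by
  have hN : (0 : ℝ) < N := by exact_mod_cast A.N0
  obtain ⟨a, b, c⟩ := o
  have e := Ps_edge (a, b, c) (r := 0) le_rfl (by norm_num)
  simp only [sub_zero, one_smul, zero_smul, add_zero] at e
  simp only [tri, Finset.mem_insert, Finset.mem_singleton] at hu
  have key : ∀ i : ℕ, (i = 0 ∨ i = N ∨ i = 2 * N) → Box N (i : ℝ) 0 ∧ Off pos L (a, b, c) (i : ℝ) 0 := fun i hi => by
    refine ⟨⟨by positivity, ?_, le_rfl, by positivity⟩, off_base A ho fun x hx e => ?_⟩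
    · exact_mod_cast (by omega : i ≤ 3 * N)
    · have := A.bd _ ho x hx
      have e' : i = pos (a, b, c) x := by exact_mod_cast e
      omega
  rcases hu with rfl | rfl | rfl
  · exact ⟨_, (key 0 (by simp)).1, (key 0 (by simp)).2, by simpa [Q] using e.1⟩
  · refine ⟨_, (key N (by simp)).1, (key N (by simp)).2, ?_⟩
    rw [Q, div_self hN.ne', zero_div]; exact e.2.1
  · refine ⟨_, (key (2 * N) (by simp)).1, (key (2 * N) (by simp)).2, ?_⟩
    rw [Q, zero_div]; push_cast
    rw [mul_div_assoc, div_self hN.ne', mul_one]; exact e.2.2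

theorem vert_nc (H : Tri M T) (A : Arr T l N W pos loc L) {o} (ho : o ∈ l) {u : F} (hu : u ∈ tri o) : u ∈ M \ CC l N pos L := by
  obtain ⟨t, h1, h2, rfl⟩ := vert_Q A ho hu
  refine ⟨(H.cov _).2 ⟨_, A.tm o ho, Q_hull A.N0 (H.c3 _ (A.tm o ho)) h1⟩, fun hC => ?_⟩
  obtain ⟨x, hx, k1, k2, k3⟩ := memC H A ho h1 hC
  exact h2 x hx k1 k2 k3

theorem compl_conn (H : Tri M T) (hM : LC M) (hc : IsPreconnected M) (hT : T.Nonempty) (A : Arr T l N W pos loc L) :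
    IsConnected (M \ CC l N pos L) := by
  classical
  obtain ⟨t0, ht0⟩ := hT
  obtain ⟨o0, ho0, rfl⟩ := A.ts t0 ht0
  refine ⟨⟨o0.1, vert_nc H A ho0 (by simp [tri])⟩, isPreconnected_of_forall_constant fun f hf => ?_⟩
  have hv : ∀ o ∈ l, ∀ u ∈ tri o, f u = f (Q N o (1 / 2) 0) := fun o ho u hu => by
    obtain ⟨t, h1, h2, rfl⟩ := vert_Q A ho hu
    exact tri_all H A hf ho h1 h2
  have hall : ∀ o ∈ l, f (Q N o (1 / 2) 0) = f (Q N o0 (1 / 2) 0) := by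
    by_contra! hcon
    obtain ⟨o1, ho1, hne⟩ := hcon
    obtain ⟨t, ht, t', ht', e, e1, e2, e3⟩ := H.dual hM hc
      (T.filter fun t => ∃ o ∈ l, tri o = t ∧ f (Q N o (1 / 2) 0) = f (Q N o0 (1 / 2) 0)) (Finset.filter_subset _ _)
      ⟨_, Finset.mem_filter.2 ⟨ht0, o0, ho0, rfl, rfl⟩⟩ (fun he => by
        have := A.tm o1 ho1
        rw [← he] at this
        obtain ⟨-, o, ho, h1, h2⟩ := Finset.mem_filter.1 this
        rw [A.ti o ho o1 ho1 h1] at h2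
        exact hne h2)
    obtain ⟨-, o, ho, rfl, ho2⟩ := Finset.mem_filter.1 ht
    obtain ⟨ht'T, hn⟩ := Finset.mem_sdiff.1 ht'
    obtain ⟨o', ho', rfl⟩ := A.ts t' ht'T
    obtain ⟨u, hu⟩ : e.Nonempty := Finset.card_pos.1 (by omega)
    refine hn (Finset.mem_filter.2 ⟨ht'T, o', ho', rfl, ?_⟩)
    rw [← ho2, ← hv o ho u (e1 hu), ← hv o' ho' u (e2 hu)]
  have hx : ∀ x ∈ M \ CC l N pos L, f x = f (Q N o0 (1 / 2) 0) := by
    rintro x ⟨hx, hxC⟩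
    obtain ⟨t, ht, hxt⟩ := (H.cov x).1 hx
    obtain ⟨o, ho, rfl⟩ := A.ts t ht
    obtain ⟨w, hw⟩ := mem_hull.1 hxt
    have hN : (0 : ℝ) < N := by exact_mod_cast A.N0
    obtain ⟨t, s, h1, h2, h3, h4, e⟩ : ∃ t s : ℝ, 0 ≤ t ∧ t ≤ 3 ∧ 0 ≤ s ∧ s ≤ 1 ∧ Ps o t s = x := by
      obtain ⟨a, b, c⟩ := o
      obtain ⟨hab, hac, hbc⟩ := tri3 (H.c3 _ ht)
      exact Ps_surj hab hac hbc hw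
    have hb : Box N (t * N) (s * (3 * N)) := ⟨by positivity, by gcongr, by positivity, by nlinarith⟩
    have e' : Q N o (t * N) (s * (3 * N)) = x := by
      rw [Q, mul_div_assoc, div_self hN.ne', mul_div_assoc, div_self (by positivity), mul_one, mul_one, e]
    rw [← hall o ho, ← e']
    refine tri_all H A hf ho hb fun y hy y1 y2 y3 => hxC ?_
    refine ⟨o, ho, y, hy, t * N, ⟨y1, y2⟩, ?_⟩
    dsimp only
    rw [← y3, e']
  exact fun x h y h' => (hx x h).trans (hx y h').symm
end Arrs
end PaperAlg

namespace PaperAlg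
open Geometry Set
section Rlz
variable {F : Type*} [NormedAddCommGroup F] [NormedSpace ℝ F] [DecidableEq F]

theorem Nst.symm {p q p' q' : ℕ} (h : Nst p q p' q') : Nst p' q' p q := by unfold Nst at *; omega

theorem realize {M : Set F} {T : Finset (Finset F)} (H : Tri M T) (hM : LC M) (hc : IsPreconnected M) (hT : T.Nonempty)
    {lt : F → F → Bool} (hlt : IsLt lt) {l : List (F × F × F)} (hnd : (l.map tri).Nodup) (hl : ∀ t, t ∈ l.map tri ↔ t ∈ T)
    {k : ℕ} (hG : Good k (l.map (bdw lt))) :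
    ∃ m, k ≤ m ∧ ∃ C : Fin m → Set F, (∀ i, C i ⊆ M) ∧ (∀ i j, i ≠ j → Disjoint (C i) (C j)) ∧
      (∀ i, Nonempty (C i ≃ₜ Circle)) ∧ IsConnected (M \ ⋃ i, C i) := by
  classical
  obtain ⟨Lab, pts, Mm, ⟨hn, hu, hv, κ, hκ, hk⟩, hNC⟩ := hG
  have htm : ∀ o ∈ l, tri o ∈ T := fun o ho => (hl _).1 (List.mem_map_of_mem ho)
  have h3 : ∀ o ∈ l, (tri o).card = 3 := fun o ho => H.c3 _ (htm o ho)
  have hln : l.Nodup := hnd.of_map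
  obtain ⟨N, pos, loc, hN, hpl⟩ := place hlt l h3 hn hu
  rw [List.map_map] at hNC
  obtain ⟨Mo, hMo, hMM⟩ := hNC.split hln
  have hex : ∀ o, ∃ Lo : List ((Lab × Bool) × (Lab × Bool)), o ∈ l →
      (Lo.flatMap fun x => [x.1, x.2]).Perm (Ew pts (bdw lt o)) ∧ (∀ x ∈ Lo, pos o x.1 < pos o x.2 ∧ s(x.1, x.2) ∈ Mo o) ∧
      Lo.Pairwise (fun x y => Nst (pos o x.1) (pos o x.2) (pos o y.1) (pos o y.2)) ∧
      ∀ a b, s(a, b) ∈ Mo o → (a, b) ∈ Lo ∨ (b, a) ∈ Lo := fun o => by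
    by_cases ho : o ∈ l
    · obtain ⟨Lo, h⟩ := (hMo o ho).arcs (pos o) (hpl o ho).1
      exact ⟨Lo, fun _ => h⟩
    · exact ⟨[], fun h => absurd h ho⟩
  choose L hL using hex
  have hMa : ∀ o ∈ l, ∀ x ∈ L o, s(x.1, x.2) ∈ Mm := fun o ho x hx => (hMM _).2 ⟨o, ho, ((hL o ho).2.1 x hx).2⟩
  have hMb : ∀ a b, s(a, b) ∈ Mm → ∃ o ∈ l, (a, b) ∈ L o ∨ (b, a) ∈ L o := fun a b h => by
    obtain ⟨o, ho, h⟩ := (hMM _).1 h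
    exact ⟨o, ho, (hL o ho).2.2.2 a b h⟩
  have A : Arr T l N (fun o => Ew pts (bdw lt o)) pos loc L := by
    refine ⟨hN, htm, fun o ho o' ho' e => List.inj_on_of_nodup_map hnd ho ho' e, fun t ht => ?_, fun o ho a ha => ?_, fun o ho a ha => ?_,
      fun o ho a ha b hb e => ?_, fun o ho o' ho' a ha hm => ?_, fun o ho x hx => ?_, fun o ho a ha => ?_, fun o ho x hx y hy => ?_,
      fun v hvv o ho a ha => ?_⟩
    · simpa using (hl t).2 ht
    · obtain ⟨h1, h2, h4, h5, -⟩ := (hpl o ho).2 a ha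
      exact ⟨h1, h2, h4, h5⟩
    · exact ((hpl o ho).2 a ha).2.2.2.2.2
    · by_contra hne
      have : Std.Symm fun a b => pos o a ≠ pos o b := ⟨fun _ _ h => h.symm⟩
      exact ((hpl o ho).1.imp (S := fun a b => pos o a ≠ pos o b) fun h => h.ne).forall ha hb hne e
    · obtain ⟨-, -, -, -, ⟨u, hu', v, hv', r, huv, hp, r0, r1, e⟩, -⟩ := (hpl o' ho').2 a ha
      have hw : Wt (tri o') (fun y => (1 - r) * (Pi.single u 1 : F → ℝ) y + r * (Pi.single v 1 : F → ℝ) y) (loc a.1 0) := by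
        obtain ⟨a1, a2, a3, a4⟩ := Wt_single hu'
        obtain ⟨b1, b2, b3, b4⟩ := Wt_single hv'
        refine ⟨fun y => ?_, fun y hy => by simp only [a2 y hy, b2 y hy]; simp, ?_, ?_⟩
        · exact add_nonneg (mul_nonneg (by linarith) (a1 y)) (mul_nonneg r0.le (b1 y))
        · rw [Finset.sum_add_distrib, ← Finset.mul_sum, ← Finset.mul_sum, a3, b3]; ring
        · simp only [add_smul, mul_smul]
          rw [Finset.sum_add_distrib, ← Finset.smul_sum, ← Finset.smul_sum, a4, b4, e]
      have hw' := (H.wt_inter (htm o' ho') (htm o ho) hw hm).2.1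
      have huo : u ∈ tri o := by
        by_contra hh
        have := hw' u (by simp [hh])
        simp [huv] at this; linarith
      have hvo : v ∈ tri o := by
        by_contra hh
        have := hw' v (by simp [hh])
        simp [huv.symm] at this; linarith
      exact mem_W (h3 o ho) (Finset.card_pair huv) (by intro y hy; simp at hy; rcases hy with rfl | rfl <;> assumption) hp
    · refine ⟨?_, ?_, ((hL o ho).2.1 x hx).1⟩
      · exact (hL o ho).1.mem_iff.1 (List.mem_flatMap.2 ⟨x, hx, by simp⟩)
      · exact (hL o ho).1.mem_iff.1 (List.mem_flatMap.2 ⟨x, hx, by simp⟩)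
    · obtain ⟨x, hx, h⟩ := List.mem_flatMap.1 ((hL o ho).1.mem_iff.2 ha)
      exact ⟨x, hx, by simpa using h⟩
    · by_cases e : x = y
      · exact Or.inl e
      · have : Std.Symm fun x y : (Lab × Bool) × (Lab × Bool) => Nst (pos o x.1) (pos o x.2) (pos o y.1) (pos o y.2) := ⟨fun _ _ h => h.symm⟩
        exact Or.inr ((hL o ho).2.2.1.forall hx hy e)
    · obtain ⟨x, hx, hax⟩ := List.mem_flatMap.1 ha
      refine hv v (fun a b hab => ?_) x.1 a.1 (mem_EE.1 hax).1
      obtain ⟨o, ho, h | h⟩ := hMb a b hab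
      · exact (hvv o ho _ h).1
      · exact (hvv o ho _ h).2.symm
  let LL : List (Set F × Lab × Lab) := l.flatMap fun o => (L o).map fun x => (arc N pos o x, x.1.1, x.2.1)
  have hLL : ∀ y, y ∈ LL ↔ ∃ o ∈ l, ∃ x ∈ L o, (arc N pos o x, x.1.1, x.2.1) = y := fun y => by simp only [LL, List.mem_flatMap, List.mem_map]
  have hends : (ends LL).Perm ((l.flatMap fun o => Ew pts (bdw lt o)).map Prod.fst) := by
    have : ends LL = (l.flatMap fun o => (L o).flatMap fun x => [x.1, x.2]).map Prod.fst := by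
      simp [ends, LL, List.flatMap_assoc, List.map_flatMap, List.flatMap_map]
    rw [this]
    exact (List.Perm.flatMap_left _ fun o ho => (hL o ho).1).map _
  have hcirc := circles (fun v => loc v 0) κ LL.length LL le_rfl (by
      intro y hy; obtain ⟨o, ho, x, hx, rfl⟩ := (hLL y).1 hy; exact arc_arc H A ho hx) (by
      intro y hy; obtain ⟨o, ho, x, hx, rfl⟩ := (hLL y).1 hy; exact hκ _ _ (hMa o ho x hx)) (by
      refine List.pairwise_flatMap.2 ⟨fun o ho => List.pairwise_map.2 ?_, ?_⟩
      · exact (hL o ho).2.2.1.imp_of_mem fun {x y} hx hy h P hP hP' => arc_pair H A ho ho hx hy (Or.inr ⟨rfl, h⟩) hP hP'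
      · refine List.Pairwise.imp_of_mem (fun {o o'} ho ho' hne x hx y hy P hP hP' => ?_) hln
        obtain ⟨x, hx1, rfl⟩ := List.mem_map.1 hx
        obtain ⟨y, hy1, rfl⟩ := List.mem_map.1 hy
        exact arc_pair H A ho ho' hx1 hy1 (Or.inl hne) hP hP') (by
      intro v hv
      have hpos := List.count_pos_iff.2 hv
      rw [hends.count_eq] at hpos ⊢
      obtain ⟨a, ha, rfl⟩ := List.mem_map.1 (hends.mem_iff.1 hv)
      obtain ⟨o, ho, ha⟩ := List.mem_flatMap.1 ha
      obtain ⟨-, -, -, -, ⟨u, hu', v, hv', r, huv, hp, -⟩, -⟩ := (hpl o ho).2 a ha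
      have hcc := Finset.card_pair huv
      rw [bdw_cnt hnd hl h3 hn hu hcc hp] at hpos ⊢
      have := H.two _ hcc
      omega)
  obtain ⟨Cs, hd, hcs, hun, hcol⟩ := hcirc
  have hU : (⋃ i : Fin Cs.length, (Cs.get i).1) = CC l N pos L := by
    ext P
    rw [mem_iUnion]
    have h1 : (∃ i : Fin Cs.length, P ∈ (Cs.get i).1) ↔ ∃ c ∈ Cs, P ∈ c.1 := by
      constructor
      · rintro ⟨i, h⟩; exact ⟨_, List.get_mem _ _, h⟩
      · rintro ⟨c, hc, h⟩; obtain ⟨i, rfl⟩ := List.get_of_mem hc; exact ⟨i, h⟩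
    rw [h1, hun]
    constructor
    · rintro ⟨y, hy, h⟩; obtain ⟨o, ho, x, hx, rfl⟩ := (hLL y).1 hy; exact ⟨o, ho, x, hx, h⟩
    · rintro ⟨o, ho, x, hx, h⟩; exact ⟨_, (hLL _).2 ⟨o, ho, x, hx, rfl⟩, h⟩
  refine ⟨Cs.length, ?_, fun i => (Cs.get i).1, fun i => ?_, fun i j hij => ?_, fun i => hcs _ (List.get_mem _ _), ?_⟩
  · have hsub : Finset.range k ⊆ (Cs.map Prod.snd).toFinset := by
      intro j hj
      obtain ⟨x, a, ha, rfl⟩ := hk j (Finset.mem_range.1 hj)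
      obtain ⟨o, ho, y, hy, e⟩ : ∃ o ∈ l, ∃ y ∈ L o, κ y.1.1 = κ a := by
        by_contra! hno
        have hnn : ∀ c d, s(c, d) ∈ Mm → c.1 ≠ a := fun c d hcd e => by
          obtain ⟨o, ho, h | h⟩ := hMb c d hcd
          · exact hno o ho _ h (by rw [e])
          · exact hno o ho _ h (by rw [← e]; exact (hκ c d hcd).symm)
        have := hv (fun b d => decide (b = a) && d) (fun c d hcd => by
          have e1 := hnn c d hcd
          have e2 := hnn d c (by rwa [Sym2.eq_swap])
          simp [e1, e2]) x a ha
        simp at this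
      obtain ⟨c, hc, e'⟩ := hcol _ ((hLL _).2 ⟨o, ho, y, hy, rfl⟩)
      rw [List.mem_toFinset, List.mem_map]
      exact ⟨c, hc, e'.trans e⟩
    have h1 := Finset.card_le_card hsub
    have h2 := List.toFinset_card_le (Cs.map Prod.snd)
    simp only [Finset.card_range, List.length_map] at h1 h2
    omega
  · intro P hP
    have : P ∈ CC l N pos L := hU ▸ mem_iUnion.2 ⟨i, hP⟩
    obtain ⟨o, ho, x, hx, t, ht, rfl⟩ := this
    exact (H.cov _).2 ⟨_, htm o ho, Q_hull hN (h3 o ho) (tent_box A ho hx ht.1 ht.2).1⟩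
  · rw [List.pairwise_iff_get] at hd
    rcases lt_or_gt_of_ne hij with h | h
    · exact hd i j h
    · exact (hd j i h).symm
  · rw [hU]; exact compl_conn H hM hc hT A
end Rlz

noncomputable def sphCircle : Metric.sphere (0 : EuclideanSpace ℝ (Fin 2)) 1 ≃ₜ Circle :=
  (Complex.orthonormalBasisOneI.repr.toHomeomorph.sets (s := Metric.sphere (0 : ℂ) 1) (t := Metric.sphere 0 1) (by
    ext x; simp)).symm.trans (Homeomorph.setCongr (by ext x; simp [Submonoid.unitSphere]))
end PaperAlg

namespace PaperAlg
open Geometry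
variable {n : ℕ}
theorem genus_closed_nonorientable (K : SimplicialComplex ℝ (Pt n))
    (hfin : K.faces.Finite) (hdim : TwoDimensional K)
    (hconn : IsConnected K.space) (hlp : LocallyPlanar K)
    (hnobd : ∀ e ∈ K.faces, e.card = 2 → IsInteriorEdge K e)
    (hor : ¬ Orientable K) :
    (genus ↥K.space : ℤ) = 2 - eulerChar K := by
  classical
  obtain ⟨T, hT, hTn, H, he⟩ := K_main K hfin hdim hconn hnobd hor
  have hM := lc_of_planar K hlp
  have hdual := H.dual hM hconn.isPreconnected
  obtain ⟨b, hb, ⟨Φ, h1, h2⟩, hmax⟩ := b_char hTn H.c3 H.two hdual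
  obtain ⟨lt, hlt⟩ := exists_lt (Pt n)
  obtain ⟨l, hnd, hl, hG⟩ := main_comb hlt hTn H.c3 H.two hdual (fun v h hh => H.link hM v h hh)
    (fun ⟨l, k1, k2, k3⟩ => hor (orient_of_list hT H.two hlt l k1 k2 k3)) Φ h1 h2
  obtain ⟨m, hm, C, c1, c2, c3, c4⟩ := realize H hM hconn.isPreconnected hTn hlt hnd hl hG
  have hup : ∀ k ∈ {m : ℕ | ∃ C : Fin m → Set K.space, (Pairwise fun i j => Disjoint (C i) (C j)) ∧
      (∀ i, Nonempty (↥(C i) ≃ₜ ↥(Metric.sphere (0 : EuclideanSpace ℝ (Fin 2)) 1))) ∧ IsConnected (⋃ i, C i)ᶜ}, k ≤ b := by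
    rintro k ⟨D, d1, d2, d3⟩
    obtain ⟨Ψ, p1, p2⟩ := upper H hM (fun i => Subtype.val '' D i) (fun i => by rintro _ ⟨x, -, rfl⟩; exact x.2)
      (fun i j hij => (Set.disjoint_image_iff Subtype.val_injective).2 (d1 hij))
      (fun i => ((Topology.IsEmbedding.subtypeVal.homeomorphImage (D i)).symm.trans (d2 i).some).trans sphCircle) (by
        have : K.space \ ⋃ i, Subtype.val '' D i = Subtype.val '' (⋃ i, D i)ᶜ := by
          ext x
          simp only [Set.mem_diff, Set.mem_iUnion, Set.mem_image, Set.mem_compl_iff]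
          constructor
          · rintro ⟨hx, h⟩
            exact ⟨⟨x, hx⟩, fun ⟨i, hi⟩ => h ⟨i, _, hi, rfl⟩, rfl⟩
          · rintro ⟨y, hy, rfl⟩
            exact ⟨y.2, fun ⟨i, z, hz, e⟩ => hy ⟨i, Subtype.val_injective e ▸ hz⟩⟩
        rw [this]
        exact d3.image _ continuous_subtype_val.continuousOn)
    exact hmax k Ψ p1 p2
  have hin : m ∈ {m : ℕ | ∃ C : Fin m → Set K.space, (Pairwise fun i j => Disjoint (C i) (C j)) ∧
      (∀ i, Nonempty (↥(C i) ≃ₜ ↥(Metric.sphere (0 : EuclideanSpace ℝ (Fin 2)) 1))) ∧ IsConnected (⋃ i, C i)ᶜ} := by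
    have him : ∀ i, Subtype.val '' (Subtype.val ⁻¹' C i : Set K.space) = C i := fun i => by
      rw [Subtype.image_preimage_coe]; exact Set.inter_eq_right.2 (c1 i)
    refine ⟨fun i => Subtype.val ⁻¹' C i, fun i j hij => (c2 i j hij).preimage _, fun i => ⟨?_⟩, ?_⟩
    · exact ((Topology.IsEmbedding.subtypeVal.homeomorphImage _).trans (Homeomorph.setCongr (him i))).trans
        ((c3 i).some.trans sphCircle.symm)
    · have e : Subtype.val '' (⋃ i, Subtype.val ⁻¹' C i : Set K.space)ᶜ = K.space \ ⋃ i, C i := by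
        rw [← Set.preimage_iUnion, ← Set.preimage_compl, Subtype.image_preimage_coe]; rfl
      refine ⟨?_, ?_⟩
      · rw [← Set.image_nonempty (f := Subtype.val), e]; exact c4.1
      · rw [← Topology.IsInducing.subtypeVal.isPreconnected_image, e]; exact c4.2
  have hg : genus ↥K.space = b := by
    apply le_antisymm
    · exact csSup_le' hup
    · exact hm.trans (le_csSup ⟨b, hup⟩ hin)
  rw [hg, hb, he]

end PaperAlg
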